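/- Assume the Framework, with Θ a stable orbit equivalence between α and β. Suppose that Γ₁ and Λ₁ are measure equivalent via a coupling of generalized index 1; that Γ₁ is not measure equivalent to any Γ_p for p ≠ 1 nor to any Λ_q for q ≠ 1; and that every measure equivalence self-coupling of Γ₁ with itself has generalized index 1 (i.e. I_ME(Γ₁) = {1}). Then Θ is in fact an orbit equivalence between α and β, and the restrictions α|Γ₁ and β|Λ₁ are orbit equivalent. -/

import Mathlib

open MeasureTheory

/-- A countable Borel equivalence relation on `X`, defined on a Borel domain `dom`:
it is Borel as a subset of `X × X`, is an equivalence relation on `dom`, and has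
countable classes. -/
structure CBER (X : Type) [MeasurableSpace X] where
  dom : Set X
  dom_meas : MeasurableSet dom
  rel : X → X → Prop
  rel_meas : MeasurableSet {p : X × X | rel p.1 p.2}
  rel_dom : ∀ {x y : X}, rel x y → x ∈ dom ∧ y ∈ dom
  refl : ∀ x ∈ dom, rel x x
  symm : ∀ {x y : X}, rel x y → rel y x
  trans : ∀ {x y z : X}, rel x y → rel y z → rel x z
  countable_classes : ∀ x : X, {y | rel x y}.Countable

/-- The class of `x`. -/
def CBER.cls {X : Type} [MeasurableSpace X] (R : CBER X) (x : X) : Set X := {y | R.rel x y}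

/-- The `R`-saturation of a set `A`: the union of the `R`-classes meeting `A`. -/
def CBER.sat {X : Type} [MeasurableSpace X] (R : CBER X) (A : Set X) : Set X :=
  {y | ∃ x ∈ A, R.rel x y}

/-- A complete section: a Borel subset of the domain meeting every class. -/
def CBER.IsCompleteSection {X : Type} [MeasurableSpace X] (R : CBER X) (A : Set X) : Prop :=
  MeasurableSet A ∧ A ⊆ R.dom ∧ ∀ x ∈ R.dom, ∃ y ∈ A, R.rel x y

/-- A smooth CBER: one admitting a Borel fundamental domain (a Borel set meeting
every class exactly once). -/
def CBER.Smooth {X : Type} [MeasurableSpace X] (R : CBER X) : Prop :=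
  ∃ D : Set X, MeasurableSet D ∧ D ⊆ R.dom ∧ ∀ x ∈ R.dom, ∃! y, y ∈ D ∧ R.rel x y

/-- Smoothness of the restriction `R|A`. -/
def CBER.SmoothOn {X : Type} [MeasurableSpace X] (R : CBER X) (A : Set X) : Prop :=
  ∃ D : Set X, MeasurableSet D ∧ D ⊆ A ∧ ∀ x ∈ R.dom ∩ A, ∃! y, y ∈ D ∧ R.rel x y

/-- All classes are finite. -/
def CBER.FiniteClasses {X : Type} [MeasurableSpace X] (R : CBER X) : Prop :=
  ∀ x ∈ R.dom, (R.cls x).Finite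

/-- Aperiodic: all classes are infinite (on the domain). -/
def CBER.Aperiodic {X : Type} [MeasurableSpace X] (R : CBER X) : Prop :=
  ∀ x ∈ R.dom, (R.cls x).Infinite

/-- Trivial: all classes are singletons. -/
def CBER.TrivialClasses {X : Type} [MeasurableSpace X] (R : CBER X) : Prop :=
  ∀ x y, R.rel x y → x = y

/-- The restriction `R|U` of `R` to a Borel set `U`. -/
def CBER.restrict {X : Type} [MeasurableSpace X] (R : CBER X) (U : Set X)
    (hU : MeasurableSet U) : CBER X where
  dom := R.dom ∩ U
  dom_meas := R.dom_meas.inter hU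
  rel x y := R.rel x y ∧ x ∈ U ∧ y ∈ U
  rel_meas := by
    have h : {p : X × X | R.rel p.1 p.2 ∧ p.1 ∈ U ∧ p.2 ∈ U} =
        {p : X × X | R.rel p.1 p.2} ∩ (Prod.fst ⁻¹' U ∩ Prod.snd ⁻¹' U) := by
      ext p
      simp only [Set.mem_setOf_eq, Set.mem_inter_iff, Set.mem_preimage, and_assoc]
    rw [h]
    exact R.rel_meas.inter ((measurable_fst hU).inter (measurable_snd hU))
  rel_dom := fun h => ⟨⟨(R.rel_dom h.1).1, h.2.1⟩, ⟨(R.rel_dom h.1).2, h.2.2⟩⟩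
  refl := fun x hx => ⟨R.refl x hx.1, hx.2, hx.2⟩
  symm := fun h => ⟨R.symm h.1, h.2.2, h.2.1⟩
  trans := fun h h' => ⟨R.trans h.1 h'.1, h.2.1, h'.2.2⟩
  countable_classes := fun x =>
    Set.Countable.mono (fun y hy => hy.1) (R.countable_classes x)

/-- `S` is a subrelation of `R`. -/
def CBER.IsSubrelOf {X : Type} [MeasurableSpace X] (S R : CBER X) : Prop :=
  S.dom ⊆ R.dom ∧ ∀ x y, S.rel x y → R.rel x y

/-- A partial Borel isomorphism between Borel subsets `src` and `tgt` of `X`. -/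
structure PBI (X : Type) [MeasurableSpace X] where
  src : Set X
  tgt : Set X
  src_meas : MeasurableSet src
  tgt_meas : MeasurableSet tgt
  toFun : X → X
  invFun : X → X
  meas_toFun : Measurable toFun
  meas_invFun : Measurable invFun
  mapsTo : Set.MapsTo toFun src tgt
  mapsTo_inv : Set.MapsTo invFun tgt src
  left_inv : ∀ x ∈ src, invFun (toFun x) = x
  right_inv : ∀ y ∈ tgt, toFun (invFun y) = y

/-- Membership in the full pseudogroup `[[R]]`: a partial Borel isomorphism whose
graph is contained in `R`. -/
def CBER.InPseudogroup {X : Type} [MeasurableSpace X] (R : CBER X) (φ : PBI X) : Prop :=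
  φ.src ⊆ R.dom ∧ ∀ x ∈ φ.src, R.rel x (φ.toFun x)

/-- Two subrelations `S₁`, `S₂` of `R` are inner conjugate in `R` if some element of the
full pseudogroup of `R` with domain `D(S₂)` and target `D(S₁)` conjugates one to the other. -/
def InnerConjugate {X : Type} [MeasurableSpace X] (R S₁ S₂ : CBER X) : Prop :=
  ∃ φ : PBI X, R.InPseudogroup φ ∧ φ.src = S₂.dom ∧ φ.tgt = S₁.dom ∧
    ∀ x ∈ φ.src, ∀ y ∈ φ.src, (S₂.rel x y ↔ S₁.rel (φ.toFun x) (φ.toFun y))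

/-- `R` preserves the measure `μ`: every element of its full pseudogroup preserves `μ`. -/
def CBER.IsPMP {X : Type} [MeasurableSpace X] (R : CBER X) (μ : Measure X) : Prop :=
  ∀ φ : PBI X, R.InPseudogroup φ → ∀ A : Set X, A ⊆ φ.src → MeasurableSet A →
    μ (φ.toFun '' A) = μ A

/-- Free independence of a family of equivalence relations: any cycle alternating
nontrivially among the factors must have two consecutive steps in the same factor. -/
def FreelyIndep {X : Type} [MeasurableSpace X] {ι : Type} (Rf : ι → CBER X) : Prop :=
  ∀ (n : ℕ) (x : ℕ → X) (i : ℕ → ι), 2 ≤ n → x n = x 0 →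
    (∀ j < n, x j ≠ x (j + 1)) → (∀ j < n, (Rf (i j)).rel (x j) (x (j + 1))) →
    ∃ j, j + 1 < n ∧ i j = i (j + 1)

/-- `R` is the free product of the family `Rf`: the family is freely independent and `R`
is the smallest equivalence relation on the union of the domains containing every `Rf i`. -/
def IsFreeProduct {X : Type} [MeasurableSpace X] {ι : Type} (R : CBER X)
    (Rf : ι → CBER X) : Prop :=
  FreelyIndep Rf ∧ R.dom = (⋃ i, (Rf i).dom) ∧
    ∀ x y, R.rel x y ↔
      (x ∈ R.dom ∧ Relation.EqvGen (fun a b => ∃ i, (Rf i).rel a b) x y)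

/-- The partition `U = ⊔ⱼ Uⱼ` trivializes the free product decomposition `R = *ⱼ Rf j`:
`U` is a complete section for `R`, the partition is `R|U`-invariant, and
`R|Uⱼ = (Rf j)|Uⱼ` for every `j`. -/
def Trivializes {X : Type} [MeasurableSpace X] {ι : Type}
    (R : CBER X) (Rf : ι → CBER X) (U : ι → Set X) : Prop :=
  (∀ j, MeasurableSet (U j)) ∧ (∀ j, U j ⊆ R.dom) ∧
  Pairwise (Function.onFun Disjoint U) ∧
  (∀ x ∈ R.dom, ∃ y ∈ ⋃ j, U j, R.rel x y) ∧
  (∀ i j : ι, ∀ x ∈ U i, ∀ y ∈ U j, R.rel x y → i = j) ∧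
  (∀ j, ∀ x ∈ U j, ∀ y ∈ U j, (R.rel x y ↔ (Rf j).rel x y))

/-- A free product decomposition is inessential if it admits a trivialization. -/
def Inessential {X : Type} [MeasurableSpace X] {ι : Type}
    (R : CBER X) (Rf : ι → CBER X) : Prop :=
  ∃ U : ι → Set X, Trivializes R Rf U

/-- Freely indecomposable (Borel context): every free product decomposition is inessential. -/
def FreelyIndecomposable {X : Type} [MeasurableSpace X] (R : CBER X) : Prop :=
  ∀ (ι : Type) (_ : Countable ι) (Rf : ι → CBER X), IsFreeProduct R Rf → Inessential R Rf

/-- Inessential decomposition in the measured context: a trivialization up to `μ`-null sets. -/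
def InessentialMod {X : Type} [MeasurableSpace X] (μ : Measure X) {ι : Type}
    (R : CBER X) (Rf : ι → CBER X) : Prop :=
  ∃ (U : ι → Set X) (C : Set X),
    (∀ j, MeasurableSet (U j)) ∧ (∀ j, U j ⊆ R.dom) ∧
    Pairwise (Function.onFun Disjoint U) ∧
    MeasurableSet C ∧ μ Cᶜ = 0 ∧
    (∀ x ∈ R.dom ∩ C, ∃ y ∈ ⋃ j, U j, R.rel x y) ∧
    (∀ i j : ι, ∀ x ∈ U i ∩ C, ∀ y ∈ U j ∩ C, R.rel x y → i = j) ∧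
    (∀ j, ∀ x ∈ U j ∩ C, ∀ y ∈ U j ∩ C, (R.rel x y ↔ (Rf j).rel x y))

/-- Freely indecomposable (measured context): every free product decomposition is
inessential up to `μ`-null sets. -/
def FreelyIndecomposableMod {X : Type} [MeasurableSpace X] (μ : Measure X)
    (R : CBER X) : Prop :=
  ∀ (ι : Type) (_ : Countable ι) (Rf : ι → CBER X), IsFreeProduct R Rf →
    InessentialMod μ R Rf

/-- One step of a word in a graphing: apply `φ` (if `e = true`) or `φ⁻¹` (if `e = false`). -/
def PBIStep {X : Type} [MeasurableSpace X] (φ : PBI X) : Bool → X → X → Prop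
  | true, a, b => a ∈ φ.src ∧ φ.toFun a = b
  | false, a, b => a ∈ φ.tgt ∧ φ.invFun a = b

/-- A treeing: any cyclic word in the generators and their inverses admits a reduction. -/
def IsTreeing {X : Type} [MeasurableSpace X] {ι : Type} (Φ : ι → PBI X) : Prop :=
  ∀ (n : ℕ) (i : ℕ → ι) (ε : ℕ → Bool) (x : ℕ → X),
    0 < n → x n = x 0 → (∀ j < n, PBIStep (Φ (i j)) (ε j) (x j) (x (j + 1))) →
    ∃ j, j + 1 < n ∧ i j = i (j + 1) ∧ ε j ≠ ε (j + 1)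

/-- The graphing `Φ` generates `R`: `R` is the smallest equivalence relation on the union of
the sources and targets containing the graphs of the `Φ i`. -/
def GeneratesCBER {X : Type} [MeasurableSpace X] {ι : Type} (Φ : ι → PBI X)
    (R : CBER X) : Prop :=
  R.dom = (⋃ i, ((Φ i).src ∪ (Φ i).tgt)) ∧ (∀ i, R.InPseudogroup (Φ i)) ∧
    ∀ x y, R.rel x y ↔ (x ∈ R.dom ∧
      Relation.EqvGen (fun a b => ∃ i, a ∈ (Φ i).src ∧ (Φ i).toFun a = b) x y)

/-- Treeable: generated by some (countable) treeing. -/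
def CBER.Treeable {X : Type} [MeasurableSpace X] (R : CBER X) : Prop :=
  ∃ Φ : ℕ → PBI X, IsTreeing Φ ∧ GeneratesCBER Φ R

/-- Hyperfinite: increasing union of finite Borel subrelations. -/
def CBER.Hyperfinite {X : Type} [MeasurableSpace X] (R : CBER X) : Prop :=
  ∃ S : ℕ → CBER X, (∀ n, (S n).IsSubrelOf R) ∧ (∀ n, (S n).FiniteClasses) ∧
    (∀ n, (S n).dom = R.dom) ∧ (∀ n, ∀ x y, (S n).rel x y → (S (n + 1)).rel x y) ∧
    ∀ x y, R.rel x y → ∃ n, (S n).rel x y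

/-- Ergodicity of a measured CBER: every invariant Borel set is null or conull. -/
def ErgodicCBER {X : Type} [MeasurableSpace X] (R : CBER X) (μ : Measure X) : Prop :=
  ∀ A : Set X, MeasurableSet A → (∀ x ∈ A, ∀ y, R.rel x y → y ∈ A) →
    μ A = 0 ∨ μ Aᶜ = 0

/-- A stable orbit equivalence between measured CBERs: a Borel isomorphism between
complete sections (mod null sets), sending the normalized measure to the normalized
measure, and preserving the relations a.e. -/
structure SOEquiv {X Y : Type} [MeasurableSpace X] [MeasurableSpace Y]
    (R : CBER X) (μ : Measure X) (S : CBER Y) (ν : Measure Y) where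
  A : Set X
  B : Set Y
  toFun : X → Y
  invFun : Y → X
  measA : MeasurableSet A
  measB : MeasurableSet B
  A_sub : A ⊆ R.dom
  B_sub : B ⊆ S.dom
  A_pos : 0 < μ A
  B_pos : 0 < ν B
  A_section : ∀ᵐ x ∂μ, x ∈ R.dom → ∃ y ∈ A, R.rel x y
  B_section : ∀ᵐ y ∂ν, y ∈ S.dom → ∃ z ∈ B, S.rel y z
  meas_toFun : Measurable toFun
  meas_invFun : Measurable invFun
  mapsTo : Set.MapsTo toFun A B
  mapsTo_inv : Set.MapsTo invFun B A
  left_inv : ∀ x ∈ A, invFun (toFun x) = x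
  right_inv : ∀ y ∈ B, toFun (invFun y) = y
  measure_eq : ∀ E : Set X, E ⊆ A → MeasurableSet E →
    (μ A)⁻¹ * μ E = (ν B)⁻¹ * ν (toFun '' E)
  rel_iff : ∃ C : Set X, MeasurableSet C ∧ μ (A \ C) = 0 ∧
    ∀ x ∈ A ∩ C, ∀ y ∈ A ∩ C, (R.rel x y ↔ S.rel (toFun x) (toFun y))

/-- Stable orbit equivalence. -/
def SOE {X Y : Type} [MeasurableSpace X] [MeasurableSpace Y]
    (R : CBER X) (μ : Measure X) (S : CBER Y) (ν : Measure Y) : Prop :=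
  Nonempty (SOEquiv R μ S ν)

/-- Orbit equivalence: a stable orbit equivalence where one can take the complete
sections to be the full spaces. -/
def OE {X Y : Type} [MeasurableSpace X] [MeasurableSpace Y]
    (R : CBER X) (μ : Measure X) (S : CBER Y) (ν : Measure Y) : Prop :=
  ∃ E : SOEquiv R μ S ν, E.A = Set.univ ∧ E.B = Set.univ

/-- A probability measure preserving action of a group `G` on a measured space. -/
structure PMPAction (G : Type) [Group G] (X : Type) [MeasurableSpace X]
    (μ : Measure X) where
  act : G → X → X
  act_one : ∀ x, act 1 x = x
  act_mul : ∀ g h x, act (g * h) x = act g (act h x)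
  measurePreserving : ∀ g, MeasurePreserving (act g) μ μ

/-- Essential freeness: a.e. point has trivial stabilizer. -/
def PMPAction.IsFree {G X : Type} [Group G] [MeasurableSpace X] {μ : Measure X}
    (α : PMPAction G X μ) : Prop :=
  ∀ᵐ x ∂μ, ∀ g : G, α.act g x = x → g = 1

/-- `R` is the orbit equivalence relation of the action `α` restricted to the subgroup `H`. -/
def IsOrbitRel {G X : Type} [Group G] [MeasurableSpace X] {μ : Measure X}
    (α : PMPAction G X μ) (H : Subgroup G) (R : CBER X) : Prop :=
  R.dom = Set.univ ∧ ∀ x y, (R.rel x y ↔ ∃ g ∈ H, α.act g x = y)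

/-- A countable group is measurably freely indecomposable (MFI) if the orbit equivalence
relation of every free p.m.p. action of it on a standard probability space is freely
indecomposable. -/
def MFI (G : Type) [Group G] [Countable G] : Prop :=
  ∀ (X : Type) [MeasurableSpace X] [StandardBorelSpace X]
    (μ : Measure X) [IsProbabilityMeasure μ]
    (α : PMPAction G X μ) (R : CBER X),
    α.IsFree → IsOrbitRel α ⊤ R → FreelyIndecomposableMod μ R

/-- `G` is the internal free product of the family of subgroups `H`. -/
def IsFreeProductOf (G : Type) [Group G] {ι : Type} (H : ι → Subgroup G) : Prop :=
  Function.Bijective (Monoid.CoprodI.lift fun i => (H i).subtype)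

/-- A Borel fundamental domain for an action, of the coupling kind: meets a.e. orbit,
and meets each orbit at most once mod null. -/
def IsFundamentalDomainFor {G : Type} [Group G] {Ω : Type} [MeasurableSpace Ω]
    (ν : Measure Ω) (a : G → Ω → Ω) (D : Set Ω) : Prop :=
  MeasurableSet D ∧ (∀ᵐ x ∂ν, ∃ g : G, a g x ∈ D) ∧
    ∀ g : G, g ≠ 1 → ν (D ∩ a g ⁻¹' D) = 0

/-- A measure equivalence coupling between `G` and `H`: a standard σ-finite measure space
with commuting measure-preserving essentially free actions of `G` and `H`, each admitting
a Borel fundamental domain of finite positive measure. -/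
structure MECoupling (G : Type) [Group G] (H : Type) [Group H] where
  (Ω : Type)
  [mΩ : MeasurableSpace Ω]
  [sbΩ : StandardBorelSpace Ω]
  (ν : Measure Ω)
  sigmaFinite : SigmaFinite ν
  aG : G → Ω → Ω
  aH : H → Ω → Ω
  DG : Set Ω
  DH : Set Ω
  aG_one : ∀ x, aG 1 x = x
  aG_mul : ∀ g g' x, aG (g * g') x = aG g (aG g' x)
  aH_one : ∀ x, aH 1 x = x
  aH_mul : ∀ h h' x, aH (h * h') x = aH h (aH h' x)
  comm : ∀ g h x, aG g (aH h x) = aH h (aG g x)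
  mp_aG : ∀ g, MeasurePreserving (aG g) ν ν
  mp_aH : ∀ h, MeasurePreserving (aH h) ν ν
  free_aG : ∀ᵐ x ∂ν, ∀ g, aG g x = x → g = 1
  free_aH : ∀ᵐ x ∂ν, ∀ h, aH h x = x → h = 1
  fund_DG : IsFundamentalDomainFor ν aG DG
  fund_DH : IsFundamentalDomainFor ν aH DH
  DG_pos : 0 < ν DG
  DG_fin : ν DG < ⊤
  DH_pos : 0 < ν DH
  DH_fin : ν DH < ⊤

/-- The generalized index (compression constant) of a measure equivalence coupling. -/
noncomputable def MECoupling.index {G : Type} [Group G] {H : Type} [Group H]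
    (c : MECoupling G H) : ENNReal :=
  c.ν c.DH / c.ν c.DG

/-- Measure equivalence of countable groups. -/
def MeasureEquivalent (G : Type) [Group G] (H : Type) [Group H] : Prop :=
  Nonempty (MECoupling G H)

/-- Measure equivalence with a prescribed generalized index. -/
def MEwithIndex (G : Type) [Group G] (H : Type) [Group H] (κ : ENNReal) : Prop :=
  ∃ c : MECoupling G H, c.index = κ

/-! ### Gates: a combinatorial criterion for free independence -/

/-- A family of relations is gated if every class of every member is a retract of the whole set
through a map which is constant along each step lying outside that class. -/
def Gated {V ι : Type} (S : ι → V → V → Prop) : Prop :=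
  ∀ i a, ∃ π : V → V, (∀ y, S i a y → π y = y) ∧ (∀ y, S i a (π y)) ∧
    ∀ k y y', S k y y' → ¬(k = i ∧ S i a y) → π y = π y'

/-- Free independence of a family of bare relations. -/
def FreeRel {V ι : Type} (S : ι → V → V → Prop) : Prop :=
  ∀ (n : ℕ) (x : ℕ → V) (i : ℕ → ι), 2 ≤ n → x n = x 0 →
    (∀ j < n, x j ≠ x (j + 1)) → (∀ j < n, S (i j) (x j) (x (j + 1))) →
    ∃ j, j + 1 < n ∧ i j = i (j + 1)

theorem Gated.freeRel {V ι : Type} {S : ι → V → V → Prop} (hS : ∀ i, Equivalence (S i))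
    (hg : Gated S) : FreeRel S := by
  intro n
  induction n using Nat.strong_induction_on with
  | _ n ih =>
  intro x i hn hx hne hst
  by_contra hcon
  push Not at hcon
  obtain ⟨π, h1, h2, h3⟩ := hg (i 0) (x 0)
  have hx0 : π (x 0) = x 0 := h1 _ ((hS _).refl _)
  have hx1 : π (x 1) = x 1 := h1 _ (hst 0 (by omega))
  have hex : ∃ j, 1 ≤ j ∧ j < n ∧ π (x j) ≠ π (x (j + 1)) := by
    by_contra hno
    push Not at hno
    have hc : ∀ m, 1 ≤ m → m ≤ n → π (x m) = x 1 := by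
      intro m hm
      induction m, hm using Nat.le_induction with
      | base => intro _; exact hx1
      | succ m hm ihm => intro hmn; rw [← hno m hm (by omega)]; exact ihm (by omega)
    have := hc n (by omega) le_rfl
    rw [hx, hx0] at this
    exact hne 0 (by omega) this
  classical
  obtain ⟨hj1, hjn, hjne⟩ := Nat.find_spec hex
  set j := Nat.find hex with hj
  have hmin : ∀ m, 1 ≤ m → m < j → π (x m) = π (x (m + 1)) := by
    intro m hm hmj
    have := Nat.find_min hex hmj
    push Not at this
    exact this hm (by omega)
  have hc : ∀ m, 1 ≤ m → m ≤ j → π (x m) = x 1 := by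
    intro m hm
    induction m, hm using Nat.le_induction with
    | base => intro _; exact hx1
    | succ m hm ihm => intro hmn; rw [← hmin m hm (by omega)]; exact ihm (by omega)
  have hin : i j = i 0 ∧ S (i 0) (x 0) (x j) := by
    by_contra hno
    exact hjne (h3 _ _ _ (hst j hjn) hno)
  have hxj : x j = x 1 := by rw [← hc j hj1 le_rfl, h1 _ hin.2]
  have hj2 : j ≠ 1 := by
    intro h
    have := hcon 0 (by omega)
    rw [h] at hin
    exact this hin.1.symm
  have hj3 : j ≠ 2 := by
    intro h
    rw [h] at hxj
    exact hne 1 (by omega) hxj.symm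
  obtain ⟨m, hm, hmm⟩ := ih (j - 1) (by omega) (fun m => x (m + 1)) (fun m => i (m + 1)) (by omega)
    (by simpa [Nat.sub_add_cancel hj1] using hxj) (fun m hm => hne (m + 1) (by omega))
    (fun m hm => hst (m + 1) (by omega))
  exact hcon (m + 1) (by omega) hmm

/-- `ReducedFrom S i z y l`: there is a reduced path from `z` to `y`, not starting with the label
`i`, with last label `l`; the empty path has label `i`. -/
inductive ReducedFrom {V ι : Type} (S : ι → V → V → Prop) (i : ι) (z : V) : V → ι → Prop
  | base : ReducedFrom S i z z i
  | snoc {y y' l k} : ReducedFrom S i z y l → k ≠ l → S k y y' → y ≠ y' → ReducedFrom S i z y' k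

theorem ReducedFrom.exists_seq {V ι : Type} {S : ι → V → V → Prop} {i : ι} {z y : V} {l : ι}
    (h : ReducedFrom S i z y l) : ∃ (n : ℕ) (x : ℕ → V) (lab : ℕ → ι), x 0 = z ∧ x n = y ∧
      lab 0 = i ∧ lab n = l ∧ (∀ j < n, x j ≠ x (j + 1)) ∧
      (∀ j < n, S (lab (j + 1)) (x j) (x (j + 1))) ∧ ∀ j < n, lab j ≠ lab (j + 1) := by
  induction h with
  | base => exact ⟨0, fun _ => z, fun _ => i, rfl, rfl, rfl, rfl, by simp, by simp, by simp⟩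
  | @snoc y y' l k h hk hS hne ih =>
    obtain ⟨n, x, lab, h1, h2, h3, h4, h5, h6, h7⟩ := ih
    refine ⟨n + 1, fun m => if m ≤ n then x m else y', fun m => if m ≤ n then lab m else k,
      by simpa using h1, by simp, by simpa using h3, by simp, ?_, ?_, ?_⟩
    all_goals
      intro j hj
      rcases Nat.lt_succ_iff_lt_or_eq.mp hj with hj' | hj'
      · have e1 : j ≤ n := by omega
        have e2 : j + 1 ≤ n := by omega
        simp only [e1, e2, if_true]
        first | exact h5 j hj' | exact h6 j hj' | exact h7 j hj'
      · subst hj'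
        simp only [le_refl, if_true, Nat.not_succ_le_self, if_false, h2, h4]
        first | exact hne | exact hS | exact hk.symm

theorem ReducedFrom.not_rel {V ι : Type} {S : ι → V → V → Prop} (hS : ∀ i, Equivalence (S i))
    (hf : FreeRel S) {i : ι} {z y : V} {l : ι} (h : ReducedFrom S i z y l) (hl : l ≠ i) :
    ¬ S i z y := by
  intro hzy
  obtain ⟨n, x, lab, h1, h2, h3, h4, h5, h6, h7⟩ := h.exists_seq
  have hn : n ≠ 0 := by rintro rfl; exact hl (h4.symm.trans h3)
  by_cases hyz : y = z
  · have hn1 : n ≠ 1 := by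
      rintro rfl
      exact h5 0 (by omega) (by rw [h1, h2, hyz])
    obtain ⟨j, hj, hjj⟩ := hf n x (fun m => lab (m + 1)) (by omega) (by rw [h1, h2, hyz]) h5 h6
    exact h7 (j + 1) (by omega) hjj
  · obtain ⟨j, hj, hjj⟩ := hf (n + 1) (fun m => if m ≤ n then x m else z)
      (fun m => if m < n then lab (m + 1) else i) (by omega) (by simp [h1]) (by
        intro j hj
        rcases Nat.lt_succ_iff_lt_or_eq.mp hj with hj' | hj'
        · have e1 : j ≤ n := by omega
          have e2 : j + 1 ≤ n := by omega
          simpa only [e1, e2, if_true] using h5 j hj'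
        · subst hj'; simpa [h2] using hyz) (by
        intro j hj
        rcases Nat.lt_succ_iff_lt_or_eq.mp hj with hj' | hj'
        · have e1 : j ≤ n := by omega
          have e2 : j + 1 ≤ n := by omega
          simpa only [e1, e2, hj', if_true] using h6 j hj'
        · subst hj'; simpa [h2] using (hS i).symm hzy)
    have e1 : j < n := by omega
    by_cases e2 : j + 1 < n
    · simp only [e1, e2, if_true] at hjj
      exact h7 _ e2 hjj
    · have e3 : j + 1 = n := by omega
      simp only [e1, if_true, e3, lt_irrefl, if_false] at hjj
      exact hl (h4 ▸ hjj)

theorem FreeRel.gated {V ι : Type} {S : ι → V → V → Prop} (hS : ∀ i, Equivalence (S i))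
    (hf : FreeRel S) : Gated S := by
  classical
  intro i a
  set E : V → V → Prop := Relation.EqvGen fun y y' => ∃ k, S k y y' ∧ ¬(k = i ∧ S i a y) with hE
  have hstep : ∀ z, S i a z → ∀ y y' l k, ReducedFrom S i z y l → S k y y' →
      ¬(k = i ∧ S i a y) → ∃ l', ReducedFrom S i z y' l' := by
    intro z hz y y' l k hQ hyy hno
    by_cases hye : y = y'
    · exact ⟨l, hye ▸ hQ⟩
    by_cases hkl : k = l
    · subst hkl
      cases hQ with
      | base => exact absurd ⟨rfl, hz⟩ hno
      | @snoc w _ l _ hw hk hwy hne =>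
        by_cases hwy' : w = y'
        · exact ⟨l, hwy' ▸ hw⟩
        · exact ⟨k, hw.snoc hk ((hS k).trans hwy hyy) hwy'⟩
    · exact ⟨k, hQ.snoc hkl hyy hye⟩
  have hreach : ∀ z, S i a z → ∀ y y', E y y' →
      ((∃ l, ReducedFrom S i z y l) ↔ ∃ l, ReducedFrom S i z y' l) := by
    intro z hz y y' hyy
    induction hyy with
    | rel y y' h =>
      obtain ⟨k, hk, hno⟩ := h
      constructor
      · rintro ⟨l, hl⟩; exact hstep z hz _ _ _ _ hl hk hno
      · rintro ⟨l, hl⟩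
        refine hstep z hz _ _ _ _ hl ((hS k).symm hk) ?_
        rintro ⟨rfl, h⟩
        exact hno ⟨rfl, (hS k).trans h ((hS k).symm hk)⟩
    | refl y => rfl
    | symm y y' _ ih => exact ih.symm
    | trans x y w _ _ ih1 ih2 => exact ih1.trans ih2
  have huniq : ∀ z z', S i a z → S i a z' → E z z' → z = z' := by
    intro z z' hz hz' hzz
    obtain ⟨l, hl⟩ := (hreach z hz z z' hzz).1 ⟨i, .base⟩
    have hzz' : S i z z' := (hS i).trans ((hS i).symm hz) hz'
    cases hl with
    | base => rfl
    | @snoc w _ l' _ hw hk hwy hne =>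
      exfalso
      by_cases hli : l = i
      · subst hli
        exact hw.not_rel hS hf (Ne.symm hk) ((hS l).trans hzz' ((hS l).symm hwy))
      · exact (hw.snoc hk hwy hne).not_rel hS hf hli hzz'
  have hEeq : Equivalence E := Relation.EqvGen.is_equivalence _
  refine ⟨fun y => if h : ∃ z, S i a z ∧ E z y then h.choose else a, ?_, ?_, ?_⟩
  · intro y hy
    have h : ∃ z, S i a z ∧ E z y := ⟨y, hy, hEeq.refl y⟩
    simp only [h, dif_pos]
    exact huniq _ _ h.choose_spec.1 hy h.choose_spec.2
  · intro y
    dsimp only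
    split_ifs with h
    · exact h.choose_spec.1
    · exact (hS i).refl a
  · intro k y y' hyy hno
    have hE' : E y y' := Relation.EqvGen.rel _ _ ⟨k, hyy, hno⟩
    have : ∀ z, E z y ↔ E z y' := fun z =>
      ⟨fun h => hEeq.trans h hE', fun h => hEeq.trans h (hEeq.symm hE')⟩
    simp only [this]

/-- Refining one member of a gated family by a gated family of subrelations. -/
theorem Gated.refine_none {V ι κ : Type} {S : Option ι → V → V → Prop} {T : κ → V → V → Prop}
    (hS : ∀ i, Equivalence (S i)) (hg : Gated S) (hgT : Gated T)
    (hsub : ∀ k y y', T k y y' → S none y y') :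
    Gated (fun i : ι ⊕ κ => Sum.elim (fun i => S (some i)) T i) := by
  rintro (i | k) a
  · obtain ⟨π, h1, h2, h3⟩ := hg (some i) a
    refine ⟨π, h1, h2, ?_⟩
    rintro (j | k) y y' hyy hno
    · exact h3 _ _ _ hyy fun h => hno ⟨by simpa using h.1, h.2⟩
    · exact h3 _ _ _ (hsub _ _ _ hyy) fun h => by simp at h
  · obtain ⟨π, h1, h2, h3⟩ := hg none a
    obtain ⟨π', h1', h2', h3'⟩ := hgT k a
    refine ⟨π' ∘ π, ?_, fun y => h2' _, ?_⟩
    · intro y hy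
      simp only [Function.comp]
      rw [h1 y (hsub _ _ _ hy), h1' y hy]
    · rintro (j | k') y y' hyy hno
      · simp only [Function.comp]
        rw [h3 _ _ _ hyy (fun h => by simp at h)]
      · simp only [Function.comp]
        by_cases hy : S none a y
        · rw [h1 y hy, h1 y' ((hS _).trans hy (hsub _ _ _ hyy))]
          exact h3' _ _ _ hyy fun h => hno ⟨by simp [h.1], h.2⟩
        · rw [h3 _ _ _ (hsub _ _ _ hyy) (fun h => hy h.2)]

/-! ### Orbit relations of the factors of a free product of groups -/

/-- The orbit relation of a subgroup. -/
def SubRel {H : Type} [Group H] (Y : Type) [MulAction H Y] (L : Subgroup H) (y y' : Y) : Prop :=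
  ∃ h ∈ L, h • y = y'

theorem SubRel.equivalence {H Y : Type} [Group H] [MulAction H Y] (L : Subgroup H) :
    Equivalence (SubRel Y L) where
  refl y := ⟨1, L.one_mem, one_smul _ _⟩
  symm := by
    rintro y _ ⟨h, hh, rfl⟩
    exact ⟨h⁻¹, L.inv_mem hh, by simp⟩
  trans := by
    rintro y _ _ ⟨h, hh, rfl⟩ ⟨k, hk, rfl⟩
    exact ⟨k * h, L.mul_mem hk hh, mul_smul _ _ _⟩

/-- Freeness of an action, at every point. -/
def FreeAct (H Y : Type) [Group H] [MulAction H Y] : Prop :=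
  ∀ (y : Y) (h : H), h • y = y → h = 1

theorem FreeAct.eq {H Y : Type} [Group H] [MulAction H Y] (hf : FreeAct H Y) {y : Y} {h k : H}
    (e : h • y = k • y) : h = k := by
  have := hf y (k⁻¹ * h) (by rw [mul_smul, e, inv_smul_smul])
  rwa [inv_mul_eq_one, eq_comm] at this

theorem IsFreeProductOf.freeRel {H Y ι : Type} [Group H] [MulAction H Y] {L : ι → Subgroup H}
    (hL : IsFreeProductOf H L) (hf : FreeAct H Y) : FreeRel fun i => SubRel Y (L i) := by
  classical
  intro n x i hn hx hne hst
  by_contra hcon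
  push Not at hcon
  set F := Monoid.CoprodI.lift fun i => (L i).subtype
  have key : ∀ k ≤ n, ∃ w : Monoid.CoprodI.Word (fun i => L i),
      (∀ j, w.fstIdx = some j → 0 < k ∧ j = i (k - 1)) ∧ F w.prod • x 0 = x k ∧
      (0 < k → w.toList ≠ []) := by
    intro k
    induction k with
    | zero => exact fun _ => ⟨.empty, by simp [Monoid.CoprodI.Word.fstIdx,
        Monoid.CoprodI.Word.empty], by simp, by simp⟩
    | succ k ih =>
      intro hk
      obtain ⟨w, h1, h2, -⟩ := ih (by omega)
      obtain ⟨l, hl, hlx⟩ := hst k (by omega)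
      have hl1 : (⟨l, hl⟩ : L (i k)) ≠ 1 := by
        intro h
        rw [Subgroup.mk_eq_one] at h
        subst h
        exact hne k (by omega) (by simpa using hlx)
      have hw : w.fstIdx ≠ some (i k) := by
        intro h
        obtain ⟨h3, h4⟩ := h1 _ h
        refine hcon (k - 1) (by omega) ?_
        rw [← h4, Nat.sub_add_cancel h3]
      refine ⟨.cons ⟨l, hl⟩ w hw hl1, ?_, ?_, ?_⟩
      · intro j hj
        rw [Monoid.CoprodI.Word.fstIdx_cons] at hj
        exact ⟨by omega, by simpa using hj.symm⟩
      · rw [Monoid.CoprodI.Word.prod_cons, map_mul, mul_smul, h2, ← hlx]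
        simp [F]
      · simp
  obtain ⟨w, -, h2, h3⟩ := key n le_rfl
  have h4 : F w.prod = F 1 := by
    rw [map_one]; exact hf (x 0) _ (by rw [h2, hx])
  have h5 := hL.1 h4
  rw [← Monoid.CoprodI.Word.prod_empty] at h5
  have h6 : w = .empty := Monoid.CoprodI.Word.equiv.symm.injective h5
  exact h3 (by omega) (by rw [h6]; rfl)

theorem IsFreeProductOf.gated {H Y ι : Type} [Group H] [MulAction H Y] {L : ι → Subgroup H}
    (hL : IsFreeProductOf H L) (hf : FreeAct H Y) : Gated fun i => SubRel Y (L i) :=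
  (hL.freeRel hf).gated fun _ => SubRel.equivalence _

theorem IsFreeProductOf.eqvGen {H Y ι : Type} [Group H] [MulAction H Y] {L : ι → Subgroup H}
    (hL : IsFreeProductOf H L) (y : Y) (h : H) :
    Relation.EqvGen (fun a b => ∃ i, SubRel Y (L i) a b) y (h • y) := by
  obtain ⟨w, rfl⟩ := hL.2 h
  induction w using Monoid.CoprodI.induction_on generalizing y with
  | one => simpa using Relation.EqvGen.refl y
  | of i m =>
    exact Relation.EqvGen.rel _ _ ⟨i, m, m.2, by simp⟩
  | mul a b iha ihb =>
    rw [map_mul, mul_smul]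
    exact (ihb y).trans _ _ _ (iha _)

/-! ### Measurable choices of indices in countable sets -/

/-- A fixed enumeration of a countable type. -/
noncomputable def enc {I : Type} [Countable I] : I → ℕ := (exists_injective_nat I).choose

theorem enc_injective {I : Type} [Countable I] : Function.Injective (enc (I := I)) :=
  (exists_injective_nat I).choose_spec

theorem exists_min_enc {I : Type} [Countable I] {P : I → Prop} (h : ∃ i, P i) :
    ∃ i, P i ∧ ∀ j, P j → enc i ≤ enc j := by
  classical
  have h' : ∃ n, ∃ i, P i ∧ enc i = n := ⟨_, h.choose, h.choose_spec, rfl⟩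
  obtain ⟨i, hi, hn⟩ := Nat.find_spec h'
  exact ⟨i, hi, fun j hj => hn ▸ Nat.find_min' h' ⟨j, hj, rfl⟩⟩

open Classical in
/-- The first index satisfying `P`. -/
noncomputable def sel {I : Type} [Countable I] [Nonempty I] (P : I → Prop) : I :=
  if h : ∃ i, P i then (exists_min_enc h).choose else Classical.arbitrary I

theorem sel_spec {I : Type} [Countable I] [Nonempty I] {P : I → Prop} (h : ∃ i, P i) :
    P (sel P) := by
  rw [sel, dif_pos h]
  exact (exists_min_enc h).choose_spec.1

theorem sel_min {I : Type} [Countable I] [Nonempty I] {P : I → Prop} {j : I} (h : P j) :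
    enc (sel P) ≤ enc j := by
  have h' : ∃ i, P i := ⟨j, h⟩
  rw [sel, dif_pos h']
  exact (exists_min_enc h').choose_spec.2 j h

theorem sel_eq_iff {I : Type} [Countable I] [Nonempty I] {P : I → Prop} {i : I} :
    sel P = i ↔ (P i ∧ ∀ j, P j → enc i ≤ enc j) ∨ ((∀ j, ¬ P j) ∧ i = Classical.arbitrary I) := by
  by_cases h : ∃ j, P j
  · constructor
    · rintro rfl
      exact .inl ⟨sel_spec h, fun j hj => sel_min hj⟩
    · rintro (⟨h1, h2⟩ | ⟨h1, -⟩)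
      · exact enc_injective (le_antisymm (sel_min h1) (h2 _ (sel_spec h)))
      · exact absurd h (by simpa using h1)
  · have h' : ∀ j, ¬ P j := by simpa using h
    rw [sel, dif_neg h]
    constructor
    · rintro rfl; exact .inr ⟨h', rfl⟩
    · rintro (⟨h1, -⟩ | ⟨-, h2⟩)
      · exact absurd h1 (h' _)
      · exact h2.symm

/-- The fibres of `c` are measurable. -/
def MFib {A I : Type} [MeasurableSpace A] (c : A → I) : Prop := ∀ i, Measurable fun a => c a = i

theorem MFib.sel {A I : Type} [MeasurableSpace A] [Countable I] [Nonempty I]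
    {P : A → I → Prop} (h : ∀ i, Measurable fun a => P a i) : MFib fun a => sel (P a) := by
  intro i
  simp only [sel_eq_iff]
  exact ((h i).and (.forall fun j => (h j).imp measurable_const)).or
    ((Measurable.forall fun j => (h j).not).and measurable_const)

theorem MFib.apply {A I Z : Type} [MeasurableSpace A] [MeasurableSpace Z] [Countable I]
    {c : A → I} {F : I → A → Z} (hc : MFib c) (hF : ∀ i, Measurable (F i)) :
    Measurable fun a => F (c a) a := by
  intro B hB
  have : (fun a => F (c a) a) ⁻¹' B = ⋃ i, {a | c a = i} ∩ F i ⁻¹' B := by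
    ext a; simp
  rw [this]
  exact .iUnion fun i => (measurableSet_setOfPred.2 (hc i)).inter (hF i hB)

theorem MFib.bind {A I I' : Type} [MeasurableSpace A] [Countable I]
    {c : A → I} {F : I → A → I'} (hc : MFib c) (hF : ∀ i, MFib (F i)) :
    MFib fun a => F (c a) a :=
  fun i => hc.apply (F := fun j a => F j a = i) fun j => hF j i

theorem MFib.comp {A A' I : Type} [MeasurableSpace A] [MeasurableSpace A'] {c : A → I}
    (hc : MFib c) {f : A' → A} (hf : Measurable f) : MFib fun a => c (f a) :=
  fun i => (hc i).comp hf

theorem MFib.map {A I I' : Type} [MeasurableSpace A] [Countable I] {c : A → I} (hc : MFib c)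
    (f : I → I') : MFib fun a => f (c a) :=
  fun i => hc.apply (F := fun j _ => f j = i) fun _ => measurable_const

theorem MFib.prop {A I : Type} [MeasurableSpace A] [Countable I] {c : A → I} (hc : MFib c)
    (p : I → Prop) : Measurable fun a => p (c a) :=
  hc.apply (F := fun j _ => p j) fun _ => measurable_const

theorem Measurable.eqProp {A Z : Type} [MeasurableSpace A] [MeasurableSpace Z]
    [StandardBorelSpace Z] {f g : A → Z} (hf : Measurable f) (hg : Measurable g) :
    Measurable fun a => f a = g a :=
  measurableSet_setOfPred.1 (measurableSet_eq_fun hf hg)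

open Classical in
theorem Measurable.iteProp {A Z : Type} [MeasurableSpace A] [MeasurableSpace Z] {p : A → Prop}
    (hp : Measurable p) {f g : A → Z} (hf : Measurable f) (hg : Measurable g) :
    Measurable fun a => if p a then f a else g a :=
  Measurable.ite (measurableSet_setOfPred.2 hp) hf hg

/-- The first natural number satisfying `P` depends measurably on parameters. -/
theorem MFib.natInf {A : Type} [MeasurableSpace A] {P : A → ℕ → Prop}
    (h : ∀ i, Measurable fun a => P a i) : MFib fun a => sInf {n | P a n} := by
  intro n
  have : ∀ a, sInf {n | P a n} = n ↔
      (P a n ∧ ∀ m, m < n → ¬ P a m) ∨ ((∀ m, ¬ P a m) ∧ n = 0) := by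
    intro a
    by_cases hne : ∃ m, P a m
    · constructor
      · rintro rfl
        exact .inl ⟨Nat.sInf_mem (s := {n | P a n}) hne, fun m hm => Nat.notMem_of_lt_sInf hm⟩
      · rintro (⟨h1, h2⟩ | ⟨h1, -⟩)
        · refine le_antisymm (Nat.sInf_le h1) ?_
          by_contra hlt
          exact h2 _ (not_le.1 hlt) (Nat.sInf_mem (s := {n | P a n}) hne)
        · exact absurd hne (by simpa using h1)
    · have h' : ∀ m, ¬ P a m := by simpa using hne
      have e : {n | P a n} = ∅ := by ext m; simpa using h' m
      rw [e, Nat.sInf_empty]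
      constructor
      · intro hn; exact .inr ⟨h', hn.symm⟩
      · rintro (⟨h1, -⟩ | ⟨-, h2⟩)
        · exact absurd h1 (h' _)
        · exact h2.symm
  simp only [this]
  exact ((h n).and (.forall fun m => measurable_const.imp (h m).not)).or
    ((Measurable.forall fun m => (h m).not).and measurable_const)

/-- A countable family of measurable sets separating points. -/
theorem exists_separating (X : Type) [MeasurableSpace X] [StandardBorelSpace X] :
    ∃ B : ℕ × Bool → X → Prop, (∀ m, Measurable (B m)) ∧
      ∀ x x', x ≠ x' → ∃ m, B m x ∧ ¬ B m x' := by
  obtain ⟨f, hf, hinj⟩ := MeasurableSpace.measurable_injection_nat_bool_of_countablySeparated X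
  refine ⟨fun m x => f x m.1 = m.2, fun m => ?_, fun x x' hne => ?_⟩
  · exact (measurable_pi_apply m.1 |>.comp hf).eqProp measurable_const
  · obtain ⟨n, hn⟩ := Function.ne_iff.1 (hinj.ne hne)
    exact ⟨(n, f x n), rfl, fun h => hn h.symm⟩

/-! ### Pulling back a gated decomposition through a map of orbits -/

/-- A map `τ : X → Y` with countably many partial inverses, together with a gated family of
equivalence relations generating the `H`-orbits on `Y`. -/
structure Transfer (X Y H I J : Type) [Group H] [MulAction H Y] where
  τ : X → Y
  σ : I → Y → X
  S : J → Y → Y → Prop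
  B : ℕ × Bool → X → Prop
  S_equiv : ∀ j, Equivalence (S j)
  S_sub : ∀ j y y', S j y y' → ∃ h : H, h • y = y'
  gated : Gated S
  gen : ∀ (y : Y) (h : H), Relation.EqvGen (fun a b => ∃ j, S j a b) y (h • y)
  σ_τ : ∀ x, ∃ i, σ i (τ x) = x
  sep : ∀ x x', x ≠ x' → ∃ m, B m x ∧ ¬ B m x'

set_option linter.unusedSectionVars false

namespace Transfer

variable {X Y H I J : Type} [Group H] [MulAction H Y] [Countable H] [Countable I] [Nonempty I]
  [Countable J] [Nonempty J] (c : Transfer X Y H I J) (K : Set X)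

/-- The points at distance at most `n` from the image of `K`. -/
def D : ℕ → Y → Prop
  | 0, y => ∃ x ∈ K, c.τ x = y
  | n + 1, y => ∃ a : J × H, c.S a.1 y (a.2 • y) ∧ D n (a.2 • y)

def Live (y : Y) : Prop := ∃ n, c.D K n y

/-- The distance to the image of `K`. -/
noncomputable def d (y : Y) : ℕ := sInf {n | c.D K n y}

noncomputable def jh (y : Y) : J × H :=
  sel fun a : J × H => c.S a.1 y (a.2 • y) ∧ c.D K (c.d K y - 1) (a.2 • y)

/-- The first step of a geodesic towards the image of `K`. -/
noncomputable def st (y : Y) : Y := (c.jh K y).2 • y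

/-- A section of `τ` on `K`. -/
noncomputable def ρ (y : Y) : X :=
  c.σ (sel fun i => c.σ i y ∈ K ∧ c.τ (c.σ i y) = y) y

/-- The projection of the orbit to `K`. -/
noncomputable def r (y : Y) : X := c.ρ K ((c.st K)^[c.d K y] y)

noncomputable def lab (y : Y) : H := sel fun h => y = h • c.τ (c.r K y)

def Out (j : J) (y : Y) : Prop := c.d K y = 0 ∨ (c.jh K y).1 ≠ j

def MinLab (j : J) (y : Y) : Prop :=
  c.Live K y ∧ c.Out K j y ∧
    ∀ h : H, c.S j y (h • y) → c.Out K j (h • y) → enc (c.lab K y) ≤ enc (c.lab K (h • y))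

open Classical in
noncomputable def g (j : J) (y : Y) : Y :=
  if c.MinLab K j y then y else (sel fun h : H => c.S j y (h • y) ∧ c.MinLab K j (h • y)) • y

open Classical in
noncomputable def s (j : J) (y : Y) : Y := if c.Out K j y then y else c.st K y

variable {c K}

theorem d_eq_zero {y : Y} (h : ∃ x ∈ K, c.τ x = y) : c.d K y = 0 :=
  Nat.sInf_eq_zero.2 (.inl h)

theorem Live.D_d {y : Y} (h : c.Live K y) : c.D K (c.d K y) y :=
  Nat.sInf_mem (s := {n | c.D K n y}) h

theorem Live.D_zero {y : Y} (h : c.Live K y) (hd : c.d K y = 0) : ∃ x ∈ K, c.τ x = y := by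
  have := h.D_d
  rwa [hd] at this

theorem d_le {y : Y} {n : ℕ} (h : c.D K n y) : c.d K y ≤ n := Nat.sInf_le h

theorem D.step {y y' : Y} {j : J} {n : ℕ} (h : c.D K n y) (hS : c.S j y' y) :
    c.D K (n + 1) y' := by
  obtain ⟨k, rfl⟩ := c.S_sub _ _ _ hS
  exact ⟨(j, k), hS, h⟩

theorem Live.step {y y' : Y} {j : J} (h : c.Live K y) (hS : c.S j y y') : c.Live K y' :=
  ⟨_, h.choose_spec.step ((c.S_equiv j).symm hS)⟩

theorem live_τ {x : X} (hx : x ∈ K) : c.Live K (c.τ x) := ⟨0, x, hx, rfl⟩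

theorem jh_spec {y : Y} (h : c.Live K y) (hd : c.d K y ≠ 0) :
    c.S (c.jh K y).1 y (c.st K y) ∧ c.D K (c.d K y - 1) (c.st K y) := by
  have h1 := h.D_d
  obtain ⟨n, hn⟩ := Nat.exists_eq_succ_of_ne_zero hd
  refine sel_spec (P := fun a : J × H => c.S a.1 y (a.2 • y) ∧ c.D K (c.d K y - 1) (a.2 • y)) ?_
  rw [hn] at h1 ⊢
  exact h1

theorem Live.st {y : Y} (h : c.Live K y) (hd : c.d K y ≠ 0) : c.Live K (c.st K y) :=
  ⟨_, (jh_spec h hd).2⟩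

theorem d_st {y : Y} (h : c.Live K y) (hd : c.d K y ≠ 0) : c.d K (c.st K y) = c.d K y - 1 := by
  obtain ⟨h1, h2⟩ := jh_spec h hd
  refine le_antisymm (d_le h2) ?_
  have := d_le ((h.st hd).D_d.step h1)
  omega

theorem ρ_spec {y : Y} (h : ∃ x ∈ K, c.τ x = y) : c.ρ K y ∈ K ∧ c.τ (c.ρ K y) = y := by
  obtain ⟨x, hx, rfl⟩ := h
  obtain ⟨i, hi⟩ := c.σ_τ x
  exact sel_spec (P := fun i => c.σ i (c.τ x) ∈ K ∧ c.τ (c.σ i (c.τ x)) = c.τ x)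
    ⟨i, by rw [hi]; exact hx, by rw [hi]⟩

theorem r_of_d_eq_zero {y : Y} (hd : c.d K y = 0) : c.r K y = c.ρ K y := by simp [r, hd]

theorem r_st {y : Y} (h : c.Live K y) (hd : c.d K y ≠ 0) : c.r K (c.st K y) = c.r K y := by
  obtain ⟨n, hn⟩ := Nat.exists_eq_succ_of_ne_zero hd
  rw [r, r, d_st h hd, hn, Nat.succ_sub_one, Function.iterate_succ_apply]

/-- Induction along the paths towards the image of `K`. -/
theorem Live.induction {p : Y → Prop} {y : Y} (h : c.Live K y)
    (h0 : ∀ y, c.Live K y → c.d K y = 0 → p y)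
    (h1 : ∀ y, c.Live K y → c.d K y ≠ 0 → p (c.st K y) → p y) : p y := by
  induction hn : c.d K y using Nat.strong_induction_on generalizing y with
  | _ n ih =>
    by_cases hd : c.d K y = 0
    · exact h0 y h hd
    · exact h1 y h hd (ih _ (by rw [d_st h hd]; omega) (h.st hd) rfl)

theorem r_mem {y : Y} (h : c.Live K y) : c.r K y ∈ K := by
  refine h.induction (p := fun y => c.r K y ∈ K) (fun y h hd => ?_) (fun y h hd ih => by
    rwa [r_st h hd] at ih)
  rw [r_of_d_eq_zero hd]
  exact (ρ_spec (h.D_zero hd)).1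

theorem ρ_τ_r {y : Y} (h : c.Live K y) : c.ρ K (c.τ (c.r K y)) = c.r K y := by
  refine h.induction (p := fun y => c.ρ K (c.τ (c.r K y)) = c.r K y) (fun y h hd => ?_) (fun y h hd ih => by
    rwa [r_st h hd] at ih)
  rw [r_of_d_eq_zero hd, (ρ_spec (h.D_zero hd)).2]

theorem lab_spec {y : Y} (h : c.Live K y) : y = c.lab K y • c.τ (c.r K y) := by
  refine sel_spec (P := fun k : H => y = k • c.τ (c.r K y)) ?_
  refine h.induction (p := fun y => ∃ k : H, y = k • c.τ (c.r K y)) (fun y h hd => ?_)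
    (fun y h hd ih => ?_)
  · exact ⟨1, by rw [r_of_d_eq_zero hd, (ρ_spec (h.D_zero hd)).2, one_smul]⟩
  · rw [r_st h hd] at ih
    obtain ⟨k, hk⟩ := ih
    obtain ⟨l, hl⟩ := c.S_sub _ _ _ ((c.S_equiv _).symm (jh_spec h hd).1)
    exact ⟨l * k, by rw [mul_smul, ← hk, hl]⟩

theorem s_of_out {j : J} {y : Y} (h : c.Out K j y) : c.s K j y = y := if_pos h

theorem s_of_not_out {j : J} {y : Y} (h : ¬ c.Out K j y) : c.s K j y = c.st K y := if_neg h

theorem not_out_iff {j : J} {y : Y} : ¬ c.Out K j y ↔ c.d K y ≠ 0 ∧ (c.jh K y).1 = j := by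
  simp [Out]

theorem out_st {j : J} {y : Y} (h : c.Live K y) (ho : ¬ c.Out K j y) : c.Out K j (c.st K y) := by
  obtain ⟨hd, hj⟩ := not_out_iff.1 ho
  by_contra ho'
  obtain ⟨hd', hj'⟩ := not_out_iff.1 ho'
  have h1 := (jh_spec h hd).1
  obtain ⟨h2, h3⟩ := jh_spec (h.st hd) hd'
  rw [hj] at h1
  rw [hj'] at h2
  have h4 := d_le (h3.step ((c.S_equiv j).trans h1 h2))
  rw [d_st h hd] at h4 hd'
  omega

theorem out_s {j : J} {y : Y} (h : c.Live K y) : c.Out K j (c.s K j y) := by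
  by_cases ho : c.Out K j y
  · rwa [s_of_out ho]
  · rw [s_of_not_out ho]; exact out_st h ho

theorem S_s {j : J} {y : Y} (h : c.Live K y) : c.S j y (c.s K j y) := by
  by_cases ho : c.Out K j y
  · rw [s_of_out ho]; exact (c.S_equiv j).refl _
  · rw [s_of_not_out ho]
    obtain ⟨hd, hj⟩ := not_out_iff.1 ho
    have := (jh_spec h hd).1
    rwa [hj] at this

theorem r_s {j : J} {y : Y} (h : c.Live K y) : c.r K (c.s K j y) = c.r K y := by
  by_cases ho : c.Out K j y
  · rw [s_of_out ho]
  · rw [s_of_not_out ho]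
    exact r_st h (not_out_iff.1 ho).1

theorem MinLab.le {j : J} {y y' : Y} (h : c.MinLab K j y) (hS : c.S j y y')
    (ho : c.Out K j y') : enc (c.lab K y) ≤ enc (c.lab K y') := by
  obtain ⟨k, rfl⟩ := c.S_sub _ _ _ hS
  exact h.2.2 k hS ho

theorem MinLab.lab_eq {j : J} {y y' : Y} (h : c.MinLab K j y) (hS : c.S j y y')
    (h' : c.MinLab K j y') : c.lab K y = c.lab K y' :=
  enc_injective (le_antisymm (h.le hS h'.2.1) (h'.le ((c.S_equiv j).symm hS) h.2.1))

theorem exists_minLab {j : J} {y : Y} (h : c.Live K y) :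
    ∃ k : H, c.S j y (k • y) ∧ c.MinLab K j (k • y) := by
  have h0 : ∃ l : H, ∃ k : H, (c.S j y (k • y) ∧ c.Out K j (k • y)) ∧ c.lab K (k • y) = l := by
    obtain ⟨k, hk⟩ := c.S_sub _ _ _ (S_s (j := j) h)
    exact ⟨_, k, ⟨by rw [hk]; exact S_s h, by rw [hk]; exact out_s h⟩, rfl⟩
  obtain ⟨l, ⟨k, ⟨hk1, hk2⟩, hkl⟩, hl⟩ := exists_min_enc h0
  refine ⟨k, hk1, h.step hk1, hk2, fun m hm hmo => ?_⟩
  rw [hkl]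
  exact hl _ ⟨m * k, ⟨by rw [mul_smul]; exact (c.S_equiv j).trans hk1 hm,
    by rwa [mul_smul]⟩, by rw [mul_smul]⟩

theorem g_of_minLab {j : J} {y : Y} (h : c.MinLab K j y) : c.g K j y = y := if_pos h

theorem g_spec {j : J} {y : Y} (h : c.Live K y) :
    c.S j y (c.g K j y) ∧ c.MinLab K j (c.g K j y) := by
  by_cases hm : c.MinLab K j y
  · rw [g_of_minLab hm]; exact ⟨(c.S_equiv j).refl _, hm⟩
  · rw [g, if_neg hm]
    exact sel_spec (P := fun k : H => c.S j y (k • y) ∧ c.MinLab K j (k • y)) (exists_minLab h)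

/-- The gate of a live class, corrected so as to land in the points from which the way to the
image of `K` leaves the class. -/
theorem exists_gate {a : Y} (ha : c.Live K a) (j : J) :
    ∃ q : Y → Y, (∀ y, c.Live K (q y) ∧ c.S j a (q y) ∧ c.Out K j (q y)) ∧
      (∀ y, c.S j a y → c.Out K j y → q y = y) ∧
      (∀ k y y', c.S k y y' → ¬ (k = j ∧ c.S j a y) → q y = q y') ∧
      ∀ y, c.Live K y → q (c.τ (c.r K y)) = q y := by
  obtain ⟨π, h1, h2, h3⟩ := c.gated j a
  have hl : ∀ y, c.Live K (π y) := fun y => ha.step (h2 y)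
  have hq : ∀ k y y', c.S k y y' → ¬ (k = j ∧ c.S j a y) → c.s K j (π y) = c.s K j (π y') :=
    fun k y y' hS hno => by rw [h3 k y y' hS hno]
  refine ⟨fun y => c.s K j (π y), fun y => ⟨(hl y).step (S_s (j := j) (hl y)),
    (c.S_equiv j).trans (h2 y) (S_s (hl y)), out_s (hl y)⟩, ?_, hq, ?_⟩
  · intro y hy ho
    simp only [h1 y hy, s_of_out ho]
  · intro y hy
    refine hy.induction (p := fun y => c.s K j (π (c.τ (c.r K y))) = c.s K j (π y))
      (fun y h hd => ?_) (fun y h hd ih => ?_)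
    · rw [r_of_d_eq_zero hd, (ρ_spec (h.D_zero hd)).2]
    · rw [← r_st h hd, ih]
      have hs := (jh_spec h hd).1
      by_cases hc : (c.jh K y).1 = j ∧ c.S j a y
      · obtain ⟨hj, hay⟩ := hc
        rw [hj] at hs
        have ho : ¬ c.Out K j y := not_out_iff.2 ⟨hd, hj⟩
        simp only [h1 y hay, h1 _ ((c.S_equiv j).trans hay hs), s_of_not_out ho,
          s_of_out (out_st h ho)]
      · exact (hq _ _ _ hs hc).symm

theorem r_g_ne {j : J} {y : Y} (h : c.Live K y) (ho : c.Out K j y) (hm : ¬ c.MinLab K j y) :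
    c.r K y ≠ c.r K (c.g K j y) := by
  intro he
  obtain ⟨q, h1, h2, h3, h4⟩ := c.exists_gate h j
  obtain ⟨hg, hgm⟩ := g_spec (j := j) h
  have e1 := h4 y h
  have e2 := h4 _ hgm.1
  rw [h2 y ((c.S_equiv j).refl y) ho] at e1
  rw [h2 _ hg hgm.2.1] at e2
  rw [he, e2] at e1
  exact hm (e1 ▸ hgm)

end Transfer

set_option linter.unusedSectionVars false

namespace Transfer

variable {X Y H I J : Type} [Group H] [MulAction H Y] [Countable H] [Countable I] [Nonempty I]
  [Countable J] [Nonempty J] (c : Transfer X Y H I J) (K : Set X)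

def Good (a : J × H) (x : X) : Prop :=
  c.r K (a.2 • c.τ x) = x ∧ c.lab K (a.2 • c.τ x) = a.2 ∧ c.MinLab K a.1 (a.2 • c.τ x)

def Leaf (k : J × H × H × ℕ × Bool) (x : X) : Prop :=
  c.r K (k.2.1 • c.τ x) = x ∧ c.lab K (k.2.1 • c.τ x) = k.2.1 ∧ c.Live K (k.2.1 • c.τ x) ∧
    c.Out K k.1 (k.2.1 • c.τ x) ∧ ¬ c.MinLab K k.1 (k.2.1 • c.τ x) ∧
    c.lab K (c.g K k.1 (k.2.1 • c.τ x)) = k.2.2.1 ∧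
    sel (fun m => c.B m x ∧ ¬ c.B m (c.r K (c.g K k.1 (k.2.1 • c.τ x)))) = k.2.2.2

open Classical in
noncomputable def ctr (k : J × H × H × ℕ × Bool) (x : X) : X :=
  if c.Leaf K k x then c.r K (c.g K k.1 (k.2.1 • c.τ x)) else x

/-- The pieces of the pulled back decomposition. -/
def Piece (orb : X → Set X) :
    Unit ⊕ (J × H) ⊕ (J × H × H × ℕ × Bool) → X → X → Prop
  | .inl _, x, x' => orb x = orb x' ∧ c.τ x = c.τ x'
  | .inr (.inl a), x, x' => x = x' ∨ (orb x = orb x' ∧ c.Good (orb x) a x ∧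
      c.Good (orb x') a x' ∧ c.S a.1 (a.2 • c.τ x) (a.2 • c.τ x'))
  | .inr (.inr k), x, x' => orb x = orb x' ∧ c.ctr (orb x) k x = c.ctr (orb x') k x'

variable {c K}

theorem Leaf.ctr_eq {k : J × H × H × ℕ × Bool} {x : X} (h : c.Leaf K k x) :
    c.ctr K k x = c.r K (c.g K k.1 (k.2.1 • c.τ x)) := if_pos h

theorem ctr_of_not {k : J × H × H × ℕ × Bool} {x : X} (h : ¬ c.Leaf K k x) :
    c.ctr K k x = x := if_neg h

theorem Leaf.sep {k : J × H × H × ℕ × Bool} {x : X} (h : c.Leaf K k x) :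
    c.B k.2.2.2 x ∧ ¬ c.B k.2.2.2 (c.ctr K k x) := by
  obtain ⟨h1, h2, h3, h4, h5, h6, h7⟩ := id h
  rw [h.ctr_eq, ← h7]
  refine sel_spec (P := fun m => c.B m x ∧ ¬ c.B m (c.r K (c.g K k.1 (k.2.1 • c.τ x)))) ?_
  refine c.sep _ _ ?_
  have := r_g_ne h3 h4 h5
  rwa [h1] at this

theorem Leaf.not_leaf_ctr {k : J × H × H × ℕ × Bool} {x : X} (h : c.Leaf K k x) :
    ¬ c.Leaf K k (c.ctr K k x) := fun h' => h.sep.2 h'.sep.1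

theorem ctr_mem {k : J × H × H × ℕ × Bool} {x : X} (hx : x ∈ K) : c.ctr K k x ∈ K := by
  by_cases h : c.Leaf K k x
  · rw [h.ctr_eq]; exact r_mem (g_spec h.2.2.1).2.1
  · rwa [ctr_of_not h]

variable {orb : X → Set X}

theorem piece_orb {i} {x x' : X} (h : c.Piece orb i x x') : orb x = orb x' := by
  match i, h with
  | .inl _, h => exact h.1
  | .inr (.inl a), h => exact h.elim (fun h => h ▸ rfl) (fun h => h.1)
  | .inr (.inr k), h => exact h.1

theorem piece_equiv (i) : Equivalence (c.Piece orb i) := by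
  match i with
  | .inl _ => exact ⟨fun x => ⟨rfl, rfl⟩, fun h => ⟨h.1.symm, h.2.symm⟩,
      fun h h' => ⟨h.1.trans h'.1, h.2.trans h'.2⟩⟩
  | .inr (.inl a) =>
    refine ⟨fun x => .inl rfl, ?_, ?_⟩
    · rintro x x' (h | ⟨h1, h2, h3, h4⟩)
      · exact .inl h.symm
      · exact .inr ⟨h1.symm, h3, h2, (c.S_equiv _).symm h4⟩
    · rintro x x' x'' (rfl | ⟨h1, h2, h3, h4⟩) h'
      · exact h'
      · rcases h' with rfl | ⟨h1', h2', h3', h4'⟩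
        · exact .inr ⟨h1, h2, h3, h4⟩
        · exact .inr ⟨h1.trans h1', h2, h3', (c.S_equiv _).trans h4 h4'⟩
  | .inr (.inr k) => exact ⟨fun x => ⟨rfl, rfl⟩, fun h => ⟨h.1.symm, h.2.symm⟩,
      fun h h' => ⟨h.1.trans h'.1, h.2.trans h'.2⟩⟩

/-- To check that a map is constant along the steps outside a class, it suffices to consider
the points of `K`. -/
theorem gate_of_orbit (hmem : ∀ x, x ∈ orb x) (horb : ∀ x, ∀ x' ∈ orb x, orb x' = orb x)
    {i} {x₀ : X}
    (h : ∃ π : X → X, (∀ x ∈ orb x₀, c.Piece orb i x₀ x → π x = x) ∧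
      (∀ x ∈ orb x₀, c.Piece orb i x₀ (π x)) ∧
      ∀ k, ∀ x ∈ orb x₀, ∀ x' ∈ orb x₀, c.Piece orb k x x' → ¬ (k = i ∧ c.Piece orb i x₀ x) →
        π x = π x') :
    ∃ π : X → X, (∀ y, c.Piece orb i x₀ y → π y = y) ∧ (∀ y, c.Piece orb i x₀ (π y)) ∧
      ∀ k y y', c.Piece orb k y y' → ¬(k = i ∧ c.Piece orb i x₀ y) → π y = π y' := by
  classical
  obtain ⟨π, h1, h2, h3⟩ := h
  refine ⟨fun x => if x ∈ orb x₀ then π x else x₀, ?_, ?_, ?_⟩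
  · intro y hy
    have : y ∈ orb x₀ := by rw [piece_orb hy]; exact hmem y
    simp only [this, if_true]
    exact h1 y this hy
  · intro y
    dsimp only
    split_ifs with hy
    · exact h2 y hy
    · exact (piece_equiv i).refl _
  · intro k y y' hyy hno
    have hiff : y ∈ orb x₀ ↔ y' ∈ orb x₀ := by
      have e := piece_orb hyy
      constructor
      · intro hy; rw [← horb _ _ hy, e]; exact hmem _
      · intro hy; rw [← horb _ _ hy, ← e]; exact hmem _
    by_cases hy : y ∈ orb x₀
    · simp only [hy, hiff.1 hy, if_true]
      exact h3 k y hy y' (hiff.1 hy) hyy hno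
    · have hy' : y' ∉ orb x₀ := fun h => hy (hiff.2 h)
      simp only [hy, hy', if_false]

theorem piece_gated (hmem : ∀ x, x ∈ orb x) (horb : ∀ x, ∀ x' ∈ orb x, orb x' = orb x) :
    Gated (c.Piece orb) := by
  classical
  intro i x₀
  refine gate_of_orbit hmem horb ?_
  generalize hK : orb x₀ = K
  have hKe : ∀ x ∈ K, orb x = K := fun x hx => by subst hK; exact horb _ _ hx
  have hx₀ : x₀ ∈ K := hK ▸ hmem x₀
  match i with
  | .inl _ =>
    have hρ := ρ_spec (c := c) (K := K) ⟨x₀, hx₀, rfl⟩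
    refine ⟨fun x => if c.τ x₀ = c.τ x then x else c.ρ K (c.τ x₀), ?_, ?_, ?_⟩
    · intro x hx h
      simp only [h.2, if_true]
    · intro x hx
      dsimp only
      split_ifs with h
      · exact ⟨by rw [hKe _ hx, hK], h⟩
      · exact ⟨by rw [hKe _ hρ.1, hK], hρ.2.symm⟩
    · have key : ∀ y, c.Live K y →
          (if c.τ x₀ = c.τ (c.r K y) then c.r K y else c.ρ K (c.τ x₀)) = c.ρ K (c.τ x₀) := by
        intro y hy
        split_ifs with h
        · rw [h, ρ_τ_r hy]
        · rfl
      have key2 : ∀ k x, x ∈ K →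
          (if c.τ x₀ = c.τ (c.ctr K k x) then c.ctr K k x else c.ρ K (c.τ x₀)) =
            (if c.τ x₀ = c.τ x then x else c.ρ K (c.τ x₀)) := by
        intro k x hx
        by_cases hl : c.Leaf K k x
        · have e := key _ hl.2.2.1
          rw [hl.1] at e
          rw [hl.ctr_eq, e, key _ (g_spec hl.2.2.1).2.1]
        · rw [ctr_of_not hl]
      intro k x hx x' hx' hxx hno
      match k, hxx with
      | .inl _, hxx =>
        have h1 : c.τ x₀ ≠ c.τ x := fun h => hno ⟨rfl, by rw [hKe _ hx, hK], h⟩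
        have h2 : c.τ x₀ ≠ c.τ x' := hxx.2 ▸ h1
        simp only [h1, h2, if_false]
      | .inr (.inl a), hxx =>
        rcases hxx with rfl | ⟨-, h1, h2, -⟩
        · rfl
        · rw [hKe _ hx] at h1
          rw [hKe _ hx'] at h2
          have e1 := key _ h1.2.2.1
          have e2 := key _ h2.2.2.1
          rw [h1.1] at e1
          rw [h2.1] at e2
          exact e1.trans e2.symm
      | .inr (.inr k), hxx =>
        have e := hxx.2
        rw [hKe _ hx, hKe _ hx'] at e
        have e1 := key2 k x hx
        rw [e, key2 k x' hx'] at e1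
        exact e1.symm
  | .inr (.inl (j, h)) =>
    by_cases hg : c.Good K (j, h) x₀
    swap
    · refine ⟨fun _ => x₀, ?_, fun x _ => (piece_equiv _).refl _, fun _ _ _ _ _ _ _ => rfl⟩
      rintro x hx (hxx | ⟨-, hg', -⟩)
      · exact hxx
      · rw [hK] at hg'; exact absurd hg' hg
    obtain ⟨q, q1, q2, q3, q4⟩ := c.exists_gate hg.2.2.1 j
    dsimp only at q1 q2 q3 q4
    refine ⟨fun x => c.r K (c.g K j (q (c.τ x))), ?_, ?_, ?_⟩
    · have : ∀ x, c.Good K (j, h) x → c.S j (h • c.τ x₀) (h • c.τ x) →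
          c.r K (c.g K j (q (c.τ x))) = x := by
        intro x hx hS
        obtain ⟨g1, g2, g3⟩ := hx
        dsimp only at g1 g2 g3
        have e := q4 _ g3.1
        rw [g1, q2 _ hS g3.2.1] at e
        rw [e, g_of_minLab g3, g1]
      rintro x hx (rfl | ⟨-, -, hg', hS⟩)
      · exact this _ hg ((c.S_equiv j).refl _)
      · rw [hKe _ hx] at hg'
        exact this x hg' hS
    · intro x hx
      obtain ⟨l1, l2, l3⟩ := q1 (c.τ x)
      obtain ⟨m1, m2⟩ := g_spec (j := j) l1
      have e1 := lab_spec m2.1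
      have e2 : c.lab K (c.g K j (q (c.τ x))) = h :=
        (hg.2.2.lab_eq ((c.S_equiv j).trans l2 m1) m2).symm.trans hg.2.1
      rw [e2] at e1
      have hm := r_mem m2.1
      refine .inr ⟨by rw [hKe _ hm, hK], by rw [hK]; exact hg, ?_, ?_⟩
      · rw [hKe _ hm]
        refine ⟨?_, ?_, ?_⟩ <;> dsimp only <;> rw [← e1]
        · exact e2
        · exact m2
      · dsimp only
        rw [← e1]
        exact (c.S_equiv j).trans l2 m1
    · have key2 : ∀ k x, x ∈ K →
          c.g K j (q (c.τ (c.ctr K k x))) = c.g K j (q (c.τ x)) := by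
        intro k x hx
        by_cases hl : c.Leaf K k x
        · obtain ⟨m1, m2⟩ := g_spec (j := k.1) hl.2.2.1
          have e1 := q4 _ hl.2.2.1
          rw [hl.1] at e1
          rw [hl.ctr_eq, q4 _ m2.1, e1]
          by_cases hin : k.1 = j ∧ c.S j (h • c.τ x₀) (k.2.1 • c.τ x)
          · obtain ⟨hkj, hin⟩ := hin
            have ho := hl.2.2.2.1
            rw [hkj] at m1 m2 ho ⊢
            rw [q2 _ hin ho, q2 _ ((c.S_equiv j).trans hin m1) m2.2.1, g_of_minLab m2]
          · rw [q3 _ _ _ m1 hin]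
        · rw [ctr_of_not hl]
      intro k x hx x' hx' hxx hno
      dsimp only
      match k, hxx with
      | .inl _, hxx => rw [hxx.2]
      | .inr (.inl (j', h')), hxx =>
        rcases hxx with rfl | ⟨-, h1, h2, h3⟩
        · rfl
        · rw [hKe _ hx] at h1
          rw [hKe _ hx'] at h2
          have e1 := q4 _ h1.2.2.1
          have e2 := q4 _ h2.2.2.1
          rw [h1.1] at e1
          rw [h2.1] at e2
          rw [e1, e2]
          by_cases hin : j' = j ∧ c.S j (h • c.τ x₀) (h' • c.τ x)
          · exfalso
            obtain ⟨rfl, hin⟩ := hin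
            have : h' = h :=
              h1.2.1.symm.trans ((hg.2.2.lab_eq hin h1.2.2).symm.trans hg.2.1)
            subst this
            exact hno ⟨rfl, .inr ⟨by rw [hK, hKe _ hx], by rwa [hK], by rwa [hKe _ hx], hin⟩⟩
          · rw [q3 _ _ _ h3 hin]
      | .inr (.inr k), hxx =>
        have e := hxx.2
        rw [hKe _ hx, hKe _ hx'] at e
        rw [← key2 k x hx, e, key2 k x' hx']
  | .inr (.inr k₀) =>
    by_cases hl₁ : ∃ x₁ ∈ K, c.Leaf K k₀ x₁ ∧ c.ctr K k₀ x₁ = c.ctr K k₀ x₀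
    swap
    · refine ⟨fun _ => x₀, ?_, fun x _ => (piece_equiv _).refl _, fun _ _ _ _ _ _ _ => rfl⟩
      rintro x hx ⟨-, hxx⟩
      rw [hK, hKe _ hx] at hxx
      have n1 : ¬ c.Leaf K k₀ x₀ := fun h => hl₁ ⟨x₀, hx₀, h, rfl⟩
      have n2 : ¬ c.Leaf K k₀ x := fun h => hl₁ ⟨x, hx, h, hxx.symm⟩
      rwa [ctr_of_not n1, ctr_of_not n2] at hxx
    obtain ⟨x₁, hx₁, hl₁, hc₁⟩ := hl₁
    have hcn := hl₁.not_leaf_ctr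
    rw [hc₁] at hcn
    have hcr := hl₁.ctr_eq
    rw [hc₁] at hcr
    obtain ⟨j, h, h', m⟩ := k₀
    set k₀ : J × H × H × ℕ × Bool := (j, h, h', m) with hk₀
    have hlive := hl₁.2.2.1
    have hlab := hl₁.2.2.2.2.2.1
    dsimp only [k₀] at hcr hlive hlab
    have hcm := ctr_mem (c := c) (k := k₀) hx₀
    obtain ⟨gc1, gc2⟩ := g_spec (c := c) (j := j) hlive
    generalize hcg : c.ctr K k₀ x₀ = ct at *
    generalize hyc : c.g K j (h • c.τ x₁) = yc at *
    have hyct : yc = h' • c.τ ct := by rw [hcr, ← hlab]; exact lab_spec gc2.1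
    have hclass : ∀ x ∈ K, c.Piece orb (.inr (.inr k₀)) x₀ x ↔ c.ctr K k₀ x = ct := by
      intro x hx
      rw [Piece, hK, hKe _ hx, hcg]
      exact ⟨fun h => h.2.symm, fun h => ⟨rfl, h.symm⟩⟩
    obtain ⟨q, q1, q2, q3, q4⟩ := c.exists_gate hlive j
    set cond : Y → Prop := fun z => c.Leaf K k₀ (c.r K z) ∧ h • c.τ (c.r K z) = z ∧
      c.g K j z = yc with hcond
    have cond_ctr : ∀ z, cond z → c.ctr K k₀ (c.r K z) = ct := by
      rintro z ⟨c1, c2, c3⟩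
      rw [c1.ctr_eq]
      dsimp only [k₀]
      rw [c2, c3, hcr]
    have cond_min : ∀ z, c.MinLab K j z → ¬ cond z := by
      rintro z hz ⟨c1, -, c3⟩
      rw [g_of_minLab hz] at c3
      rw [c3, ← hcr] at c1
      exact hcn c1
    refine ⟨fun x => if cond (q (c.τ x)) then c.r K (q (c.τ x)) else ct, ?_, ?_, ?_⟩
    · intro x hx hxx
      rw [hclass x hx] at hxx
      dsimp only
      by_cases hl : c.Leaf K k₀ x
      · rw [hl.ctr_eq] at hxx
        obtain ⟨l1, l2, l3, l4, l5, l6, l7⟩ := id hl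
        dsimp only [k₀] at l1 l2 l3 l4 l5 l6 l7 hxx
        have gy : c.g K j (h • c.τ x) = yc := by
          rw [hyct, ← hxx, ← l6]
          exact lab_spec (g_spec l3).2.1
        have hin : c.S j (h • c.τ x₁) (h • c.τ x) := by
          refine (c.S_equiv j).trans gc1 ((c.S_equiv j).symm ?_)
          rw [← gy]
          exact (g_spec l3).1
        have e := q4 _ l3
        rw [l1, q2 _ hin l4] at e
        have : cond (q (c.τ x)) := by
          rw [e]
          exact ⟨by rwa [l1], by rw [l1], gy⟩
        rw [if_pos this, e, l1]
      · rw [ctr_of_not hl] at hxx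
        subst hxx
        have e := q4 _ gc2.1
        rw [q2 _ gc1 gc2.2.1, ← hcr] at e
        rw [e, if_neg (cond_min _ gc2)]
    · intro x hx
      dsimp only
      split_ifs with hcd
      · rw [hclass _ (r_mem (q1 _).1)]
        exact cond_ctr _ hcd
      · rw [hclass _ hcm, ctr_of_not hcn]
    · set F : Y → X := fun z => if cond z then c.r K z else ct with hF
      have key2 : ∀ k x, x ∈ K → ¬ (k = k₀ ∧ c.ctr K k₀ x = ct) →
          F (q (c.τ (c.ctr K k x))) = F (q (c.τ x)) := by
        intro k x hx hno
        by_cases hl : c.Leaf K k x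
        · obtain ⟨m1, m2⟩ := g_spec (j := k.1) hl.2.2.1
          have e1 := q4 _ hl.2.2.1
          rw [hl.1] at e1
          rw [hl.ctr_eq, q4 _ m2.1, e1]
          by_cases hin : k.1 = j ∧ c.S j (h • c.τ x₁) (k.2.1 • c.τ x)
          · obtain ⟨k1, k2, k3, k4⟩ := k
            dsimp only at hin m1 m2 e1 ⊢
            obtain ⟨rfl, hin⟩ := hin
            obtain ⟨l1, l2, l3, l4, l5, l6, l7⟩ := id hl
            dsimp only at l1 l2 l3 l4 l5 l6 l7
            rw [q2 _ hin l4, q2 _ ((c.S_equiv _).trans hin m1) m2.2.1]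
            have n1 := cond_min _ m2
            have n2 : ¬ cond (k2 • c.τ x) := by
              intro hcd
              have hcc := cond_ctr _ hcd
              obtain ⟨c1, c2, c3⟩ := hcd
              rw [l1] at c1 c2 hcc
              obtain ⟨l1', l2', l3', l4', l5', l6', l7'⟩ := c1
              dsimp only [k₀] at l1' l2' l3' l4' l5' l6' l7'
              refine hno ⟨?_, hcc⟩
              have a1 : k2 = h := by rw [← l2, ← c2, l2']
              subst a1
              have a2 : k3 = h' := l6.symm.trans l6'
              have a3 : k4 = m := l7.symm.trans l7'
              rw [a2, a3]
            simp only [F, n1, n2, if_false]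
          · rw [q3 _ _ _ m1 hin]
        · rw [ctr_of_not hl]
      intro k x hx x' hx' hxx hno
      change F _ = F _
      match k, hxx with
      | .inl _, hxx => rw [hxx.2]
      | .inr (.inl (j', h'')), hxx =>
        rcases hxx with rfl | ⟨-, h1, h2, h3⟩
        · rfl
        · rw [hKe _ hx] at h1
          rw [hKe _ hx'] at h2
          obtain ⟨g1, g2, g3⟩ := h1
          obtain ⟨g1', g2', g3'⟩ := h2
          dsimp only at g1 g2 g3 g1' g2' g3' h3
          have e1 := q4 _ g3.1
          have e2 := q4 _ g3'.1
          rw [g1] at e1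
          rw [g1'] at e2
          rw [e1, e2]
          by_cases hin : j' = j ∧ c.S j (h • c.τ x₁) (h'' • c.τ x)
          · obtain ⟨rfl, hin⟩ := hin
            rw [q2 _ hin g3.2.1, q2 _ ((c.S_equiv _).trans hin h3) g3'.2.1]
            simp only [F, cond_min _ g3, cond_min _ g3', if_false]
          · rw [q3 _ _ _ h3 hin]
      | .inr (.inr k), hxx =>
        have e := hxx.2
        rw [hKe _ hx, hKe _ hx'] at e
        have hno1 : ¬ (k = k₀ ∧ c.ctr K k₀ x = ct) := by
          rintro ⟨rfl, h2⟩
          exact hno ⟨rfl, (hclass x hx).2 h2⟩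
        have hno2 : ¬ (k = k₀ ∧ c.ctr K k₀ x' = ct) := by
          rintro ⟨h1, h2⟩
          refine hno1 ⟨h1, ?_⟩
          rw [h1] at e
          rw [e, h2]
        rw [← key2 k x hx hno1, e, key2 k x' hx' hno2]

theorem piece_gen (horb : ∀ x, ∀ x' ∈ orb x, orb x' = orb x)
    (hmem : ∀ x, x ∈ orb x) (hτ : ∀ x, ∀ x' ∈ orb x, ∃ h : H, h • c.τ x = c.τ x')
    {x x' : X} (hx : x' ∈ orb x) :
    Relation.EqvGen (fun a b => ∃ i, c.Piece orb i a b) x x' := by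
  set E := Relation.EqvGen (fun a b => ∃ i, c.Piece orb i a b) with hE
  have hEe : Equivalence E := Relation.EqvGen.is_equivalence _
  have hrel : ∀ i a b, c.Piece orb i a b → E a b := fun i a b h => .rel _ _ ⟨i, h⟩
  generalize hK : orb x = K at hx
  have hKe : ∀ x ∈ K, orb x = K := fun y hy => by subst hK; exact horb _ _ hy
  have hxK : x ∈ K := hK ▸ hmem x
  have hN : ∀ y ∈ K, E (c.r K (c.τ y)) y := by
    intro y hy
    refine hrel (.inl ()) _ _ ⟨?_, ?_⟩
    · rw [hKe _ hy, hKe _ (r_mem (live_τ hy))]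
    · rw [r_of_d_eq_zero (d_eq_zero ⟨y, hy, rfl⟩), (ρ_spec ⟨y, hy, rfl⟩).2]
  have hL : ∀ j y, c.Live K y → c.Out K j y → E (c.r K y) (c.r K (c.g K j y)) := by
    intro j y hy ho
    by_cases hm : c.MinLab K j y
    · rw [g_of_minLab hm]; exact hEe.refl _
    obtain ⟨g1, g2⟩ := g_spec (j := j) hy
    have hlab := lab_spec hy
    set k : J × H × H × ℕ × Bool := (j, c.lab K y, c.lab K (c.g K j y),
      sel (fun m => c.B m (c.r K y) ∧ ¬ c.B m (c.r K (c.g K j y)))) with hk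
    have hl : c.Leaf K k (c.r K y) := by
      refine ⟨?_, ?_, ?_, ?_, ?_, ?_, ?_⟩ <;> dsimp only [k] <;> rw [← hlab]
      · exact hy
      · exact ho
      · exact hm
    have hce : c.ctr K k (c.r K y) = c.r K (c.g K j y) := by
      rw [hl.ctr_eq]
      dsimp only [k]
      rw [← hlab]
    refine hrel (.inr (.inr k)) _ _ ⟨?_, ?_⟩
    · rw [hKe _ (r_mem hy), hKe _ (r_mem g2.1)]
    · rw [hKe _ (r_mem hy), hKe _ (r_mem g2.1), ← hce, ctr_of_not hl.not_leaf_ctr]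
  have hL' : ∀ j y, c.Live K y → ∃ z, c.S j y z ∧ c.MinLab K j z ∧ E (c.r K y) (c.r K z) := by
    intro j y hy
    have hs := S_s (j := j) hy
    have hls := hy.step hs
    obtain ⟨g1, g2⟩ := g_spec (j := j) hls
    refine ⟨_, (c.S_equiv j).trans hs g1, g2, ?_⟩
    rw [← r_s (j := j) hy]
    exact hL j _ hls (out_s hy)
  have hS : ∀ j y y', c.Live K y → c.S j y y' → E (c.r K y) (c.r K y') := by
    intro j y y' hy hyy
    obtain ⟨z, z1, z2, z3⟩ := hL' j y hy
    obtain ⟨z', z1', z2', z3'⟩ := hL' j y' (hy.step hyy)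
    refine hEe.trans z3 (hEe.trans ?_ (hEe.symm z3'))
    have hzz : c.S j z z' := (c.S_equiv j).trans ((c.S_equiv j).symm z1)
      ((c.S_equiv j).trans hyy z1')
    have hlz := lab_spec z2.1
    have hlz' := lab_spec z2'.1
    have hll := z2.lab_eq hzz z2'
    rw [← hll] at hlz'
    refine hrel (.inr (.inl (j, c.lab K z))) _ _ (.inr ⟨?_, ?_, ?_, ?_⟩)
    · rw [hKe _ (r_mem z2.1), hKe _ (r_mem z2'.1)]
    · rw [hKe _ (r_mem z2.1)]
      refine ⟨?_, ?_, ?_⟩ <;> dsimp only <;> rw [← hlz]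
      exact z2
    · rw [hKe _ (r_mem z2'.1)]
      refine ⟨?_, ?_, ?_⟩ <;> dsimp only <;> rw [← hlz']
      · exact hll.symm
      · exact z2'
    · dsimp only
      rwa [← hlz, ← hlz']
  have hgen : ∀ y y', Relation.EqvGen (fun a b => ∃ j, c.S j a b) y y' →
      ((c.Live K y ↔ c.Live K y') ∧ (c.Live K y → E (c.r K y) (c.r K y'))) := by
    intro y y' h
    induction h with
    | rel y y' h =>
      obtain ⟨j, h⟩ := h
      exact ⟨⟨fun hy => hy.step h, fun hy => hy.step ((c.S_equiv j).symm h)⟩,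
        fun hy => hS j y y' hy h⟩
    | refl y => exact ⟨Iff.rfl, fun _ => hEe.refl _⟩
    | symm y y' _ ih => exact ⟨ih.1.symm, fun hy => hEe.symm (ih.2 (ih.1.2 hy))⟩
    | trans y y' y'' _ _ ih1 ih2 =>
      exact ⟨ih1.1.trans ih2.1, fun hy => hEe.trans (ih1.2 hy) (ih2.2 (ih1.1.1 hy))⟩
  obtain ⟨h, hh⟩ := hτ x x' (hK ▸ hx)
  have e := (hgen _ _ (c.gen (c.τ x) h)).2 (live_τ hxK)
  rw [hh] at e
  exact hEe.trans (hEe.symm (hN x hxK)) (hEe.trans e (hN x' hx))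

end Transfer

/-! ### Infinite groups have no invariant selection of a point -/

theorem measure_eq_zero_of_selection {Γ X : Type} [Group Γ] [Countable Γ] [Infinite Γ]
    [MeasurableSpace X] [StandardBorelSpace X] [MulAction Γ X] [MeasurableConstSMul Γ X]
    {μ : Measure X} [IsFiniteMeasure μ] [SMulInvariantMeasure Γ X μ] (hf : FreeAct Γ X)
    {Z : Set X} (hZ : MeasurableSet Z) (hinv : ∀ (γ : Γ), ∀ x ∈ Z, γ • x ∈ Z)
    {κ : X → X} (hκ : Measurable κ) (h1 : ∀ x ∈ Z, ∃ γ : Γ, κ x = γ • x)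
    (h2 : ∀ x ∈ Z, ∀ γ : Γ, κ (γ • x) = κ x) : μ Z = 0 := by
  set W : Γ → Set X := fun γ => Z ∩ {x | κ x = γ • x} with hW
  have hWm : ∀ γ, MeasurableSet (W γ) := fun γ =>
    hZ.inter (measurableSet_eq_fun hκ (measurable_const_smul γ))
  have hWd : Pairwise (Function.onFun Disjoint W) := by
    intro γ δ hne
    rw [Function.onFun, Set.disjoint_left]
    rintro x ⟨-, hx⟩ ⟨-, hx'⟩
    exact hne (hf.eq (hx.symm.trans hx'))
  have hWe : ∀ γ, μ (W γ) = μ (W 1) := by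
    intro γ
    rw [← measure_preimage_smul μ γ (W 1)]
    congr 1
    ext x
    constructor
    · rintro ⟨hx, hx'⟩
      refine ⟨hinv γ x hx, ?_⟩
      change κ (γ • x) = (1 : Γ) • γ • x
      rw [h2 x hx, one_smul]
      exact hx'
    · rintro ⟨hx, hx'⟩
      have hxZ : x ∈ Z := by simpa using hinv γ⁻¹ _ hx
      refine ⟨hxZ, ?_⟩
      change κ x = γ • x
      rw [← h2 x hxZ γ]
      exact hx'.trans (one_smul _ _)
  have hle : ∑' γ, μ (W γ) ≤ μ Set.univ := by
    rw [← measure_iUnion hWd hWm]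
    exact measure_mono (Set.subset_univ _)
  have h0 : μ (W 1) = 0 := by
    by_contra hne
    simp only [hWe, ENNReal.tsum_const_eq_top_of_ne_zero hne, top_le_iff] at hle
    exact measure_ne_top μ _ hle
  refine measure_mono_null (t := ⋃ γ, W γ) (fun x hx => ?_)
    (measure_iUnion_null fun γ => (hWe γ).trans h0)
  obtain ⟨γ, hγ⟩ := h1 x hx
  exact Set.mem_iUnion.2 ⟨γ, hx, hγ⟩

namespace Transfer

set_option linter.unusedSectionVars false

variable {Γ X Y H I J : Type} [Group Γ] [Countable Γ] [MeasurableSpace X] [StandardBorelSpace X]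
  [MulAction Γ X] [MeasurableConstSMul Γ X] [MeasurableSpace Y] [StandardBorelSpace Y]
  [Group H] [MulAction H Y] [MeasurableConstSMul H Y] [Countable H] [Countable I] [Nonempty I]
  [Countable J] [Nonempty J] (c : Transfer X Y H I J)

/-- Measurability of the data of a transfer. -/
structure Meas : Prop where
  τ : Measurable c.τ
  σ : ∀ i, Measurable (c.σ i)
  S : ∀ j, Measurable fun p : Y × Y => c.S j p.1 p.2
  B : ∀ m, Measurable (c.B m)

variable {c}

theorem measurable_mem_orbit {A : Type} [MeasurableSpace A] {f f' : A → X} (hf : Measurable f)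
    (hf' : Measurable f') : Measurable fun a => f' a ∈ MulAction.orbit Γ (f a) :=
  .exists fun γ : Γ => (hf.const_smul γ).eqProp hf'

theorem Meas.D (hc : c.Meas) (n : ℕ) :
    Measurable fun p : X × Y => c.D (MulAction.orbit Γ p.1) n p.2 := by
  induction n with
  | zero =>
    have : (fun p : X × Y => c.D (MulAction.orbit Γ p.1) 0 p.2) =
        fun p => ∃ γ : Γ, c.τ (γ • p.1) = p.2 := by
      funext p
      simp [Transfer.D, MulAction.mem_orbit_iff]
    rw [this]
    exact .exists fun γ => (hc.τ.comp (measurable_fst.const_smul γ)).eqProp measurable_snd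
  | succ n ih =>
    exact .exists fun a => ((hc.S a.1).comp
      (measurable_snd.prodMk (measurable_snd.const_smul a.2))).and
        (ih.comp (measurable_fst.prodMk (measurable_snd.const_smul a.2)))

variable (Γ) in
theorem Meas.live (hc : c.Meas) :
    Measurable fun p : X × Y => c.Live (MulAction.orbit Γ p.1) p.2 :=
  .exists fun n => hc.D n

theorem Meas.d (hc : c.Meas) : MFib fun p : X × Y => c.d (MulAction.orbit Γ p.1) p.2 :=
  MFib.natInf fun n => hc.D n

theorem Meas.jh (hc : c.Meas) : MFib fun p : X × Y => c.jh (MulAction.orbit Γ p.1) p.2 := by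
  refine MFib.sel fun a => ((hc.S a.1).comp
    (measurable_snd.prodMk (measurable_snd.const_smul a.2))).and ?_
  exact (hc.d (Γ := Γ)).apply (F := fun n (p : X × Y) =>
    c.D (MulAction.orbit Γ p.1) (n - 1) (a.2 • p.2)) fun n =>
      (hc.D (n - 1)).comp (measurable_fst.prodMk (measurable_snd.const_smul a.2))

theorem Meas.st (hc : c.Meas) : Measurable fun p : X × Y => c.st (MulAction.orbit Γ p.1) p.2 :=
  (hc.jh (Γ := Γ)).apply (F := fun a (p : X × Y) => a.2 • p.2) fun a => measurable_snd.const_smul a.2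

theorem Meas.ρ (hc : c.Meas) : Measurable fun p : X × Y => c.ρ (MulAction.orbit Γ p.1) p.2 := by
  refine MFib.apply (F := fun i (p : X × Y) => c.σ i p.2) (MFib.sel fun i => ?_)
    fun i => (hc.σ i).comp measurable_snd
  exact (measurable_mem_orbit measurable_fst ((hc.σ i).comp measurable_snd)).and
    ((hc.τ.comp ((hc.σ i).comp measurable_snd)).eqProp measurable_snd)

theorem Meas.r (hc : c.Meas) : Measurable fun p : X × Y => c.r (MulAction.orbit Γ p.1) p.2 := by
  have hit : ∀ n, Measurable fun p : X × Y => (c.st (MulAction.orbit Γ p.1))^[n] p.2 := by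
    intro n
    induction n with
    | zero => exact measurable_snd
    | succ n ih =>
      simp only [Function.iterate_succ_apply']
      exact (hc.st (Γ := Γ)).comp (measurable_fst.prodMk ih)
  exact (hc.d (Γ := Γ)).apply (F := fun n (p : X × Y) =>
    c.ρ (MulAction.orbit Γ p.1) ((c.st (MulAction.orbit Γ p.1))^[n] p.2)) fun n =>
      (hc.ρ (Γ := Γ)).comp (measurable_fst.prodMk (hit n))

theorem Meas.lab (hc : c.Meas) : MFib fun p : X × Y => c.lab (MulAction.orbit Γ p.1) p.2 :=
  MFib.sel fun h => measurable_snd.eqProp ((hc.τ.comp (hc.r (Γ := Γ))).const_smul h)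

theorem Meas.out (hc : c.Meas) (j : J) :
    Measurable fun p : X × Y => c.Out (MulAction.orbit Γ p.1) j p.2 :=
  ((hc.d (Γ := Γ)).prop (· = 0)).or ((hc.jh (Γ := Γ)).prop (·.1 ≠ j))

theorem measurable_smul_snd (h : H) : Measurable fun p : X × Y => (p.1, h • p.2) :=
  measurable_fst.prodMk (measurable_snd.const_smul h)

theorem Meas.minLab (hc : c.Meas) (j : J) :
    Measurable fun p : X × Y => c.MinLab (MulAction.orbit Γ p.1) j p.2 := by
  refine (hc.live Γ).and ((hc.out j).and (.forall fun h => ?_))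
  refine ((hc.S j).comp (measurable_snd.prodMk (measurable_snd.const_smul h))).imp ?_
  refine ((hc.out (Γ := Γ) j).comp (measurable_smul_snd h)).imp ?_
  refine (hc.lab (Γ := Γ)).apply (F := fun l (p : X × Y) => enc l ≤
    enc (c.lab (MulAction.orbit Γ p.1) (h • p.2))) fun l => ?_
  exact ((hc.lab (Γ := Γ)).comp (measurable_smul_snd h)).prop fun l' => enc l ≤ enc l'

theorem Meas.g (hc : c.Meas) (j : J) :
    Measurable fun p : X × Y => c.g (MulAction.orbit Γ p.1) j p.2 := by
  refine (hc.minLab j).iteProp measurable_snd ?_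
  refine MFib.apply (F := fun h (p : X × Y) => h • p.2) (MFib.sel fun h => ?_)
    fun h => measurable_snd.const_smul h
  exact ((hc.S j).comp (measurable_snd.prodMk (measurable_snd.const_smul h))).and
    ((hc.minLab (Γ := Γ) j).comp (measurable_smul_snd h))

theorem Meas.pair (hc : c.Meas) (h : H) : Measurable fun x : X => (x, h • c.τ x) :=
  measurable_id.prodMk (hc.τ.const_smul h)

theorem Meas.good (hc : c.Meas) (a : J × H) :
    Measurable fun x => c.Good (MulAction.orbit Γ x) a x :=
  (((hc.r (Γ := Γ)).comp (hc.pair a.2)).eqProp measurable_id).and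
    ((((hc.lab (Γ := Γ)).comp (hc.pair a.2)) a.2).and
      ((hc.minLab (Γ := Γ) a.1).comp (hc.pair a.2)))

theorem Meas.rg (hc : c.Meas) (j : J) (h : H) :
    Measurable fun x => c.r (MulAction.orbit Γ x) (c.g (MulAction.orbit Γ x) j (h • c.τ x)) :=
  (hc.r (Γ := Γ)).comp (measurable_id.prodMk ((hc.g (Γ := Γ) j).comp (hc.pair h)))

theorem Meas.leaf (hc : c.Meas) (k : J × H × H × ℕ × Bool) :
    Measurable fun x => c.Leaf (MulAction.orbit Γ x) k x := by
  have hp := hc.pair k.2.1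
  refine (((hc.r (Γ := Γ)).comp hp).eqProp measurable_id).and
    ((((hc.lab (Γ := Γ)).comp hp) k.2.1).and (((hc.live Γ).comp hp).and
      (((hc.out (Γ := Γ) k.1).comp hp).and (((hc.minLab (Γ := Γ) k.1).comp hp).not.and
        (((((hc.lab (Γ := Γ)).comp (measurable_id.prodMk ((hc.g (Γ := Γ) k.1).comp hp)))
          k.2.2.1)).and ?_)))))
  exact MFib.sel (fun m => (hc.B m).and ((hc.B m).comp (hc.rg k.1 k.2.1)).not) k.2.2.2

theorem Meas.ctr (hc : c.Meas) (k : J × H × H × ℕ × Bool) :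
    Measurable fun x => c.ctr (MulAction.orbit Γ x) k x :=
  (hc.leaf k).iteProp (hc.rg k.1 k.2.1) measurable_id

theorem measurable_orbit_eq : Measurable fun p : X × X =>
    MulAction.orbit Γ p.1 = MulAction.orbit Γ p.2 := by
  simp only [MulAction.orbit_eq_iff]
  exact measurable_mem_orbit measurable_snd measurable_fst

theorem Meas.piece (hc : c.Meas) (i) :
    Measurable fun p : X × X => c.Piece (MulAction.orbit Γ) i p.1 p.2 := by
  match i with
  | .inl _ =>
    exact (measurable_orbit_eq (Γ := Γ)).and
      ((hc.τ.comp measurable_fst).eqProp (hc.τ.comp measurable_snd))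
  | .inr (.inl a) =>
    exact (measurable_fst.eqProp measurable_snd).or (measurable_orbit_eq.and
      (((hc.good a).comp measurable_fst).and (((hc.good a).comp measurable_snd).and
        ((hc.S a.1).comp (((hc.τ.comp measurable_fst).const_smul a.2).prodMk
          ((hc.τ.comp measurable_snd).const_smul a.2))))))
  | .inr (.inr k) =>
    exact (measurable_orbit_eq (Γ := Γ)).and
      (((hc.ctr k).comp measurable_fst).eqProp ((hc.ctr k).comp measurable_snd))

end Transfer

namespace Transfer

set_option linter.unusedSectionVars false

variable {Γ X Y H I J : Type} [Group Γ] [Countable Γ] [MeasurableSpace X] [StandardBorelSpace X]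
  [MulAction Γ X] [MeasurableConstSMul Γ X] [MeasurableSpace Y] [StandardBorelSpace Y]
  [Group H] [MulAction H Y] [MeasurableConstSMul H Y] [Countable H] [Countable I] [Nonempty I]
  [Countable J] [Nonempty J] {c : Transfer X Y H I J}

theorem measure_eq_zero_of_invariant [Infinite Γ] {μ : Measure X} [IsFiniteMeasure μ]
    [SMulInvariantMeasure Γ X μ] (hf : FreeAct Γ X) (hc : c.Meas)
    {Z : Set X} (hZ : MeasurableSet Z) (hinv : ∀ (γ : Γ), ∀ x ∈ Z, γ • x ∈ Z)
    {w : X → Y} (hw : Measurable w) (h1 : ∀ x ∈ Z, ∃ h : H, h • w x = c.τ x)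
    (h2 : ∀ x ∈ Z, ∀ γ : Γ, w (γ • x) = w x) : μ Z = 0 := by
  set P : X → H × I → Prop := fun x a => c.σ a.2 (a.1 • w x) ∈ MulAction.orbit Γ x with hP
  have hm : ∀ a : H × I, Measurable fun x => c.σ a.2 (a.1 • w x) :=
    fun a => (hc.σ a.2).comp (hw.const_smul a.1)
  have hPm : MFib fun x => sel (P x) :=
    MFib.sel fun a => measurable_mem_orbit measurable_id (hm a)
  refine measure_eq_zero_of_selection (Γ := Γ) hf hZ hinv
    (κ := fun x => c.σ (sel (P x)).2 ((sel (P x)).1 • w x))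
    (hPm.apply (F := fun a x => c.σ a.2 (a.1 • w x)) hm) ?_ ?_
  · intro x hx
    have : P x (sel (P x)) := by
      refine sel_spec ?_
      obtain ⟨h, hh⟩ := h1 x hx
      obtain ⟨i, hi⟩ := c.σ_τ x
      refine ⟨(h, i), ?_⟩
      change c.σ i (h • w x) ∈ _
      rw [hh, hi]
      exact MulAction.mem_orbit_self x
    obtain ⟨γ, hγ⟩ := this
    exact ⟨γ, hγ.symm⟩
  · intro x hx γ
    have e : P (γ • x) = P x := by
      funext a
      simp only [P, h2 x hx γ, MulAction.orbit_smul]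
    simp only [e, h2 x hx γ]

/-- The map to `Y` attached to a piece. -/
noncomputable def mark (c : Transfer X Y H I J) (Γ : Type) [Group Γ] [MulAction Γ X] :
    Unit ⊕ (J × H) ⊕ (J × H × H × ℕ × Bool) → X → Y
  | .inl _, x => c.τ x
  | .inr (.inl a), x => a.2 • c.τ x
  | .inr (.inr k), x => c.τ (c.ctr (MulAction.orbit Γ x) k x)

theorem Meas.mark (hc : c.Meas) (i) : Measurable (c.mark Γ i) := by
  match i with
  | .inl _ => exact hc.τ
  | .inr (.inl a) => exact hc.τ.const_smul a.2
  | .inr (.inr k) => exact hc.τ.comp (hc.ctr k)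

theorem mark_orbit (hτ : ∀ (γ : Γ) x, ∃ h : H, h • c.τ x = c.τ (γ • x)) (i) (x : X) :
    ∃ h : H, h • c.τ x = c.mark Γ i x := by
  match i with
  | .inl _ => exact ⟨1, one_smul _ _⟩
  | .inr (.inl a) => exact ⟨a.2, rfl⟩
  | .inr (.inr k) =>
    obtain ⟨γ, hγ⟩ := ctr_mem (c := c) (k := k) (MulAction.mem_orbit_self (M := Γ) x)
    obtain ⟨h, hh⟩ := hτ γ x
    exact ⟨h, by rw [hh]; exact congrArg c.τ hγ⟩

/-- A freely indecomposable orbit relation is conjugate into the members of a gated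
decomposition. -/
theorem exists_conjugator [Infinite Γ] {μ : Measure X} [IsFiniteMeasure μ]
    [SMulInvariantMeasure Γ X μ] (hf : FreeAct Γ X) (hc : c.Meas)
    (hτ : ∀ (γ : Γ) x, ∃ h : H, h • c.τ x = c.τ (γ • x))
    {R : CBER X} (hdom : R.dom = Set.univ)
    (hR : ∀ x y, R.rel x y ↔ ∃ γ : Γ, γ • x = y) (hFI : FreelyIndecomposableMod μ R) :
    ∃ (Z : Set X) (jj : X → J) (v : X → Y), MeasurableSet Z ∧ μ Zᶜ = 0 ∧
      (∀ (γ : Γ), ∀ x ∈ Z, γ • x ∈ Z) ∧ MFib jj ∧ Measurable v ∧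
      ∀ x ∈ Z, (∃ h : H, h • c.τ x = v x) ∧
        ∀ γ : Γ, jj (γ • x) = jj x ∧ c.S (jj x) (v x) (v (γ • x)) := by
  classical
  set orb : X → Set X := MulAction.orbit Γ with horb_def
  have hmem : ∀ x, x ∈ orb x := fun x => MulAction.mem_orbit_self x
  have horb : ∀ x, ∀ x' ∈ orb x, orb x' = orb x := fun x x' h => MulAction.orbit_eq_iff.2 h
  have hsub : ∀ i x y, c.Piece orb i x y → R.rel x y := by
    intro i x y h
    rw [hR]
    have := hmem y
    rw [← piece_orb h] at this
    exact this
  let Rf : Unit ⊕ (J × H) ⊕ (J × H × H × ℕ × Bool) → CBER X := fun i =>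
    { dom := Set.univ
      dom_meas := MeasurableSet.univ
      rel := c.Piece orb i
      rel_meas := measurableSet_setOfPred.2 (hc.piece i)
      rel_dom := fun _ => ⟨trivial, trivial⟩
      refl := fun x _ => (piece_equiv i).refl x
      symm := fun h => (piece_equiv i).symm h
      trans := fun h h' => (piece_equiv i).trans h h'
      countable_classes := fun x => (R.countable_classes x).mono fun y hy => hsub i x y hy }
  have hprod : IsFreeProduct R Rf := by
    refine ⟨(piece_gated hmem horb).freeRel piece_equiv, ?_, ?_⟩
    · rw [hdom, eq_comm, Set.iUnion_eq_univ_iff]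
      exact fun x => ⟨.inl (), trivial⟩
    · intro x y
      rw [hdom]
      constructor
      · intro h
        refine ⟨trivial, piece_gen horb hmem (fun x x' hx => ?_) ((hR x y).1 h)⟩
        obtain ⟨γ, rfl⟩ := hx
        exact hτ γ x
      · rintro ⟨-, h⟩
        have hE : Equivalence R.rel :=
          ⟨fun x => R.refl x (hdom ▸ trivial), fun h => R.symm h, fun h h' => R.trans h h'⟩
        induction h with
        | rel x y h => exact hsub _ _ _ h.choose_spec
        | refl x => exact hE.refl x
        | symm x y _ ih => exact hE.symm ih
        | trans x y z _ _ ih ih' => exact hE.trans ih ih'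
  obtain ⟨U, C, hUm, -, -, hCm, hC0, hU1, hU2, hU3⟩ := hFI _ inferInstance Rf hprod
  set Z₀ : Set X := ⋂ γ : Γ, (fun x => γ • x) ⁻¹' C with hZ₀
  have hZ₀m : MeasurableSet Z₀ := .iInter fun γ => measurable_const_smul γ hCm
  have hZ₀n : μ Z₀ᶜ = 0 := by
    rw [hZ₀, Set.compl_iInter]
    refine measure_iUnion_null fun γ => ?_
    rw [← Set.preimage_compl, measure_preimage_smul]
    exact hC0
  have hZ₀C : ∀ x ∈ Z₀, ∀ γ : Γ, γ • x ∈ C := fun x hx γ => Set.mem_iInter.1 hx γ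
  have hZ₀i : ∀ (γ : Γ), ∀ x ∈ Z₀, γ • x ∈ Z₀ := by
    intro γ x hx
    refine Set.mem_iInter.2 fun δ => ?_
    change δ • γ • x ∈ C
    rw [← mul_smul]
    exact hZ₀C x hx _
  set P : X → (Unit ⊕ (J × H) ⊕ (J × H × H × ℕ × Bool)) × Γ → Prop :=
    fun x a => a.2 • x ∈ U a.1 with hP
  have hPm : MFib fun x => sel (P x) := MFib.sel fun a =>
    measurableSet_setOfPred.1 (measurable_const_smul a.2 (hUm a.1))
  set kk : X → Unit ⊕ (J × H) ⊕ (J × H × H × ℕ × Bool) := fun x => (sel (P x)).1 with hkk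
  set xh : X → X := fun x => (sel (P x)).2 • x with hxh
  have hkkm : MFib kk := hPm.map Prod.fst
  have hxhm : Measurable xh :=
    hPm.apply (F := fun a x => a.2 • x) fun a => measurable_const_smul a.2
  have hxU : ∀ x ∈ Z₀, xh x ∈ U (kk x) ∩ C := by
    intro x hx
    refine ⟨?_, hZ₀C x hx _⟩
    refine sel_spec (P := P x) ?_
    obtain ⟨y, hy, hxy⟩ := hU1 x ⟨hdom ▸ trivial, by simpa using hZ₀C x hx 1⟩
    obtain ⟨i, hi⟩ := Set.mem_iUnion.1 hy
    obtain ⟨γ, rfl⟩ := (hR _ _).1 hxy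
    exact ⟨(i, γ), hi⟩
  have hxR : ∀ x (γ : Γ), R.rel (xh x) (xh (γ • x)) := by
    intro x γ
    rw [hR]
    refine ⟨(sel (P (γ • x))).2 * γ * (sel (P x)).2⁻¹, ?_⟩
    simp only [xh, mul_smul, inv_smul_smul]
  have hkki : ∀ x ∈ Z₀, ∀ γ : Γ, kk (γ • x) = kk x := fun x hx γ =>
    (hU2 _ _ _ (hxU x hx) _ (hxU _ (hZ₀i γ x hx)) (hxR x γ)).symm
  have hpc : ∀ x ∈ Z₀, ∀ γ : Γ, c.Piece orb (kk x) (xh x) (xh (γ • x)) := by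
    intro x hx γ
    refine (hU3 _ _ (hxU x hx) _ ?_).1 (hxR x γ)
    rw [← hkki x hx γ]
    exact hxU _ (hZ₀i γ x hx)
  set v : X → Y := fun x => c.mark Γ (kk x) (xh x) with hv
  have hvm : Measurable v :=
    hkkm.apply (F := fun i x => c.mark Γ i (xh x)) fun i => (hc.mark i).comp hxhm
  have hvo : ∀ x, ∃ h : H, h • c.τ x = v x := by
    intro x
    obtain ⟨h, hh⟩ := mark_orbit hτ (kk x) (xh x)
    obtain ⟨k, hk⟩ := hτ (sel (P x)).2 x
    exact ⟨h * k, by rw [mul_smul, hk]; exact hh⟩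
  -- the pieces on which the marking is invariant are negligible
  have hnull : ∀ i, (∀ x y, c.Piece orb i x y → c.mark Γ i x = c.mark Γ i y) →
      μ (Z₀ ∩ {x | kk x = i}) = 0 := by
    intro i hi
    refine measure_eq_zero_of_invariant (c := c) (w := v) hf hc
      (hZ₀m.inter (measurableSet_setOfPred.2 (hkkm i))) ?_ hvm ?_ ?_
    · rintro γ x ⟨hx, hxi⟩
      exact ⟨hZ₀i γ x hx, (hkki x hx γ).trans hxi⟩
    · rintro x -
      obtain ⟨h, hh⟩ := hvo x
      exact ⟨h⁻¹, by rw [← hh, inv_smul_smul]⟩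
    · rintro x ⟨hx, hxi⟩ γ
      have hxi' : kk x = i := hxi
      have := hpc x hx γ
      rw [hxi'] at this
      simp only [v, hkki x hx γ, hxi']
      exact (hi _ _ this).symm
  set isM : Unit ⊕ (J × H) ⊕ (J × H × H × ℕ × Bool) → Prop := fun i => ∃ a, i = .inr (.inl a)
  refine ⟨Z₀ ∩ {x | isM (kk x)}, fun x => Sum.elim (fun _ => Classical.arbitrary J)
    (Sum.elim Prod.fst fun k => k.1) (kk x), v,
    hZ₀m.inter (measurableSet_setOfPred.2 (hkkm.prop isM)), ?_, ?_, hkkm.map _, hvm, ?_⟩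
  · have : (Z₀ ∩ {x | isM (kk x)})ᶜ ⊆ Z₀ᶜ ∪
        ((Z₀ ∩ {x | kk x = .inl ()}) ∪ ⋃ k, Z₀ ∩ {x | kk x = .inr (.inr k)}) := by
      intro x hx
      by_cases hx0 : x ∈ Z₀
      · right
        have hn : ¬ isM (kk x) := fun h => hx ⟨hx0, h⟩
        match hk : kk x with
        | .inl _ => exact .inl ⟨hx0, hk⟩
        | .inr (.inl a) => exact absurd ⟨a, hk⟩ hn
        | .inr (.inr k) => exact .inr (Set.mem_iUnion.2 ⟨k, hx0, hk⟩)
      · exact .inl hx0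
    refine measure_mono_null this (measure_union_null hZ₀n (measure_union_null ?_
      (measure_iUnion_null fun k => ?_)))
    · exact hnull _ fun x y h => h.2
    · refine hnull _ fun x y h => ?_
      exact congrArg c.τ h.2
  · rintro γ x ⟨hx, hxi⟩
    refine ⟨hZ₀i γ x hx, ?_⟩
    change isM (kk (γ • x))
    rw [hkki x hx γ]
    exact hxi
  · rintro x ⟨hx, a, ha⟩
    refine ⟨hvo x, fun γ => ⟨by simp only [hkki x hx γ], ?_⟩⟩
    have := hpc x hx γ
    simp only [v, hkki x hx γ]
    rw [ha] at this ⊢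
    rcases this with h | ⟨-, -, -, h⟩
    · change c.S a.1 (a.2 • c.τ (xh x)) (a.2 • c.τ (xh (γ • x)))
      rw [← h]
      exact (c.S_equiv _).refl _
    · exact h

/-- No part of a freely indecomposable orbit relation is conjugate into a smooth member. -/
theorem measure_eq_zero_of_kernel [Infinite Γ] {μ : Measure X} [IsFiniteMeasure μ]
    [SMulInvariantMeasure Γ X μ] (hf : FreeAct Γ X) (hc : c.Meas)
    {Z : Set X} {jj : X → J} {v : X → Y} (hZ : MeasurableSet Z)
    (hinv : ∀ (γ : Γ), ∀ x ∈ Z, γ • x ∈ Z) (hjj : MFib jj) (hv : Measurable v)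
    (h : ∀ x ∈ Z, (∃ h : H, h • c.τ x = v x) ∧
        ∀ γ : Γ, jj (γ • x) = jj x ∧ c.S (jj x) (v x) (v (γ • x)))
    (j : J) {e : Y → Y} (he : Measurable e) (heo : ∀ y, ∃ k : H, k • y = e y)
    (hSe : ∀ y y', c.S j y y' → e y = e y') : μ (Z ∩ {x | jj x = j}) = 0 := by
  refine measure_eq_zero_of_invariant (c := c) (w := fun x => e (v x)) hf hc
    (hZ.inter (measurableSet_setOfPred.2 (hjj j))) ?_ (he.comp hv) ?_ ?_
  · rintro γ x ⟨hx, hxj⟩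
    exact ⟨hinv γ x hx, ((h x hx).2 γ).1.trans hxj⟩
  · rintro x ⟨hx, -⟩
    obtain ⟨k, hk⟩ := (h x hx).1
    obtain ⟨l, hl⟩ := heo (v x)
    exact ⟨(l * k)⁻¹, by rw [← hl, ← hk, ← mul_smul l k, inv_smul_smul]⟩
  · rintro x ⟨hx, hxj⟩ γ
    have := ((h x hx).2 γ).2
    rw [show jj x = j from hxj] at this
    exact (hSe _ _ this).symm

end Transfer

/-! ### Decomposing a treeing into smooth pieces -/

open Classical in
/-- A treeing splits into countably many freely independent kernels of Borel maps. -/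
theorem CBER.Treeable.exists_kernels {Y : Type} [MeasurableSpace Y] [StandardBorelSpace Y]
    {R : CBER Y} (hT : R.Treeable) (hdom : R.dom = Set.univ) :
    ∃ e : ℕ × ℕ × Bool → Y → Y, (∀ k, Measurable (e k)) ∧
      FreeRel (fun k y y' => e k y = e k y') ∧ (∀ k y, R.rel y (e k y)) ∧
      ∀ y y', R.rel y y' → Relation.EqvGen (fun a b => ∃ k, e k a = e k b) y y' := by
  obtain ⟨Φ, hΦ, -, hsub, hgen⟩ := hT
  obtain ⟨B, hBm, hB⟩ := exists_separating Y
  have hne : ∀ i, ∀ y ∈ (Φ i).src, y ≠ (Φ i).toFun y := by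
    intro i y hy he
    obtain ⟨j, hj, -⟩ := hΦ 1 (fun _ => i) (fun _ => true) (fun _ => y) one_pos rfl
      fun j _ => ⟨hy, he.symm⟩
    omega
  set s : ℕ → Y → ℕ × Bool := fun i y => sel fun m => B m y ∧ ¬ B m ((Φ i).toFun y) with hs
  have hsm : ∀ i, MFib (s i) := fun i => MFib.sel fun m =>
    (hBm m).and ((hBm m).comp (Φ i).meas_toFun).not
  have hss : ∀ i, ∀ y ∈ (Φ i).src, B (s i y) y ∧ ¬ B (s i y) ((Φ i).toFun y) :=
    fun i y hy => sel_spec (P := fun m => B m y ∧ ¬ B m ((Φ i).toFun y)) (hB _ _ (hne i y hy))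
  set leaf : ℕ × ℕ × Bool → Y → Prop := fun k y => y ∈ (Φ k.1).src ∧ s k.1 y = k.2 with hleaf
  have hnl : ∀ k y, leaf k y → ¬ leaf k ((Φ k.1).toFun y) := by
    rintro k y ⟨h1, h2⟩ ⟨h3, h4⟩
    have := (hss _ _ h1).2
    have h5 := (hss _ _ h3).1
    rw [h4] at h5
    rw [h2] at this
    exact this h5
  have hinj : ∀ i, ∀ y ∈ (Φ i).src, ∀ y' ∈ (Φ i).src, (Φ i).toFun y = (Φ i).toFun y' → y = y' := by
    intro i y hy y' hy' he
    rw [← (Φ i).left_inv y hy, he, (Φ i).left_inv y' hy']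
  set e : ℕ × ℕ × Bool → Y → Y := fun k y => if leaf k y then (Φ k.1).toFun y else y with he
  have hstep : ∀ k y y', e k y = e k y' → y ≠ y' →
      ∃ ε, PBIStep (Φ k.1) ε y y' ∧ leaf k (if ε then y else y') := by
    intro k y y' hyy hne'
    simp only [e] at hyy
    split_ifs at hyy with h1 h2 h2
    · exact absurd (hinj _ _ h1.1 _ h2.1 hyy) hne'
    · exact ⟨true, ⟨h1.1, hyy⟩, by simpa using h1⟩
    · refine ⟨false, ⟨?_, ?_⟩, by simpa using h2⟩
      · rw [hyy]; exact (Φ k.1).mapsTo h2.1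
      · rw [hyy]; exact (Φ k.1).left_inv _ h2.1
    · exact absurd hyy hne'
  refine ⟨e, ?_, ?_, ?_, ?_⟩
  · intro k
    refine Measurable.ite ?_ (Φ k.1).meas_toFun measurable_id
    exact measurableSet_setOfPred.2 ((measurableSet_setOfPred.1 (Φ k.1).src_meas).and (hsm k.1 k.2))
  · intro n x i hn hx hxne hst
    choose! ε hε1 hε2 using fun j (hj : j < n) => hstep (i j) _ _ (hst j hj) (hxne j hj)
    obtain ⟨j, hj, hij, hεj⟩ := hΦ n (fun j => (i j).1) ε x (by omega) hx hε1
    refine ⟨j, hj, Prod.ext hij ?_⟩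
    have a1 := hε1 j (by omega)
    have a2 := hε1 (j + 1) hj
    have b1 := hε2 j (by omega)
    have b2 := hε2 (j + 1) hj
    have hij' : (i j).1 = (i (j + 1)).1 := hij
    cases h1 : ε j <;> cases h2 : ε (j + 1) <;> simp only [h1, h2, ne_eq, not_true_eq_false] at hεj
    · simp only [h1, h2, if_true] at b1 b2
      simp only [Bool.false_eq_true, if_false] at b1
      rw [← b1.2, ← b2.2, hij']
    · simp only [h1, h2, if_true] at a1 a2 b1 b2
      simp only [Bool.false_eq_true, if_false] at b2
      have : x j = x (j + 1 + 1) := by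
        refine hinj (i j).1 _ b1.1 _ ?_ ?_
        · rw [hij']; exact b2.1
        · rw [a1.2, hij', ← a2.2, (Φ _).right_inv _ a2.1]
      rw [← b1.2, ← b2.2, hij', this]
  · intro k y
    by_cases h : leaf k y
    · simp only [e, h, if_true]
      exact (hsub k.1).2 y h.1
    · simp only [e, h, if_false]
      exact R.refl _ (by simp [hdom])
  · intro y y' hyy
    refine ((hgen y y').1 hyy).2.mono ?_
    rintro a b ⟨i, ha, rfl⟩
    refine ⟨(i, s i a), ?_⟩
    have hl : leaf (i, s i a) a := ⟨ha, rfl⟩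
    have := hnl _ _ hl
    simp only [e, hl, if_true]
    rw [if_neg this]

/-- The part of a measured orbit relation, conjugated into one of the given subgroups. -/
theorem exists_conjugator_of_freeProduct {G X Y H Q K : Type} [Group G] [Countable G]
    [MeasurableSpace X]
    [StandardBorelSpace X] [MulAction G X] [MeasurableConstSMul G X] [MeasurableSpace Y]
    [StandardBorelSpace Y] [Group H] [Countable H] [MulAction H Y] [MeasurableConstSMul H Y]
    [Countable Q] [Nonempty Q] [Countable K]
    {μ : Measure X} [IsFiniteMeasure μ] [SMulInvariantMeasure G X μ]
    (hfX : FreeAct G X) (hfY : FreeAct H Y)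
    {L₀ : Subgroup H} {L : Q → Subgroup H}
    (hL : IsFreeProductOf H (fun j : Option Q => j.elim L₀ L))
    {e : K → Y → Y} (hem : ∀ k, Measurable (e k))
    (hef : FreeRel fun k y y' => e k y = e k y') (heo : ∀ k y, SubRel Y L₀ y (e k y))
    (heg : ∀ y y', SubRel Y L₀ y y' → Relation.EqvGen (fun a b => ∃ k, e k a = e k b) y y')
    {τ : X → Y} {σ : Y → X} (hτm : Measurable τ) (hσm : Measurable σ)
    (hτ : ∀ (g : G) x, ∃ h : H, h • τ x = τ (g • x)) (hστ : ∀ x, ∃ g : G, g • σ (τ x) = x)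
    {C : Subgroup G} [Infinite C] {R : CBER X} (hdom : R.dom = Set.univ)
    (hR : ∀ x y, R.rel x y ↔ SubRel X C x y) (hFI : FreelyIndecomposableMod μ R) :
    ∃ (Z : Set X) (q : X → Q) (v : X → Y), MeasurableSet Z ∧ μ Zᶜ = 0 ∧
      (∀ g ∈ C, ∀ x ∈ Z, g • x ∈ Z) ∧ MFib q ∧ Measurable v ∧
      ∀ x ∈ Z, (∃ h : H, h • τ x = v x) ∧
        ∀ g ∈ C, q (g • x) = q x ∧ SubRel Y (L (q x)) (v x) (v (g • x)) := by
  obtain ⟨B, hBm, hB⟩ := exists_separating X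
  have hk : ∀ k, Equivalence fun y y' => e k y = e k y' := fun k =>
    ⟨fun _ => rfl, fun h => h.symm, fun h h' => h.trans h'⟩
  have hsubk : ∀ k y y', e k y = e k y' → SubRel Y L₀ y y' := fun k y y' h =>
    (SubRel.equivalence L₀).trans (heo k y) (h ▸ (SubRel.equivalence L₀).symm (heo k y'))
  have hgat := hL.gated hfY
  set c : Transfer X Y H G (Q ⊕ K) :=
    { τ := τ
      σ := fun g y => g • σ y
      S := fun i => Sum.elim (fun q => SubRel Y (L q)) (fun k y y' => e k y = e k y') i
      B := B
      S_equiv := by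
        rintro (q | k)
        · exact SubRel.equivalence _
        · exact hk k
      S_sub := by
        rintro (q | k) y y' h
        · obtain ⟨h, -, hh⟩ := h
          exact ⟨h, hh⟩
        · obtain ⟨h, -, hh⟩ := hsubk k y y' h
          exact ⟨h, hh⟩
      gated := Gated.refine_none (S := fun i : Option Q => SubRel Y (i.elim L₀ L))
        (fun _ => SubRel.equivalence _) hgat (hef.gated hk) hsubk
      gen := by
        intro y h
        have := hL.eqvGen y h
        generalize h • y = z at this ⊢
        induction this with
        | rel a b hab =>
          obtain ⟨(_ | q), hab⟩ := hab
          · refine (heg a b hab).mono ?_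
            rintro a b ⟨k, hk⟩
            exact ⟨.inr k, hk⟩
          · exact .rel _ _ ⟨.inl q, hab⟩
        | refl a => exact .refl a
        | symm a b _ ih => exact ih.symm
        | trans a b c _ _ ih ih' => exact ih.trans _ _ _ ih'
      σ_τ := hστ
      sep := hB } with hc
  have hcm : c.Meas := by
    refine ⟨hτm, fun g => hσm.const_smul g, ?_, hBm⟩
    rintro (q | k)
    · change Measurable fun p : Y × Y => ∃ h ∈ L q, h • p.1 = p.2
      exact .exists fun h => measurable_const.and ((measurable_fst.const_smul h).eqProp measurable_snd)
    · exact ((hem k).comp measurable_fst).eqProp ((hem k).comp measurable_snd)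
  have hfC : FreeAct C X := fun x g hg => Subtype.ext (hfX x g hg)
  obtain ⟨Z, jj, v, hZ, hZ0, hZi, hjj, hv, H1⟩ := Transfer.exists_conjugator (Γ := C) (c := c)
    hfC hcm (fun γ x => hτ γ x) hdom
    (fun x y => by rw [hR]; exact ⟨fun ⟨g, hg, h⟩ => ⟨⟨g, hg⟩, h⟩, fun ⟨g, h⟩ => ⟨g, g.2, h⟩⟩) hFI
  have hnull : ∀ k, μ (Z ∩ {x | jj x = .inr k}) = 0 := fun k =>
    Transfer.measure_eq_zero_of_kernel (Γ := C) (c := c) hfC hcm hZ hZi hjj hv H1 (.inr k)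
      (hem k) (fun y => by obtain ⟨h, -, hh⟩ := heo k y; exact ⟨h, hh⟩) fun y y' h => h
  refine ⟨Z ∩ {x | ∃ q, jj x = .inl q}, fun x => Sum.elim id (fun _ => Classical.arbitrary Q) (jj x),
    v, hZ.inter (measurableSet_setOfPred.2 (hjj.prop fun i => ∃ q, i = .inl q)), ?_, ?_, hjj.map _,
    hv, ?_⟩
  · refine measure_mono_null (t := Zᶜ ∪ ⋃ k, Z ∩ {x | jj x = .inr k}) ?_
      (measure_union_null hZ0 (measure_iUnion_null hnull))
    intro x hx
    by_cases hxZ : x ∈ Z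
    · right
      match hj : jj x with
      | .inl q => exact absurd ⟨hxZ, q, hj⟩ hx
      | .inr k => exact Set.mem_iUnion.2 ⟨k, hxZ, hj⟩
    · exact .inl hxZ
  · rintro g hg x ⟨hx, q, hq⟩
    exact ⟨hZi ⟨g, hg⟩ x hx, q, (((H1 x hx).2 ⟨g, hg⟩).1).trans hq⟩
  · rintro x ⟨hx, q, hq⟩
    refine ⟨(H1 x hx).1, fun g hg => ?_⟩
    obtain ⟨h1, h2⟩ := (H1 x hx).2 ⟨g, hg⟩
    have h1' : jj (g • x) = jj x := h1
    refine ⟨by simp only [h1'], ?_⟩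
    simp only [hq] at h2 ⊢
    exact h2

/-! ### Malnormality of the factors -/

theorem Gated.gate_unique {V ι : Type} {S : ι → V → V → Prop} (hS : ∀ i, Equivalence (S i)) {i : ι}
    {a : V} {π π' : V → V} (h1 : ∀ y, S i a y → π y = y) (h1' : ∀ y, S i a y → π' y = y)
    (h3 : ∀ k y y', S k y y' → ¬(k = i ∧ S i a y) → π y = π y')
    (h3' : ∀ k y y', S k y y' → ¬(k = i ∧ S i a y) → π' y = π' y') {y : V}
    (hy : Relation.EqvGen (fun y y' => ∃ k, S k y y') a y) : π y = π' y := by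
  have key : ∀ z z', Relation.EqvGen (fun y y' => ∃ k, S k y y') z z' →
      (π z = π' z ↔ π z' = π' z') := by
    intro z z' h
    induction h with
    | rel z z' h =>
      obtain ⟨k, hk⟩ := h
      by_cases hki : k = i ∧ S i a z
      · obtain ⟨rfl, ha⟩ := hki
        have ha' := (hS k).trans ha hk
        rw [h1 _ ha, h1' _ ha, h1 _ ha', h1' _ ha']
        simp
      · rw [h3 _ _ _ hk hki, h3' _ _ _ hk hki]
    | refl => exact Iff.rfl
    | symm _ _ _ ih => exact ih.symm
    | trans _ _ _ _ _ ih ih' => exact ih.trans ih'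
  have ha := (hS i).refl a
  exact (key _ _ hy).1 ((h1 a ha).trans (h1' a ha).symm)

/-- An equivariant projection of a free product onto one of its factors. -/
theorem IsFreeProductOf.exists_projection {G ι : Type} [Group G] {L : ι → Subgroup G}
    (hL : IsFreeProductOf G L) (i : ι) :
    ∃ π : G → G, (∀ g, π g ∈ L i) ∧ (∀ g, ∀ c ∈ L i, π (g * c) = π g * c) ∧
      ∀ k g, ∀ l ∈ L k, ¬(k = i ∧ g ∈ L i) → π (l * g) = π g := by
  have hf : FreeAct G G := fun y h e => by simpa using e
  obtain ⟨π, h1, h2, h3⟩ := hL.gated hf i 1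
  have hmem : ∀ g, SubRel G (L i) 1 g ↔ g ∈ L i := fun g =>
    ⟨fun ⟨h, hh, e⟩ => by simpa [← e] using hh, fun h => ⟨g, h, by simp⟩⟩
  simp only [hmem] at h1 h2 h3
  refine ⟨π, h2, fun g c hc => ?_, fun k g l hl hn => (h3 k _ _ ⟨l, hl, rfl⟩ hn).symm⟩
  have := Gated.gate_unique (S := fun i => SubRel G (L i)) (i := i) (a := 1)
    (π := π) (π' := fun g => π (g * c) * c⁻¹)
    (fun i => SubRel.equivalence _) (fun y hy => h1 y ((hmem y).1 hy))
    (fun y hy => by rw [h1 _ ((L i).mul_mem ((hmem y).1 hy) hc), mul_inv_cancel_right])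
    (fun k y y' hy hn => h3 k y y' hy (by rwa [hmem] at hn))
    (fun k y y' hy hn => by
      obtain ⟨l, hl, rfl⟩ := hy
      rw [hmem] at hn
      have := h3 k (y * c) (l • y * c) ⟨l, hl, by simp [mul_assoc]⟩ fun h =>
        hn ⟨h.1, by simpa using (L i).mul_mem h.2 ((L i).inv_mem hc)⟩
      simp only [this])
    (y := g) (by simpa using hL.eqvGen (1 : G) g)
  rw [this, inv_mul_cancel_right]

/-- A measurable map conjugating a factor into a factor is almost surely inner. -/
theorem measure_not_inner_eq_zero {G X P : Type} [Group G] [Countable G] [MeasurableSpace X]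
    [StandardBorelSpace X] [MulAction G X] [MeasurableConstSMul G X] [Countable P]
    {μ : Measure X} [IsFiniteMeasure μ] [SMulInvariantMeasure G X μ] (hf : FreeAct G X)
    {C₀ : Subgroup G} {C : P → Subgroup G}
    (hC : IsFreeProductOf G (fun j : Option P => j.elim C₀ C)) (p : P) [Infinite (C p)]
    {A : Set X} (hA : MeasurableSet A) (hAi : ∀ g ∈ C p, ∀ x ∈ A, g • x ∈ A)
    {θ : X → X} (hθ : Measurable θ) (hθo : ∀ x ∈ A, ∃ g : G, θ x = g • x) {r : X → P} (hr : MFib r)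
    (h : ∀ x ∈ A, ∀ g ∈ C p, r (g • x) = r x ∧ SubRel X (C (r x)) (θ x) (θ (g • x))) :
    μ (A ∩ {x | ¬ (r x = p ∧ SubRel X (C p) x (θ x))}) = 0 := by
  obtain ⟨π, hπ1, hπ2, hπ3⟩ := hC.exists_projection (some p)
  set γ : X → G := fun x => sel fun g : G => θ x = g • x with hγ
  have hγm : MFib γ := MFib.sel fun g => hθ.eqProp (measurable_const_smul g)
  have hγs : ∀ x ∈ A, θ x = γ x • x := fun x hx => sel_spec (P := fun g : G => θ x = g • x) (hθo x hx)
  have hfp : FreeAct (C p) X := fun x g hg => Subtype.ext (hf x g hg)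
  have hin : ∀ x ∈ A, SubRel X (C p) x (θ x) ↔ γ x ∈ C p := by
    intro x hx
    rw [hγs x hx]
    exact ⟨fun ⟨g, hg, e⟩ => hf.eq e ▸ hg, fun hg => ⟨_, hg, rfl⟩⟩
  have hγe : ∀ x ∈ A, ∀ g ∈ C p, ∃ l ∈ C (r x), γ (g • x) = l * γ x * g⁻¹ := by
    intro x hx g hg
    obtain ⟨l, hl, e⟩ := (h x hx g hg).2
    refine ⟨l, hl, ?_⟩
    rw [hγs x hx, hγs _ (hAi g hg x hx), ← mul_smul, ← mul_smul] at e
    rw [hf.eq e, mul_inv_cancel_right]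
  refine measure_eq_zero_of_selection (Γ := C p) (κ := fun x => π (γ x) • x) hfp ?_ ?_ ?_ ?_ ?_
  · refine hA.inter (measurableSet_setOfPred.2 (Measurable.not ((hr p).and ?_)))
    exact .exists fun g => measurable_const.and ((measurable_const_smul g).eqProp hθ)
  · rintro ⟨g, hg⟩ x ⟨hx, hn⟩
    refine ⟨hAi g hg x hx, fun hh => hn ?_⟩
    obtain ⟨h1, h2⟩ := hh
    change r (g • x) = p at h1
    have h1' : r x = p := by rw [← (h x hx g hg).1, h1]
    refine ⟨h1', ?_⟩
    obtain ⟨l, hl, e⟩ := hγe x hx g hg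
    rw [h1'] at hl
    replace h2 := (hin _ (hAi g hg x hx)).1 h2
    rw [e] at h2
    rw [hin x hx]
    have := (C p).mul_mem ((C p).mul_mem ((C p).inv_mem hl) h2) hg
    simpa [mul_assoc] using this
  · exact hγm.apply (F := fun g x => π g • x) fun g => measurable_const_smul _
  · rintro x -
    exact ⟨⟨_, hπ1 (γ x)⟩, rfl⟩
  · rintro x ⟨hx, hn⟩ ⟨g, hg⟩
    obtain ⟨l, hl, e⟩ := hγe x hx g hg
    change π (γ (g • x)) • g • x = π (γ x) • x
    rw [e, hπ2 _ _ ((C p).inv_mem hg), hπ3 (some (r x)) _ l hl, ← mul_smul, inv_mul_cancel_right]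
    rintro ⟨h1, h2⟩
    exact hn ⟨by simpa using h1, (hin x hx).2 h2⟩

/-! ### Maps of orbits scaling the measure -/

/-- A pair of maps inducing mutually inverse bijections between the orbits of two actions, such
that partial injections along them scale the measure by a constant. -/
structure OrbitMap (G H : Type) {X Y : Type} [Group G] [Group H] [MulAction G X] [MulAction H Y]
    [MeasurableSpace X] [MeasurableSpace Y] (μ : Measure X) (ν : Measure Y) where
  τ : X → Y
  σ : Y → X
  c : ENNReal
  τ_meas : Measurable τ
  σ_meas : Measurable σ
  τ_smul : ∀ (g : G) x, ∃ h : H, h • τ x = τ (g • x)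
  σ_smul : ∀ (h : H) y, ∃ g : G, g • σ y = σ (h • y)
  σ_τ : ∀ x, ∃ g : G, g • σ (τ x) = x
  τ_σ : ∀ y, ∃ h : H, h • τ (σ y) = y
  c_ne_zero : c ≠ 0
  c_ne_top : c ≠ ⊤
  measure_image : ∀ (E : Set X) (φ : X → Y), MeasurableSet E → Measurable φ → Set.InjOn φ E →
    (∀ x ∈ E, ∃ h : H, h • τ x = φ x) → ν (φ '' E) = c * μ E

namespace OrbitMap

set_option linter.unusedSectionVars false

variable {G H X Y : Type} [Group G] [Group H] [Countable G] [Countable H]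
  [MeasurableSpace X] [MeasurableSpace Y] [StandardBorelSpace X] [StandardBorelSpace Y]
  [MulAction G X] [MulAction H Y] [MeasurableConstSMul G X] [MeasurableConstSMul H Y]
  {μ : Measure X} {ν : Measure Y} (O : OrbitMap G H μ ν)

/-- The points of `X` and `Y` lying in corresponding orbits. -/
def T (x : X) (y : Y) : Prop := ∃ h : H, h • O.τ x = y

theorem T_iff {x : X} {y : Y} : O.T x y ↔ ∃ g : G, g • O.σ y = x := by
  constructor
  · rintro ⟨h, rfl⟩
    obtain ⟨g, hg⟩ := O.σ_smul h (O.τ x)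
    obtain ⟨k, hk⟩ := O.σ_τ x
    exact ⟨k * g⁻¹, by rw [← hg, mul_smul, inv_smul_smul, hk]⟩
  · rintro ⟨g, rfl⟩
    obtain ⟨h, hh⟩ := O.τ_smul g (O.σ y)
    obtain ⟨k, hk⟩ := O.τ_σ y
    exact ⟨k * h⁻¹, by rw [← hh, mul_smul, inv_smul_smul, hk]⟩

variable {O}

theorem T.smul_left {x : X} {y : Y} (h : O.T x y) (g : G) : O.T (g • x) y := by
  obtain ⟨k, rfl⟩ := O.T_iff.1 h
  exact O.T_iff.2 ⟨g * k, mul_smul _ _ _⟩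

theorem T.smul_right {x : X} {y : Y} (h : O.T x y) (g : H) : O.T x (g • y) := by
  obtain ⟨k, rfl⟩ := h
  exact ⟨g * k, mul_smul _ _ _⟩

theorem T.left_rel {x x' : X} {y : Y} (h : O.T x y) (h' : O.T x' y) : ∃ g : G, x' = g • x := by
  obtain ⟨k, rfl⟩ := O.T_iff.1 h
  obtain ⟨l, rfl⟩ := O.T_iff.1 h'
  exact ⟨l * k⁻¹, by rw [mul_smul, inv_smul_smul]⟩

theorem T.right_rel {x : X} {y y' : Y} (h : O.T x y) (h' : O.T x y') : ∃ g : H, y' = g • y := by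
  obtain ⟨k, rfl⟩ := h
  obtain ⟨l, rfl⟩ := h'
  exact ⟨l * k⁻¹, by rw [mul_smul, inv_smul_smul]⟩

/-- Preimages of null sets along `T` are null. -/
theorem measure_preimage_right {A : Set X} (hA : MeasurableSet A) {v : X → Y} (hv : Measurable v)
    (hT : ∀ x ∈ A, O.T x (v x)) {N : Set Y} (hN : MeasurableSet N) (hN0 : ν N = 0) :
    μ (A ∩ v ⁻¹' N) = 0 := by
  have : A ∩ v ⁻¹' N = ⋃ g : G, (A ∩ v ⁻¹' N) ∩ {x | g • O.σ (v x) = x} := by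
    ext x
    simp only [Set.mem_iUnion, Set.mem_inter_iff]
    constructor
    · intro h
      obtain ⟨g, hg⟩ := O.T_iff.1 (hT x h.1)
      exact ⟨g, h, hg⟩
    · rintro ⟨g, h, -⟩
      exact h
  rw [this]
  refine measure_iUnion_null fun g => ?_
  set E := (A ∩ v ⁻¹' N) ∩ {x | g • O.σ (v x) = x}
  have h := O.measure_image E v ((hA.inter (hv hN)).inter
      (measurableSet_setOfPred.2 (((O.σ_meas.comp hv).const_smul g).eqProp measurable_id))) hv ?_
      fun x hx => hT x hx.1.1
  · have h0 : ν (v '' E) = 0 := by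
      refine measure_mono_null ?_ hN0
      rintro _ ⟨x, hx, rfl⟩
      exact hx.1.2
    rw [h0] at h
    exact (mul_eq_zero.1 h.symm).resolve_left O.c_ne_zero
  · intro x hx x' hx' e
    have h1 : g • O.σ (v x) = x := hx.2
    have h2 : g • O.σ (v x') = x' := hx'.2
    rw [← h1, e, h2]

theorem measure_preimage_left {A : Set Y} {u : Y → X} (hu : Measurable u)
    (hT : ∀ y ∈ A, O.T (u y) y) {N : Set X} (hN : MeasurableSet N) (hN0 : μ N = 0) :
    ν (A ∩ u ⁻¹' N) = 0 := by
  set E : H → Set X := fun h => N ∩ {x | u (h • O.τ x) = x}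
  refine measure_mono_null (t := ⋃ h : H, (fun x => h • O.τ x) '' E h) ?_
    (measure_iUnion_null fun h => ?_)
  · rintro y ⟨hy, hyN⟩
    obtain ⟨h, hh⟩ := hT y hy
    refine Set.mem_iUnion.2 ⟨h, u y, ⟨hyN, ?_⟩, hh⟩
    change u (h • O.τ (u y)) = u y
    rw [hh]
  · rw [O.measure_image (E h) (fun x => h • O.τ x) ?_ (O.τ_meas.const_smul h) ?_ fun x _ => ⟨h, rfl⟩]
    · rw [measure_mono_null Set.inter_subset_left hN0, mul_zero]
    · exact hN.inter (measurableSet_setOfPred.2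
        ((hu.comp (O.τ_meas.const_smul h)).eqProp measurable_id))
    · intro x hx x' hx' e
      have h1 : u (h • O.τ x) = x := hx.2
      have h2 : u (h • O.τ x') = x' := hx'.2
      have e' : h • O.τ x = h • O.τ x' := e
      rw [← h1, e', h2]

end OrbitMap

/-- A conjugation of the orbits of `C` on `X₁` with the orbits of `L` on `Y₁`. -/
structure Match {G H X Y : Type} [Group G] [Group H] [MulAction G X] [MulAction H Y]
    [MeasurableSpace X] [MeasurableSpace Y] {μ : Measure X} {ν : Measure Y}
    (O : OrbitMap G H μ ν) (C : Subgroup G) (L : Subgroup H) (v : X → Y) (u : Y → X)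
    (X₁ : Set X) (Y₁ : Set Y) : Prop where
  v_meas : Measurable v
  u_meas : Measurable u
  measX : MeasurableSet X₁
  measY : MeasurableSet Y₁
  smulX : ∀ g ∈ C, ∀ x ∈ X₁, g • x ∈ X₁
  smulY : ∀ h ∈ L, ∀ y ∈ Y₁, h • y ∈ Y₁
  v_mem : ∀ x ∈ X₁, v x ∈ Y₁
  u_mem : ∀ y ∈ Y₁, u y ∈ X₁
  T_v : ∀ x ∈ X₁, O.T x (v x)
  T_u : ∀ y ∈ Y₁, O.T (u y) y
  v_smul : ∀ g ∈ C, ∀ x ∈ X₁, SubRel Y L (v x) (v (g • x))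
  u_smul : ∀ h ∈ L, ∀ y ∈ Y₁, SubRel X C (u y) (u (h • y))
  u_v : ∀ x ∈ X₁, SubRel X C x (u (v x))
  v_u : ∀ y ∈ Y₁, SubRel Y L y (v (u y))

/-- Restriction of a conjugation to an invariant set. -/
theorem Match.restrict {G H X Y : Type} [Group G] [Group H] [MulAction G X] [MulAction H Y]
    [MeasurableSpace X] [MeasurableSpace Y] {μ : Measure X} {ν : Measure Y}
    {O : OrbitMap G H μ ν} {C : Subgroup G} {L : Subgroup H} {v : X → Y} {u : Y → X}
    {X₁ : Set X} {Y₁ : Set Y} (m : Match O C L v u X₁ Y₁) {X₂ : Set X} (hX₂ : MeasurableSet X₂)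
    (hsub : X₂ ⊆ X₁) (hinv : ∀ g ∈ C, ∀ x ∈ X₂, g • x ∈ X₂) :
    Match O C L v u X₂ (Y₁ ∩ u ⁻¹' X₂) where
  v_meas := m.v_meas
  u_meas := m.u_meas
  measX := hX₂
  measY := m.measY.inter (m.u_meas hX₂)
  smulX := hinv
  smulY := by
    rintro h hh y ⟨hy, hyu⟩
    obtain ⟨g, hg, e⟩ := m.u_smul h hh y hy
    exact ⟨m.smulY h hh y hy, by rw [Set.mem_preimage, ← e]; exact hinv g hg _ hyu⟩
  v_mem := by
    intro x hx
    obtain ⟨g, hg, e⟩ := m.u_v x (hsub hx)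
    exact ⟨m.v_mem x (hsub hx), by rw [Set.mem_preimage, ← e]; exact hinv g hg x hx⟩
  u_mem := fun y hy => hy.2
  T_v := fun x hx => m.T_v x (hsub hx)
  T_u := fun y hy => m.T_u y hy.1
  v_smul := fun g hg x hx => m.v_smul g hg x (hsub hx)
  u_smul := fun h hh y hy => m.u_smul h hh y hy.1
  u_v := fun x hx => m.u_v x (hsub hx)
  v_u := fun y hy => m.v_u y hy.1

theorem measurable_subRel {H Y A : Type} [Group H] [Countable H] [MulAction H Y]
    [MeasurableSpace Y] [StandardBorelSpace Y] [MeasurableConstSMul H Y] [MeasurableSpace A]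
    (L : Subgroup H) {f f' : A → Y}
    (hf : Measurable f) (hf' : Measurable f') : Measurable fun a => SubRel Y L (f a) (f' a) :=
  .exists fun h => measurable_const.and ((hf.const_smul h).eqProp hf')

/-- The points whose orbit under the factor `C` is conjugated to an orbit of `L`, and back. -/
def matchSet {G X Y P Q : Type} [Group G] [MulAction G X]
    (C : Subgroup G) (p : P) (q : Q) (Z : Set X) (qf : X → Q) (v : X → Y) (Z' : Set Y)
    (pf : Y → P) (u : Y → X) : Set X :=
  {x | x ∈ Z ∧ qf x = q ∧ v x ∈ Z' ∧ pf (v x) = p ∧ SubRel X C x (u (v x))}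

theorem measurableSet_matchSet {G X Y P Q : Type} [Group G] [Countable G] [MulAction G X]
    [MeasurableSpace X] [MeasurableSpace Y] [StandardBorelSpace X] [MeasurableConstSMul G X]
    {C : Subgroup G} {p : P} {q : Q}
    {Z : Set X} {qf : X → Q} {v : X → Y} {Z' : Set Y} {pf : Y → P} {u : Y → X}
    (hZ : MeasurableSet Z) (hqf : MFib qf) (hv : Measurable v) (hZ' : MeasurableSet Z')
    (hpf : MFib pf) (hu : Measurable u) :
    MeasurableSet (matchSet C p q Z qf v Z' pf u) :=
  measurableSet_setOfPred.2 <| (measurableSet_setOfPred.1 hZ).and <| (hqf q).and <|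
    (measurableSet_setOfPred.1 (hv hZ')).and <| ((hpf p).comp hv).and <|
    measurable_subRel C measurable_id (hu.comp hv)

theorem match_matchSet {G H X Y P Q : Type} [Group G] [Group H] [Countable G] [Countable H]
    [MulAction G X] [MulAction H Y]
    [MeasurableSpace X] [MeasurableSpace Y] [StandardBorelSpace X] [MeasurableConstSMul G X]
    [StandardBorelSpace Y] [MeasurableConstSMul H Y]
    {μ : Measure X} {ν : Measure Y}
    {O : OrbitMap G H μ ν} {C : P → Subgroup G} {L : Q → Subgroup H} {p : P} {q : Q}
    {Z : Set X} {qf : X → Q} {v : X → Y} {Z' : Set Y} {pf : Y → P} {u : Y → X}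
    (hZ : MeasurableSet Z) (hqf : MFib qf) (hv : Measurable v) (hZ' : MeasurableSet Z')
    (hpf : MFib pf) (hu : Measurable u)
    (hZi : ∀ g ∈ C p, ∀ x ∈ Z, g • x ∈ Z) (hZi' : ∀ h ∈ L q, ∀ y ∈ Z', h • y ∈ Z')
    (hvT : ∀ x ∈ Z, O.T x (v x)) (huT : ∀ y ∈ Z', O.T (u y) y)
    (hvs : ∀ x ∈ Z, ∀ g ∈ C p, qf (g • x) = qf x ∧ SubRel Y (L (qf x)) (v x) (v (g • x)))
    (hus : ∀ y ∈ Z', ∀ h ∈ L q, pf (h • y) = pf y ∧ SubRel X (C (pf y)) (u y) (u (h • y))) :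
    Match O (C p) (L q) v u (matchSet (C p) p q Z qf v Z' pf u)
      (matchSet (L q) q p Z' pf u Z qf v) where
  v_meas := hv
  u_meas := hu
  measX := measurableSet_matchSet hZ hqf hv hZ' hpf hu
  measY := measurableSet_matchSet hZ' hpf hu hZ hqf hv
  smulX := by
    rintro g hg x ⟨h1, h2, h3, h4, h5⟩
    obtain ⟨e1, e2⟩ := hvs x h1 g hg
    rw [h2] at e2
    obtain ⟨l, hl, e3⟩ := e2
    obtain ⟨e4, e5⟩ := hus _ h3 l hl
    rw [h4] at e5
    rw [e3] at e4 e5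
    refine ⟨hZi g hg x h1, e1.trans h2, e3 ▸ hZi' l hl _ h3, e4.trans h4, ?_⟩
    have E := SubRel.equivalence (Y := X) (C p)
    exact E.trans (E.symm ⟨g, hg, rfl⟩) (E.trans h5 e5)
  smulY := by
    rintro g hg x ⟨h1, h2, h3, h4, h5⟩
    obtain ⟨e1, e2⟩ := hus x h1 g hg
    rw [h2] at e2
    obtain ⟨l, hl, e3⟩ := e2
    obtain ⟨e4, e5⟩ := hvs _ h3 l hl
    rw [h4] at e5
    rw [e3] at e4 e5
    refine ⟨hZi' g hg x h1, e1.trans h2, e3 ▸ hZi l hl _ h3, e4.trans h4, ?_⟩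
    have E := SubRel.equivalence (Y := Y) (L q)
    exact E.trans (E.symm ⟨g, hg, rfl⟩) (E.trans h5 e5)
  v_mem := by
    rintro x ⟨h1, h2, h3, h4, g, hg, h5⟩
    obtain ⟨e1, e2⟩ := hvs x h1 g hg
    rw [h2, h5] at e2
    rw [h5] at e1
    exact ⟨h3, h4, h5 ▸ hZi g hg x h1, e1.trans h2, e2⟩
  u_mem := by
    rintro x ⟨h1, h2, h3, h4, g, hg, h5⟩
    obtain ⟨e1, e2⟩ := hus x h1 g hg
    rw [h2, h5] at e2
    rw [h5] at e1
    exact ⟨h3, h4, h5 ▸ hZi' g hg x h1, e1.trans h2, e2⟩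
  T_v := fun x hx => hvT x hx.1
  T_u := fun y hy => huT y hy.1
  v_smul := fun g hg x hx => by
    have := (hvs x hx.1 g hg).2
    rwa [hx.2.1] at this
  u_smul := fun g hg x hx => by
    have := (hus x hx.1 g hg).2
    rwa [hx.2.1] at this
  u_v := fun x hx => hx.2.2.2.2
  v_u := fun y hy => hy.2.2.2.2

/-- The sets `matchSet` cover almost all of the space. -/
theorem measure_compl_iUnion_matchSet {G H X Y P Q : Type} [Group G] [Group H] [Countable G]
    [Countable H] [Countable P] [Countable Q]
    [MulAction G X] [MulAction H Y]
    [MeasurableSpace X] [MeasurableSpace Y] [StandardBorelSpace X] [MeasurableConstSMul G X]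
    [StandardBorelSpace Y] [MeasurableConstSMul H Y]
    {μ : Measure X} {ν : Measure Y} [IsFiniteMeasure μ] [SMulInvariantMeasure G X μ]
    (hf : FreeAct G X) {C₀ : Subgroup G} {C : P → Subgroup G} {L : Q → Subgroup H}
    (hC : IsFreeProductOf G (fun j : Option P => j.elim C₀ C)) (p : P) [Infinite (C p)]
    {Z : Set X} {qf : X → Q} {v : X → Y} {Z' : Q → Set Y} {pf : Q → Y → P} {u : Q → Y → X}
    (hZ : MeasurableSet Z) (hZ0 : μ Zᶜ = 0) (hqf : MFib qf) (hv : Measurable v)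
    (hZ' : ∀ q, MeasurableSet (Z' q)) (hZ'0 : ∀ q, ν (Z' q)ᶜ = 0)
    (hpf : ∀ q, MFib (pf q)) (hu : ∀ q, Measurable (u q))
    (hZi : ∀ g ∈ C p, ∀ x ∈ Z, g • x ∈ Z) (hZi' : ∀ q, ∀ h ∈ L q, ∀ y ∈ Z' q, h • y ∈ Z' q)
    (hvs : ∀ x ∈ Z, ∀ g ∈ C p, qf (g • x) = qf x ∧ SubRel Y (L (qf x)) (v x) (v (g • x)))
    (hus : ∀ q, ∀ y ∈ Z' q, ∀ h ∈ L q,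
      pf q (h • y) = pf q y ∧ SubRel X (C (pf q y)) (u q y) (u q (h • y)))
    (hnull : ∀ N : Set Y, MeasurableSet N → ν N = 0 → μ (Z ∩ v ⁻¹' N) = 0)
    (hvu : ∀ q, ∀ x ∈ Z, v x ∈ Z' q → ∃ g : G, u q (v x) = g • x) :
    μ (⋃ q, matchSet (C p) p q Z qf v (Z' q) (pf q) (u q))ᶜ = 0 := by
  set A : Set X := Z ∩ {x | v x ∈ Z' (qf x)} with hA
  have hAm : MeasurableSet A := hZ.inter <| measurableSet_setOfPred.2 <|
    hqf.apply (F := fun q x => v x ∈ Z' q) fun q => measurableSet_setOfPred.1 (hv (hZ' q))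
  have key := measure_not_inner_eq_zero (μ := μ) hf hC p hAm ?_
    (θ := fun x => u (qf x) (v x)) (hqf.apply (F := fun q x => u q (v x)) fun q => (hu q).comp hv)
    (fun x hx => hvu _ x hx.1 hx.2) (r := fun x => pf (qf x) (v x))
    (hqf.bind (F := fun q x => pf q (v x)) fun q => (hpf q).comp hv) ?_
  · refine measure_mono_null ?_ (measure_union_null hZ0 (measure_union_null
      (measure_iUnion_null fun q => hnull (Z' q)ᶜ (hZ' q).compl (hZ'0 q)) key))
    intro x hx
    by_cases hxZ : x ∈ Z
    · right
      by_cases hxv : v x ∈ Z' (qf x)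
      · exact .inr ⟨⟨hxZ, hxv⟩, fun h => hx (Set.mem_iUnion.2 ⟨qf x, hxZ, rfl, hxv, h.1, h.2⟩)⟩
      · exact .inl (Set.mem_iUnion.2 ⟨qf x, hxZ, hxv⟩)
    · exact .inl hxZ
  · rintro g hg x ⟨hx, hxv⟩
    refine ⟨hZi g hg x hx, ?_⟩
    obtain ⟨e1, l, hl, e2⟩ := hvs x hx g hg
    change v (g • x) ∈ Z' (qf (g • x))
    rw [e1, ← e2]
    exact hZi' _ l hl _ hxv
  · rintro x ⟨hx, hxv⟩ g hg
    obtain ⟨e1, l, hl, e2⟩ := hvs x hx g hg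
    have := hus _ _ hxv l hl
    simp only [e1, ← e2]
    exact this

/-! ### The coupling attached to a conjugation of orbits -/

theorem map_count_of_bijective {A : Type} [MeasurableSpace A] [DiscreteMeasurableSpace A] {f : A → A}
    (hf : Function.Bijective f) : Measure.map f Measure.count = Measure.count := by
  ext s hs
  rw [Measure.map_apply (.of_discrete) hs, ← Measure.count_injective_image hf.1,
    Set.image_preimage_eq _ hf.2]

namespace Match

variable {G H X Y : Type} [Group G] [Group H] [Countable G] [Countable H]
  [MulAction G X] [MulAction H Y] [MeasurableSpace X] [MeasurableSpace Y]
  [StandardBorelSpace X] [StandardBorelSpace Y] [MeasurableConstSMul G X] [MeasurableConstSMul H Y]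
  {μ : Measure X} {ν : Measure Y}
  {O : OrbitMap G H μ ν} {C : Subgroup G} {L : Subgroup H} {v : X → Y} {u : Y → X}
  {X₁ : Set X} {Y₁ : Set Y}

/-- A section of the orbits gives a decomposition of the measure. -/
theorem tsum_measure (m : Match O C L v u X₁ Y₁) (hfY : FreeAct H Y) :
    ∑' l : L, O.c * μ (X₁ ∩ {x | u (l • v x) = x}) = ν Y₁ := by
  set E : L → Set X := fun l => X₁ ∩ {x | u (l • v x) = x} with hE
  have hlv : ∀ l : L, Measurable fun x => l • v x := fun l => m.v_meas.const_smul (l : H)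
  have hEm : ∀ l, MeasurableSet (E l) := fun l => m.measX.inter
    (measurableSet_setOfPred.2 ((m.u_meas.comp (hlv l)).eqProp measurable_id))
  have hinj : ∀ l, Set.InjOn (fun x => l • v x) (E l) := by
    intro l x hx x' hx' e
    have h1 : u (l • v x) = x := hx.2
    have h2 : u (l • v x') = x' := hx'.2
    have e' : l • v x = l • v x' := e
    rw [← h1, e', h2]
  have himg : ∀ l, ν ((fun x => l • v x) '' E l) = O.c * μ (E l) := fun l =>
    O.measure_image _ _ (hEm l) (hlv l) (hinj l) fun x hx => (m.T_v x hx.1).smul_right (l : H)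
  have hU : Y₁ = ⋃ l : L, (fun x => l • v x) '' E l := by
    ext y
    simp only [Set.mem_iUnion]
    constructor
    · intro hy
      obtain ⟨l, hl, e⟩ := (SubRel.equivalence L).symm (m.v_u y hy)
      refine ⟨⟨l, hl⟩, u y, ⟨m.u_mem y hy, ?_⟩, e⟩
      change u (l • v (u y)) = u y
      rw [e]
    · rintro ⟨l, x, hx, rfl⟩
      exact m.smulY l l.2 _ (m.v_mem x hx.1)
  rw [hU, measure_iUnion]
  · exact tsum_congr fun l => (himg l).symm
  · intro l l' hne
    rw [Function.onFun, Set.disjoint_left]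
    rintro _ ⟨x, hx, rfl⟩ ⟨x', hx', e⟩
    have h1 : u (l • v x) = x := hx.2
    have h2 : u (l' • v x') = x' := hx'.2
    have e' : l' • v x' = l • v x := e
    rw [e', h1] at h2
    subst h2
    exact hne (Subtype.ext (hfY.eq e').symm)
  · exact fun l => (hEm l).image_of_measurable_injOn (hlv l) (hinj l)

theorem measure_pos (m : Match O C L v u X₁ Y₁) (h : μ X₁ ≠ 0) : ν Y₁ ≠ 0 := by
  intro h0
  refine h (measure_mono_null ?_ (O.measure_preimage_right m.measX m.v_meas m.T_v m.measY h0))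
  exact fun x hx => ⟨hx, m.v_mem x hx⟩

theorem meWithIndex [IsFiniteMeasure μ] [IsFiniteMeasure ν] [SMulInvariantMeasure G X μ]
    (m : Match O C L v u X₁ Y₁) (hfX : FreeAct G X) (hfY : FreeAct H Y)
    (hpos : μ X₁ ≠ 0) : MEwithIndex C L (O.c * μ X₁ / ν Y₁) := by
  classical
  let _ : MeasurableSpace L := ⊤
  have : DiscreteMeasurableSpace L := ⟨fun _ => trivial⟩
  set a : C → X → L := fun g x => if x ∈ X₁ then sel fun l : L => l • v x = v (g • x) else 1 with ha
  have ham : ∀ g, Measurable (a g) := fun g => Measurable.ite m.measX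
    (measurable_to_countable' fun l => measurableSet_setOfPred.2
      (MFib.sel (fun l : L => (m.v_meas.const_smul (l : H)).eqProp
        (m.v_meas.comp (measurable_const_smul (g : G)))) l)) measurable_const
  have has : ∀ g, ∀ x ∈ X₁, a g x • v x = v (g • x) := by
    intro g x hx
    simp only [a, if_pos hx]
    obtain ⟨l, hl, e⟩ := m.v_smul g g.2 x hx
    exact sel_spec (P := fun l : L => l • v x = v (g • x)) ⟨⟨l, hl⟩, e⟩
  have hXi : ∀ (g : C) x, g • x ∈ X₁ ↔ x ∈ X₁ := fun g x =>
    ⟨fun h => by simpa [Subgroup.smul_def] using m.smulX _ (C.inv_mem g.2) _ h,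
      fun h => m.smulX _ g.2 _ h⟩
  have hmul : ∀ g g' x, a (g * g') x = a g (g' • x) * a g' x := by
    intro g g' x
    by_cases hx : x ∈ X₁
    · refine Subtype.ext (hfY.eq (y := v x) ?_)
      have h1 := has (g * g') x hx
      have h2 := has g' x hx
      have h3 := has g _ ((hXi g' x).2 hx)
      rw [← h2, ← mul_smul, ← mul_smul] at h3
      rw [← h3] at h1
      exact h1
    · have hx' : g' • x ∉ X₁ := fun h => hx ((hXi g' x).1 h)
      simp only [a, if_neg hx, if_neg hx', mul_one]
  have hone : ∀ x, a 1 x = 1 := by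
    intro x
    have := hmul 1 1 x
    rw [one_smul, mul_one] at this
    simpa using this
  set η : Measure X := (O.c • μ).restrict X₁ with hη
  have : IsFiniteMeasure (O.c • μ) := Measure.smul_finite μ O.c_ne_top
  have hmpη : ∀ g : C, MeasurePreserving (fun x : X => g • x) η η := by
    intro g
    have h1 : MeasurePreserving (fun x : X => g • x) (O.c • μ) (O.c • μ) :=
      (measurePreserving_smul (g : G) μ).smul_measure O.c
    have h2 := h1.restrict_preimage m.measX
    have h3 : (fun x : X => g • x) ⁻¹' X₁ = X₁ := by ext x; exact hXi g x
    rwa [h3] at h2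
  have hηX : ∀ᵐ x ∂η, x ∈ X₁ := ae_restrict_mem m.measX
  set DG : Set (X × L) := {p | p.1 ∈ X₁ ∧ u (p.2 • v p.1) = p.1} with hDG
  have hlv : Measurable fun p : X × L => p.2 • v p.1 :=
    measurable_from_prod_countable_left fun l => m.v_meas.const_smul (l : H)
  have hDGm : MeasurableSet DG := measurableSet_setOfPred.2 <|
    (measurableSet_setOfPred.1 (measurable_fst m.measX)).and
      ((m.u_meas.comp hlv).eqProp measurable_fst)
  have hνDG : (η.prod Measure.count) DG = ν Y₁ := by
    rw [Measure.prod_apply_symm hDGm, lintegral_count, ← m.tsum_measure hfY]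
    refine tsum_congr fun l => ?_
    have hs : MeasurableSet ((fun x => (x, l)) ⁻¹' DG) := measurable_prodMk_right hDGm
    rw [Measure.restrict_apply hs, Measure.smul_apply, smul_eq_mul]
    congr 2
    ext x
    exact ⟨fun h => h.1, fun h => ⟨h, h.1⟩⟩
  have hνDH : (η.prod Measure.count) (Set.univ ×ˢ ({1} : Set L)) = O.c * μ X₁ := by
    rw [Measure.prod_prod, Measure.count_singleton, mul_one, Measure.restrict_apply_univ,
      Measure.smul_apply, smul_eq_mul]
  have hkey : ∀ (g : C) (l : L), ∀ x ∈ X₁, (l * (a g x)⁻¹) • v (g • x) = l • v x := by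
    intro g l x hx
    rw [← has g x hx, mul_smul, inv_smul_smul]
  have hC0 : O.c * μ X₁ ≠ 0 := mul_ne_zero O.c_ne_zero hpos
  let cpl : MECoupling C L :=
    { Ω := X × L
      ν := η.prod Measure.count
      sigmaFinite := inferInstance
      aG := fun g p => (g • p.1, p.2 * (a g p.1)⁻¹)
      aH := fun l p => (p.1, l * p.2)
      DG := DG
      DH := Set.univ ×ˢ {1}
      aG_one := fun p => by simp [hone]
      aG_mul := fun g g' p => by
        simp only [hmul, mul_smul, mul_inv_rev, mul_assoc]
      aH_one := fun p => by simp
      aH_mul := fun l l' p => by simp [mul_assoc]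
      comm := fun g l p => by simp [mul_assoc]
      mp_aG := fun g => by
        refine (hmpη g).skew_product (g := fun x l => l * (a g x)⁻¹) ?_ ?_
        · exact measurable_from_prod_countable_left fun l =>
            (Measurable.of_discrete (f := fun b : L => l * b⁻¹)).comp (ham g)
        · exact .of_forall fun x => map_count_of_bijective (Group.mulRight_bijective _)
      mp_aH := fun l => by
        refine (MeasurePreserving.id η).skew_product (g := fun _ b => l * b) ?_ ?_
        · exact (Measurable.of_discrete (f := fun b : L => l * b)).comp measurable_snd
        · exact .of_forall fun x => map_count_of_bijective (Group.mulLeft_bijective _)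
      free_aG := .of_forall fun p g h => Subtype.ext (hfX p.1 g (congrArg Prod.fst h))
      free_aH := .of_forall fun p l h => by simpa using congrArg Prod.snd h
      fund_DG := by
        refine ⟨hDGm, ?_, ?_⟩
        · have : ∀ᵐ p ∂(η.prod Measure.count : Measure (X × L)), p.1 ∈ X₁ :=
            Measure.quasiMeasurePreserving_fst.ae hηX
          filter_upwards [this] with p hp
          obtain ⟨g, hg, e⟩ := (SubRel.equivalence C).trans (m.u_v _ hp)
            (m.u_smul p.2 p.2.2 _ (m.v_mem _ hp))
          refine ⟨⟨g, hg⟩, m.smulX g hg _ hp, ?_⟩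
          change u ((p.2 * (a ⟨g, hg⟩ p.1)⁻¹) • v ((⟨g, hg⟩ : C) • p.1)) = g • p.1
          rw [hkey _ _ _ hp, e]
          rfl
        · intro g hg
          convert measure_empty (μ := (η.prod Measure.count : Measure (X × L)))
          rw [Set.eq_empty_iff_forall_notMem]
          rintro p ⟨⟨h1, h2⟩, -, h3⟩
          have h3' : u ((p.2 * (a g p.1)⁻¹) • v (g • p.1)) = g • p.1 := h3
          rw [hkey _ _ _ h1, h2] at h3'
          exact hg (Subtype.ext (hfX p.1 g h3'.symm))
      fund_DH := by
        refine ⟨MeasurableSet.univ.prod (measurableSet_singleton _), ?_, ?_⟩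
        · exact .of_forall fun p => ⟨p.2⁻¹, by simp⟩
        · intro l hl
          convert measure_empty (μ := (η.prod Measure.count : Measure (X × L)))
          rw [Set.eq_empty_iff_forall_notMem]
          rintro p ⟨⟨-, h1⟩, -, h2⟩
          rw [Set.mem_singleton_iff] at h1 h2
          simp only [h1, mul_one] at h2
          exact hl h2
      DG_pos := by rw [hνDG]; exact pos_iff_ne_zero.2 (m.measure_pos hpos)
      DG_fin := by rw [hνDG]; exact measure_lt_top _ _
      DH_pos := by rw [hνDH]; exact pos_iff_ne_zero.2 hC0
      DH_fin := by rw [hνDH]; exact ENNReal.mul_lt_top O.c_ne_top.lt_top (measure_lt_top _ _) }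
  refine ⟨cpl, ?_⟩
  change (η.prod Measure.count) (Set.univ ×ˢ ({1} : Set L)) / (η.prod Measure.count) DG = _
  rw [hνDG, hνDH]

end Match

/-! ### Composition of measure equivalence couplings -/

attribute [instance] MECoupling.mΩ MECoupling.sbΩ MECoupling.sigmaFinite

theorem MEwithIndex.symm {G H : Type} [Group G] [Group H] {κ : ENNReal} (h : MEwithIndex G H κ) :
    MEwithIndex H G κ⁻¹ := by
  obtain ⟨c, rfl⟩ := h
  refine ⟨⟨c.Ω, c.ν, c.sigmaFinite, c.aH, c.aG, c.DH, c.DG, c.aH_one, c.aH_mul, c.aG_one, c.aG_mul,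
    fun h g x => (c.comm g h x).symm, c.mp_aH, c.mp_aG, c.free_aH, c.free_aG, c.fund_DH, c.fund_DG,
    c.DH_pos, c.DH_fin, c.DG_pos, c.DG_fin⟩, ?_⟩
  exact (ENNReal.inv_div (.inl c.DG_fin.ne) (.inl c.DG_pos.ne')).symm

theorem IsFundamentalDomainFor.ae_existsUnique {G Ω : Type} [Group G] [Countable G]
    [MeasurableSpace Ω] {ν : Measure Ω} {a : G → Ω → Ω} {D : Set Ω}
    (hD : IsFundamentalDomainFor ν a D) (hmul : ∀ g g' x, a (g * g') x = a g (a g' x))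
    (hmp : ∀ g, MeasurePreserving (a g) ν ν) : ∀ᵐ x ∂ν, ∃! g, a g x ∈ D := by
  have h1 : ∀ᵐ x ∂ν, ∀ g h : G, g ≠ h → ¬ (a g x ∈ D ∧ a h x ∈ D) := by
    refine ae_all_iff.2 fun g => ae_all_iff.2 fun h => ?_
    by_cases hgh : g = h
    · exact .of_forall fun x hn => absurd hgh hn
    · have h0 := hD.2.2 (h * g⁻¹) fun e => hgh (by rw [mul_inv_eq_one] at e; exact e.symm)
      have h2 := (hmp g).quasiMeasurePreserving.preimage_null h0
      rw [← compl_mem_ae_iff] at h2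
      filter_upwards [h2] with x hx _ hx'
      refine hx ⟨hx'.1, ?_⟩
      change a (h * g⁻¹) (a g x) ∈ D
      rw [← hmul, inv_mul_cancel_right]
      exact hx'.2
  filter_upwards [h1, hD.2.1] with x hx hx'
  obtain ⟨g, hg⟩ := hx'
  refine ⟨g, hg, fun h hh => ?_⟩
  by_contra hne
  exact hx h g hne ⟨hh, hg⟩

theorem tsum_measure_inter_preimage {G Ω : Type} [Group G] [Countable G]
    [MeasurableSpace Ω] {ν : Measure Ω} {a : G → Ω → Ω} {D F : Set Ω} (hone : ∀ x, a 1 x = x)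
    (hmul : ∀ g g' x, a (g * g') x = a g (a g' x))
    (hmp : ∀ g, MeasurePreserving (a g) ν ν) (hD : MeasurableSet D) (hF : MeasurableSet F)
    (hu : ∀ᵐ x ∂ν, ∃! g, a g x ∈ D) : ∑' g, ν (D ∩ a g ⁻¹' F) = ν F := by
  have h1 : ∀ g, ν (D ∩ a g ⁻¹' F) = ν (F ∩ a g⁻¹ ⁻¹' D) := by
    intro g
    rw [← (hmp g⁻¹).measure_preimage (hD.inter ((hmp g).measurable hF)).nullMeasurableSet]
    congr 1
    ext x
    simp only [Set.mem_preimage, Set.mem_inter_iff]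
    rw [← hmul, mul_inv_cancel, hone, and_comm]
  simp only [h1]
  have h2 : ∑' g, ν (F ∩ a g⁻¹ ⁻¹' D) = ∑' g, ν (F ∩ a g ⁻¹' D) :=
    (Equiv.inv G).tsum_eq fun g => ν (F ∩ a g ⁻¹' D)
  rw [h2]
  rw [← measure_iUnion₀ ?_ fun g => (hF.inter ((hmp g).measurable hD)).nullMeasurableSet]
  · refine measure_congr ?_
    filter_upwards [hu] with x hx
    obtain ⟨g, hg, -⟩ := hx
    refine propext ⟨fun h => ?_, fun h => Set.mem_iUnion.2 ⟨g, h, hg⟩⟩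
    obtain ⟨g', h', -⟩ := Set.mem_iUnion.1 h
    exact h'
  · intro g h hne
    refine measure_mono_null ?_ (ae_iff.1 hu)
    rintro x ⟨⟨-, hx⟩, -, hx'⟩ hex
    exact hne (hex.unique hx hx')

section Composition

variable {H K Ω : Type} [Group H] [Group K] [Countable H] [Countable K] {aH : H → Ω → Ω}
  {aK : K → Ω → Ω} {D : Set Ω}

/-- The points all of whose translates have exactly one translate in `D`. -/
def GoodPt (aH : H → Ω → Ω) (aK : K → Ω → Ω) (D : Set Ω) (x : Ω) : Prop :=
  ∀ k, ∃! h, aH h (aK k x) ∈ D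

open Classical in
/-- The element of `H` bringing `k • x` back to `D`. -/
noncomputable def retCocycle (aH : H → Ω → Ω) (aK : K → Ω → Ω) (D : Set Ω) (k : K) (x : Ω) : H :=
  if x ∈ D ∧ GoodPt aH aK D x then sel fun h => aH h (aK k x) ∈ D else 1

open Classical in
/-- The action of `K` on `D`, identified with the quotient by `H`. -/
noncomputable def retAct (aH : H → Ω → Ω) (aK : K → Ω → Ω) (D : Set Ω) (k : K) (x : Ω) : Ω :=
  if x ∈ D ∧ GoodPt aH aK D x then aH (retCocycle aH aK D k x) (aK k x) else x

theorem retCocycle_spec {x : Ω} (hx : x ∈ D ∧ GoodPt aH aK D x) (k : K) :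
    aH (retCocycle aH aK D k x) (aK k x) ∈ D := by
  rw [retCocycle, if_pos hx]
  exact sel_spec (P := fun h => aH h (aK k x) ∈ D) (hx.2 k).exists

theorem retAct_eq {x : Ω} (hx : x ∈ D ∧ GoodPt aH aK D x) (k : K) :
    retAct aH aK D k x = aH (retCocycle aH aK D k x) (aK k x) := by rw [retAct, if_pos hx]

theorem retCocycle_unique {x : Ω} (hx : x ∈ D ∧ GoodPt aH aK D x) {k : K} {h : H}
    (hh : aH h (aK k x) ∈ D) : retCocycle aH aK D k x = h :=
  (hx.2 k).unique (retCocycle_spec hx k) hh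

theorem GoodPt.smul
    (mulH : ∀ g g' x, aH (g * g') x = aH g (aH g' x))
    (mulK : ∀ g g' x, aK (g * g') x = aK g (aK g' x))
    (comm : ∀ h k x, aH h (aK k x) = aK k (aH h x)) {x : Ω} (hx : GoodPt aH aK D x) (h : H) (k : K) :
    GoodPt aH aK D (aH h (aK k x)) := by
  intro l
  obtain ⟨h', h1, h2⟩ := hx (l * k)
  refine ⟨h' * h⁻¹, ?_, fun g hg => ?_⟩
  · change aH (h' * h⁻¹) (aK l (aH h (aK k x))) ∈ D
    rw [← comm h l, ← mulH, inv_mul_cancel_right, ← mulK]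
    exact h1
  · have : aH g (aK l (aH h (aK k x))) ∈ D := hg
    rw [← comm h l, ← mulH, ← mulK] at this
    rw [← h2 _ this, mul_inv_cancel_right]

theorem retAct_mem
    (mulH : ∀ g g' x, aH (g * g') x = aH g (aH g' x))
    (mulK : ∀ g g' x, aK (g * g') x = aK g (aK g' x))
    (comm : ∀ h k x, aH h (aK k x) = aK k (aH h x)) {x : Ω} (hx : x ∈ D ∧ GoodPt aH aK D x) (k : K) :
    retAct aH aK D k x ∈ D ∧ GoodPt aH aK D (retAct aH aK D k x) := by
  rw [retAct, if_pos hx]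
  exact ⟨retCocycle_spec hx k, hx.2.smul mulH mulK comm _ _⟩

theorem retCocycle_mul
    (mulH : ∀ g g' x, aH (g * g') x = aH g (aH g' x))
    (mulK : ∀ g g' x, aK (g * g') x = aK g (aK g' x))
    (comm : ∀ h k x, aH h (aK k x) = aK k (aH h x)) (k l : K) (x : Ω) : retCocycle aH aK D (k * l) x =
    retCocycle aH aK D k (retAct aH aK D l x) * retCocycle aH aK D l x := by
  by_cases hx : x ∈ D ∧ GoodPt aH aK D x
  · refine retCocycle_unique hx ?_
    have h1 := retCocycle_spec (retAct_mem mulH mulK comm hx l) k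
    have h2 : retAct aH aK D l x = aH (retCocycle aH aK D l x) (aK l x) := by rw [retAct, if_pos hx]
    rw [mulH, mulK, comm _ k, ← h2]
    exact h1
  · rw [retAct, if_neg hx, retCocycle, retCocycle, retCocycle, if_neg hx, if_neg hx, if_neg hx,
      one_mul]

theorem retAct_mul
    (mulH : ∀ g g' x, aH (g * g') x = aH g (aH g' x))
    (mulK : ∀ g g' x, aK (g * g') x = aK g (aK g' x))
    (comm : ∀ h k x, aH h (aK k x) = aK k (aH h x)) (k l : K) (x : Ω) :
    retAct aH aK D (k * l) x = retAct aH aK D k (retAct aH aK D l x) := by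
  by_cases hx : x ∈ D ∧ GoodPt aH aK D x
  · have h1 := retAct_mem mulH mulK comm hx l
    rw [retAct, if_pos hx, retCocycle_mul mulH mulK comm, retAct.eq_1 (k := k), if_pos h1]
    rw [mulH, mulK, comm _ k (aK l x)]
    congr 3
    rw [retAct, if_pos hx]
  · rw [retAct, retAct.eq_1 (k := l), if_neg hx, if_neg hx, retAct, if_neg hx]

theorem retCocycle_one (oneH : ∀ x, aH 1 x = x) (oneK : ∀ x, aK 1 x = x) (x : Ω) :
    retCocycle aH aK D 1 x = 1 := by
  by_cases hx : x ∈ D ∧ GoodPt aH aK D x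
  · refine retCocycle_unique hx ?_
    rw [oneH, oneK]
    exact hx.1
  · rw [retCocycle, if_neg hx]

theorem retAct_one (oneH : ∀ x, aH 1 x = x) (oneK : ∀ x, aK 1 x = x) (x : Ω) :
    retAct aH aK D 1 x = x := by
  by_cases hx : x ∈ D ∧ GoodPt aH aK D x
  · rw [retAct, if_pos hx, retCocycle_one oneH oneK, oneH, oneK]
  · rw [retAct, if_neg hx]

variable [MeasurableSpace Ω]

theorem measurable_goodPt (mH : ∀ h, Measurable (aH h)) (mK : ∀ k, Measurable (aK k))
    (hD : MeasurableSet D) : Measurable fun x => x ∈ D ∧ GoodPt aH aK D x := by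
  have hD' : Measurable fun x => x ∈ D := measurableSet_setOfPred.1 hD
  refine hD'.and (.forall fun k => ?_)
  have h1 : ∀ h, Measurable fun x => aH h (aK k x) ∈ D := fun h =>
    hD'.comp ((mH h).comp (mK k))
  exact .exists fun h => (h1 h).and (.forall fun h' => (h1 h').imp measurable_const)

theorem mFib_retCocycle (mH : ∀ h, Measurable (aH h)) (mK : ∀ k, Measurable (aK k))
    (hD : MeasurableSet D) (k : K) : MFib (retCocycle aH aK D k) := by
  classical
  intro h
  have hs : MFib fun x => sel fun h => aH h (aK k x) ∈ D :=
    .sel fun h => measurableSet_setOfPred.1 (((mH h).comp (mK k)) hD)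
  have hg := measurable_goodPt mH mK hD
  have : (fun x => retCocycle aH aK D k x = h) = fun x =>
      ((x ∈ D ∧ GoodPt aH aK D x) ∧ (sel fun h => aH h (aK k x) ∈ D) = h) ∨
      (¬ (x ∈ D ∧ GoodPt aH aK D x) ∧ 1 = h) := by
    funext x
    by_cases hx : x ∈ D ∧ GoodPt aH aK D x
    · rw [retCocycle, if_pos hx]
      exact propext ⟨fun e => .inl ⟨hx, e⟩, fun e => e.elim (·.2) fun e' => absurd hx e'.1⟩
    · rw [retCocycle, if_neg hx]
      exact propext ⟨fun e => .inr ⟨hx, e⟩, fun e => e.elim (fun e' => absurd e'.1 hx) (·.2)⟩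
  rw [this]
  exact (hg.and (hs h)).or (hg.not.and measurable_const)

theorem measurable_retAct (mH : ∀ h, Measurable (aH h)) (mK : ∀ k, Measurable (aK k))
    (hD : MeasurableSet D) (k : K) : Measurable (retAct aH aK D k) := by
  classical
  unfold retAct
  exact Measurable.ite (measurableSet_setOfPred.2 (measurable_goodPt mH mK hD))
    ((mFib_retCocycle mH mK hD k).apply (F := fun h x => aH h (aK k x))
      fun h => (mH h).comp (mK k)) measurable_id

/-- The induced action on the fundamental domain preserves the restricted measure. -/
theorem measurePreserving_retAct {ν : Measure Ω} (oneH : ∀ x, aH 1 x = x)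
    (mulH : ∀ g g' x, aH (g * g') x = aH g (aH g' x))
    (mulK : ∀ g g' x, aK (g * g') x = aK g (aK g' x))
    (comm : ∀ h k x, aH h (aK k x) = aK k (aH h x))
    (mH : ∀ h, MeasurePreserving (aH h) ν ν) (mK : ∀ k, MeasurePreserving (aK k) ν ν)
    (hD : MeasurableSet D)
    (hu : ∀ᵐ x ∂ν, ∃! h, aH h x ∈ {x | x ∈ D ∧ GoodPt aH aK D x}) (k : K) :
    MeasurePreserving (retAct aH aK D k) (ν.restrict {x | x ∈ D ∧ GoodPt aH aK D x})
      (ν.restrict {x | x ∈ D ∧ GoodPt aH aK D x}) := by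
  have mH' := fun h => (mH h).measurable
  have mK' := fun k => (mK k).measurable
  set D' : Set Ω := {x | x ∈ D ∧ GoodPt aH aK D x} with hD'
  have hD'm : MeasurableSet D' := measurableSet_setOfPred.2 (measurable_goodPt mH' mK' hD)
  have hm := measurable_retAct mH' mK' hD k
  refine ⟨hm, ?_⟩
  ext E hE
  rw [Measure.map_apply hm hE, Measure.restrict_apply (hm hE), Measure.restrict_apply hE]
  have hF : MeasurableSet (aK k ⁻¹' (E ∩ D')) := mK' k (hE.inter hD'm)
  rw [← (mK k).measure_preimage (hE.inter hD'm).nullMeasurableSet,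
    ← tsum_measure_inter_preimage oneH mulH mH hD'm hF hu,
    ← measure_iUnion ?_ fun h => hD'm.inter (mH' h hF)]
  · congr 1
    ext x
    simp only [Set.mem_iUnion, Set.mem_inter_iff, Set.mem_preimage]
    constructor
    · rintro ⟨h1, h2⟩
      have h3 := retAct_mem mulH mulK comm h2 k
      have h4 : retAct aH aK D k x = aH (retCocycle aH aK D k x) (aK k x) :=
        retAct_eq h2 k
      refine ⟨retCocycle aH aK D k x, h2, ?_⟩
      rw [← comm, ← h4]
      exact ⟨h1, h3⟩
    · rintro ⟨h, h2, h3, h4⟩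
      refine ⟨?_, h2⟩
      rw [← comm] at h3 h4
      rw [retAct_eq h2 k, retCocycle_unique h2 h4.1]
      exact h3
  · intro h h' hne
    refine Set.disjoint_left.2 fun x hx hx' => hne ?_
    have h1 := hx.2.2.1
    have h2 := hx'.2.2.1
    rw [← comm] at h1 h2
    exact (hx.1.2 k).unique h1 h2

end Composition

theorem MEwithIndex.trans {G H K : Type} [Group G] [Group H] [Group K] [Countable G] [Countable H]
    [Countable K] {a b : ENNReal} (h₁ : MEwithIndex G H a) (h₂ : MEwithIndex H K b) :
    MEwithIndex G K (a * b) := by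
  obtain ⟨c₁, rfl⟩ := h₁
  obtain ⟨c₂, rfl⟩ := h₂
  have comm := c₂.comm
  have mH' := fun h => (c₂.mp_aG h).measurable
  have mK' := fun k => (c₂.mp_aH k).measurable
  have hDm := c₂.fund_DG.1
  have uH₁ := c₁.fund_DH.ae_existsUnique c₁.aH_mul c₁.mp_aH
  have uG₁ := c₁.fund_DG.2.1
  have uH₂ := c₂.fund_DG.ae_existsUnique c₂.aG_mul c₂.mp_aG
  have uK₂ := c₂.fund_DH.ae_existsUnique c₂.aH_mul c₂.mp_aH
  have uK₂' : ∀ᵐ x ∂c₂.ν, ∀ h, ∃! k, c₂.aH k (c₂.aG h x) ∈ c₂.DH :=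
    ae_all_iff.2 fun h => (c₂.mp_aG h).quasiMeasurePreserving.ae uK₂
  have good : ∀ᵐ x ∂c₂.ν, GoodPt c₂.aG c₂.aH c₂.DG x :=
    ae_all_iff.2 fun k => (c₂.mp_aH k).quasiMeasurePreserving.ae uH₂
  set D' : Set c₂.Ω := {x | x ∈ c₂.DG ∧ GoodPt c₂.aG c₂.aH c₂.DG x} with hD'
  have hD'm : MeasurableSet D' := measurableSet_setOfPred.2 (measurable_goodPt mH' mK' hDm)
  have uD' : ∀ᵐ x ∂c₂.ν, ∃! h, c₂.aG h x ∈ D' := by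
    filter_upwards [uH₂, good] with x hx hg
    obtain ⟨h, h1, h2⟩ := hx
    have hg' : ∀ h, GoodPt c₂.aG c₂.aH c₂.DG (c₂.aG h x) := by
      intro h
      have := hg.smul c₂.aG_mul c₂.aH_mul comm h 1
      rwa [c₂.aH_one] at this
    exact ⟨h, ⟨h1, hg' h⟩, fun h' hh' => h2 h' hh'.1⟩
  have hνD' : c₂.ν D' = c₂.ν c₂.DG := by
    refine measure_congr ?_
    filter_upwards [good] with x hx
    exact propext ⟨fun h => h.1, fun h => ⟨h, hx⟩⟩
  set ρ := retAct c₂.aG c₂.aH c₂.DG with hρ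
  set κ := retCocycle c₂.aG c₂.aH c₂.DG with hκ
  have ρ_eq : ∀ x ∈ D', ∀ k, ρ k x = c₂.aG (κ k x) (c₂.aH k x) := fun x hx k => retAct_eq hx k
  have hρD : ∀ x ∈ D', ∀ k, ρ k x ∈ D' := fun x hx k =>
    retAct_mem c₂.aG_mul c₂.aH_mul comm hx k
  let m : Measure (c₂.Ω × c₁.Ω) := (c₂.ν.restrict D').prod c₁.ν
  have ae1 : ∀ {p : c₂.Ω → Prop}, (∀ᵐ x ∂c₂.ν, p x) → ∀ᵐ z ∂m, p z.1 := fun h =>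
    Measure.quasiMeasurePreserving_fst.ae (ae_restrict_of_ae h)
  have ae2 : ∀ {p : c₁.Ω → Prop}, (∀ᵐ x ∂c₁.ν, p x) → ∀ᵐ z ∂m, p z.2 := fun h =>
    Measure.quasiMeasurePreserving_snd.ae h
  have aeD : ∀ᵐ z ∂m, z.1 ∈ D' := Measure.quasiMeasurePreserving_fst.ae (ae_restrict_mem hD'm)
  let aG : G → c₂.Ω × c₁.Ω → c₂.Ω × c₁.Ω := fun g z => (z.1, c₁.aG g z.2)
  let aK : K → c₂.Ω × c₁.Ω → c₂.Ω × c₁.Ω := fun k z => (ρ k z.1, c₁.aH (κ k z.1) z.2)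
  let DG : Set (c₂.Ω × c₁.Ω) := Set.univ ×ˢ c₁.DG
  let E : H → Set (c₂.Ω × c₁.Ω) := fun h => (D' ∩ c₂.aG h ⁻¹' c₂.DH) ×ˢ (c₁.aH h ⁻¹' c₁.DH)
  let DK : Set (c₂.Ω × c₁.Ω) := ⋃ h, E h
  have hE1m : ∀ h, MeasurableSet (D' ∩ c₂.aG h ⁻¹' c₂.DH) := fun h =>
    hD'm.inter (mH' h c₂.fund_DH.1)
  have hE2m : ∀ h, MeasurableSet (c₁.aH h ⁻¹' c₁.DH) := fun h =>
    (c₁.mp_aH h).measurable c₁.fund_DH.1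
  have hEm : ∀ h, MeasurableSet (E h) := fun h => (hE1m h).prod (hE2m h)
  have mDG : m DG = c₂.ν c₂.DG * c₁.ν c₁.DG := by
    change ((c₂.ν.restrict D').prod c₁.ν) (Set.univ ×ˢ c₁.DG) = _
    rw [Measure.prod_prod, Measure.restrict_apply_univ, hνD']
  have mE : ∀ h, m (E h) = c₂.ν (D' ∩ c₂.aG h ⁻¹' c₂.DH) * c₁.ν c₁.DH := by
    intro h
    change ((c₂.ν.restrict D').prod c₁.ν) (_ ×ˢ _) = _
    rw [Measure.prod_prod, Measure.restrict_apply (hE1m h), Set.inter_eq_left.2 Set.inter_subset_left,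
      (c₁.mp_aH h).measure_preimage c₁.fund_DH.1.nullMeasurableSet]
  have mDK : m DK = c₂.ν c₂.DH * c₁.ν c₁.DH := by
    change m (⋃ h, E h) = _
    rw [measure_iUnion₀ ?_ fun h => (hEm h).nullMeasurableSet]
    · simp only [mE]
      rw [ENNReal.tsum_mul_right, tsum_measure_inter_preimage c₂.aG_one c₂.aG_mul c₂.mp_aG hD'm
        c₂.fund_DH.1 uD']
    · intro h h' hne
      refine measure_mono_null ?_ (ae_iff.1 (ae2 uH₁))
      rintro z ⟨⟨-, hz⟩, -, hz'⟩ hex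
      exact hne (hex.unique hz hz')
  have mpK : ∀ k, MeasurePreserving (aK k) m m := by
    intro k
    refine (measurePreserving_retAct c₂.aG_one c₂.aG_mul c₂.aH_mul comm c₂.mp_aG c₂.mp_aH hDm uD'
      k).skew_product (g := fun d ω => c₁.aH (κ k d) ω) ?_ ?_
    · exact ((mFib_retCocycle mH' mK' hDm k).comp measurable_fst).apply
        (F := fun h (z : c₂.Ω × c₁.Ω) => c₁.aH h z.2)
        fun h => (c₁.mp_aH h).measurable.comp measurable_snd
    · exact .of_forall fun d => (c₁.mp_aH _).map_eq
  have fundG : IsFundamentalDomainFor m aG DG := by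
    refine ⟨.prod .univ c₁.fund_DG.1, ?_, fun g hg => ?_⟩
    · filter_upwards [ae2 uG₁] with z hz
      obtain ⟨g, hg⟩ := hz
      exact ⟨g, trivial, hg⟩
    · have h0 := c₁.fund_DG.2.2 g hg
      have : DG ∩ aG g ⁻¹' DG = Set.univ ×ˢ (c₁.DG ∩ c₁.aG g ⁻¹' c₁.DG) := by
        ext z
        simp [DG, aG]
      rw [this]
      change ((c₂.ν.restrict D').prod c₁.ν) _ = _
      rw [Measure.prod_prod, h0, mul_zero]
  have fundK : IsFundamentalDomainFor m aK DK := by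
    refine ⟨.iUnion hEm, ?_, fun k hk => ?_⟩
    · filter_upwards [ae2 uH₁, ae1 uK₂', aeD] with z hz1 hz2 hz3
      obtain ⟨h, hh, -⟩ := hz1
      obtain ⟨k, hk', -⟩ := hz2 h
      refine ⟨k, Set.mem_iUnion.2 ⟨h * (κ k z.1)⁻¹, ⟨hρD _ hz3 k, ?_⟩, ?_⟩⟩
      · change c₂.aG (h * (κ k z.1)⁻¹) (ρ k z.1) ∈ c₂.DH
        rw [ρ_eq _ hz3, ← c₂.aG_mul, inv_mul_cancel_right, comm]
        exact hk'
      · change c₁.aH (h * (κ k z.1)⁻¹) (c₁.aH (κ k z.1) z.2) ∈ c₁.DH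
        rw [← c₁.aH_mul, inv_mul_cancel_right]
        exact hh
    · refine measure_mono_null (t := {z | ¬ ((∃! h, c₁.aH h z.2 ∈ c₁.DH) ∧
        ∀ h, ∃! k, c₂.aH k (c₂.aG h z.1) ∈ c₂.DH)}) ?_ (ae_iff.1 ((ae2 uH₁).and (ae1 uK₂')))
      rintro z ⟨hz, hz'⟩ ⟨hu1, hu2⟩
      obtain ⟨h, ⟨h1, h2⟩, h3⟩ := Set.mem_iUnion.1 hz
      obtain ⟨h', ⟨h1', h2'⟩, h3'⟩ := Set.mem_iUnion.1 hz'
      have e3 : c₁.aH h' (c₁.aH (κ k z.1) z.2) ∈ c₁.DH := h3'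
      have e2 : c₂.aG h' (ρ k z.1) ∈ c₂.DH := h2'
      rw [← c₁.aH_mul] at e3
      have e4 := hu1.unique e3 h3
      rw [ρ_eq _ h1, ← c₂.aG_mul, e4, comm] at e2
      refine hk ((hu2 h).unique e2 ?_)
      rw [c₂.aH_one]
      exact h2
  refine ⟨⟨c₂.Ω × c₁.Ω, m, inferInstance, aG, aK, DG, DK, fun z => Prod.ext rfl (c₁.aG_one _),
    fun g g' z => Prod.ext rfl (c₁.aG_mul _ _ _), fun z => Prod.ext (retAct_one c₂.aG_one c₂.aH_one _) ?_,
    fun k k' z => Prod.ext (retAct_mul c₂.aG_mul c₂.aH_mul comm _ _ _) ?_,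
    fun g k z => Prod.ext rfl (c₁.comm _ _ _),
    fun g => (MeasurePreserving.id _).prod (c₁.mp_aG g), mpK, ?_, ?_, fundG, fundK, ?_, ?_, ?_, ?_⟩, ?_⟩
  · change c₁.aH (κ 1 z.1) z.2 = z.2
    rw [hκ, retCocycle_one c₂.aG_one c₂.aH_one, c₁.aH_one]
  · change c₁.aH (κ (k * k') z.1) z.2 = c₁.aH (κ k (ρ k' z.1)) (c₁.aH (κ k' z.1) z.2)
    rw [hκ, hρ, retCocycle_mul c₂.aG_mul c₂.aH_mul comm, c₁.aH_mul]
  · filter_upwards [ae2 c₁.free_aG] with z hz g hg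
    exact hz g (congrArg Prod.snd hg)
  · filter_upwards [ae2 c₁.free_aH, ae1 c₂.free_aH, aeD] with z hz1 hz2 hz3 k hk
    have e1 : ρ k z.1 = z.1 := congrArg Prod.fst hk
    have e2 := hz1 _ (congrArg Prod.snd hk)
    rw [ρ_eq _ hz3, e2, c₂.aG_one] at e1
    exact hz2 k e1
  · rw [mDG]
    exact ENNReal.mul_pos c₂.DG_pos.ne' c₁.DG_pos.ne'
  · rw [mDG]
    exact ENNReal.mul_lt_top c₂.DG_fin c₁.DG_fin
  · rw [mDK]
    exact ENNReal.mul_pos c₂.DH_pos.ne' c₁.DH_pos.ne'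
  · rw [mDK]
    exact ENNReal.mul_lt_top c₂.DH_fin c₁.DH_fin
  · change m DK / m DG = _
    rw [mDK, mDG, MECoupling.index, MECoupling.index, mul_comm (c₁.ν c₁.DH / _),
      ENNReal.div_eq_inv_mul, ENNReal.div_eq_inv_mul, ENNReal.div_eq_inv_mul,
      ENNReal.mul_inv (.inl c₂.DG_pos.ne') (.inl c₂.DG_fin.ne)]
    ring

/-! ### Maximal partial matchings -/

/-- Greedy choice: a partial injection built out of a sequence of partial injections, which cannot
be extended by any of them. -/
theorem exists_maximal_injection {X Y : Type} [MeasurableSpace X] [MeasurableSpace Y]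
    [StandardBorelSpace X] [StandardBorelSpace Y] {E : ℕ → Set X} {θ : ℕ → X → Y}
    (hE : ∀ n, MeasurableSet (E n)) (hθ : ∀ n, Measurable (θ n)) (hinj : ∀ n, Set.InjOn (θ n) (E n)) :
    ∃ (A : Set X) (φ : X → Y), MeasurableSet A ∧ Measurable φ ∧ Set.InjOn φ A ∧
      (∀ x ∈ A, ∃ n, x ∈ E n ∧ φ x = θ n x) ∧ ∀ x ∉ A, ∀ n, x ∈ E n → θ n x ∈ φ '' A := by
  let step : ℕ → Set X × Set Y → Set X := fun n S => E n ∩ (S.1ᶜ ∩ θ n ⁻¹' S.2ᶜ)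
  let S : ℕ → Set X × Set Y := fun n =>
    Nat.rec (∅, ∅) (fun n S => (S.1 ∪ step n S, S.2 ∪ θ n '' step n S)) n
  let N : ℕ → Set X := fun n => step n (S n)
  have hS0 : S 0 = (∅, ∅) := rfl
  have hS1 : ∀ n, S (n + 1) = ((S n).1 ∪ N n, (S n).2 ∪ θ n '' N n) := fun n => rfl
  have hNE : ∀ n, N n ⊆ E n := fun n => Set.inter_subset_left
  have hSm : ∀ n, MeasurableSet (S n).1 ∧ MeasurableSet (S n).2 ∧ MeasurableSet (N n) := by
    have hN : ∀ n, MeasurableSet (S n).1 → MeasurableSet (S n).2 → MeasurableSet (N n) :=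
      fun n h1 h2 => (hE n).inter (h1.compl.inter (hθ n h2.compl))
    intro n
    induction n with
    | zero => exact ⟨.empty, .empty, hN 0 .empty .empty⟩
    | succ n ih =>
      have h1 : MeasurableSet (S (n + 1)).1 := ih.1.union ih.2.2
      have h2 : MeasurableSet (S (n + 1)).2 :=
        ih.2.1.union (ih.2.2.image_of_measurable_injOn (hθ n) ((hinj n).mono (hNE n)))
      exact ⟨h1, h2, hN _ h1 h2⟩
  have hS1' : ∀ n x, x ∈ (S n).1 ↔ ∃ k < n, x ∈ N k := by
    intro n
    induction n with
    | zero => simp [hS0]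
    | succ n ih =>
      intro x
      rw [hS1, Set.mem_union, ih]
      constructor
      · rintro (⟨k, hk, h⟩ | h)
        · exact ⟨k, by omega, h⟩
        · exact ⟨n, by omega, h⟩
      · rintro ⟨k, hk, h⟩
        rcases Nat.lt_succ_iff_lt_or_eq.1 hk with hk | rfl
        · exact .inl ⟨k, hk, h⟩
        · exact .inr h
  have hS2' : ∀ n y, y ∈ (S n).2 ↔ ∃ k < n, y ∈ θ k '' N k := by
    intro n
    induction n with
    | zero => simp [hS0]
    | succ n ih =>
      intro x
      rw [hS1, Set.mem_union, ih]
      constructor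
      · rintro (⟨k, hk, h⟩ | h)
        · exact ⟨k, by omega, h⟩
        · exact ⟨n, by omega, h⟩
      · rintro ⟨k, hk, h⟩
        rcases Nat.lt_succ_iff_lt_or_eq.1 hk with hk | rfl
        · exact .inl ⟨k, hk, h⟩
        · exact .inr h
  have hdisj : ∀ {x n k}, x ∈ N n → x ∈ N k → n = k := by
    have : ∀ {x n k}, x ∈ N n → x ∈ N k → ¬ n < k := fun h1 h2 hlt =>
      h2.2.1 ((hS1' _ _).2 ⟨_, hlt, h1⟩)
    intro x n k h1 h2
    exact le_antisymm (not_lt.1 (this h2 h1)) (not_lt.1 (this h1 h2))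
  let c : X → ℕ := fun x => sel fun n => x ∈ N n
  have hc : ∀ {x n}, x ∈ N n → c x = n := fun {x n} h =>
    hdisj (sel_spec (P := fun n => x ∈ N n) ⟨n, h⟩) h
  have hcm : MFib c := .sel fun n => measurableSet_setOfPred.1 (hSm n).2.2
  have hφ : ∀ {x n}, x ∈ N n → θ (c x) x = θ n x := fun h => by rw [hc h]
  have hdisj' : ∀ {x x' n k}, x ∈ N n → x' ∈ N k → θ n x = θ k x' → ¬ n < k := by
    intro x x' n k h1 h2 e hlt
    refine h2.2.2 ((hS2' _ _).2 ⟨_, hlt, x, h1, e⟩)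
  refine ⟨⋃ n, N n, fun x => θ (c x) x, .iUnion fun n => (hSm n).2.2, hcm.apply hθ, ?_, ?_, ?_⟩
  · intro x hx x' hx' e
    obtain ⟨n, hn⟩ := Set.mem_iUnion.1 hx
    obtain ⟨k, hk⟩ := Set.mem_iUnion.1 hx'
    simp only [hφ hn, hφ hk] at e
    obtain rfl : n = k := le_antisymm (not_lt.1 (hdisj' hk hn e.symm)) (not_lt.1 (hdisj' hn hk e))
    exact hinj n (hNE n hn) (hNE n hk) e
  · intro x hx
    obtain ⟨n, hn⟩ := Set.mem_iUnion.1 hx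
    exact ⟨n, hNE n hn, hφ hn⟩
  · intro x hx n hn
    have h1 : x ∉ (S n).1 := fun h => by
      obtain ⟨k, -, hk⟩ := (hS1' _ _).1 h
      exact hx (Set.mem_iUnion.2 ⟨k, hk⟩)
    by_cases h2 : θ n x ∈ (S n).2
    · obtain ⟨k, -, x', hx', e⟩ := (hS2' _ _).1 h2
      exact ⟨x', Set.mem_iUnion.2 ⟨k, hx'⟩, by simp only [hφ hx', e]⟩
    · have h3 : x ∈ N n := ⟨hn, h1, h2⟩
      exact absurd (Set.mem_iUnion.2 ⟨n, h3⟩) hx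

namespace Match

variable {G H X Y : Type} [Group G] [Group H] [Countable G] [Countable H]
  [MulAction G X] [MulAction H Y] [MeasurableSpace X] [MeasurableSpace Y]
  [StandardBorelSpace X] [StandardBorelSpace Y] [MeasurableConstSMul G X] [MeasurableConstSMul H Y]
  {μ : Measure X} {ν : Measure Y}
  {O : OrbitMap G H μ ν} {C : Subgroup G} {L : Subgroup H} {v : X → Y} {u : Y → X}
  {X₁ : Set X} {Y₁ : Set Y}

/-- If the conjugation of orbits preserves the measure of invariant sets, it is induced by a
partial injection defined almost everywhere. -/
theorem exists_injection [IsFiniteMeasure μ] (m : Match O C L v u X₁ Y₁) (hc : O.c = 1)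
    (hle : ∀ X₂ ⊆ X₁, MeasurableSet X₂ → (∀ g ∈ C, ∀ x ∈ X₂, g • x ∈ X₂) →
      μ X₂ ≤ ν (Y₁ ∩ u ⁻¹' X₂)) :
    ∃ (A : Set X) (φ : X → Y), MeasurableSet A ∧ A ⊆ X₁ ∧ μ (X₁ \ A) = 0 ∧ Measurable φ ∧
      Set.InjOn φ A ∧ ∀ x ∈ A, O.T x (φ x) ∧ SubRel Y L (v x) (φ x) := by
  obtain ⟨e, he⟩ := exists_surjective_nat (L × C)
  have EX := SubRel.equivalence (Y := X) C
  have EY := SubRel.equivalence (Y := Y) L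
  have hlv : ∀ l : L, Measurable fun x => l • v x := fun l => m.v_meas.const_smul (l : H)
  obtain ⟨A, φ, hA, hφ, hinj, hφ1, hφ2⟩ := exists_maximal_injection
    (E := fun n => X₁ ∩ {x | u ((e n).1 • v x) = (e n).2 • x}) (θ := fun n x => (e n).1 • v x)
    (fun n => m.measX.inter (measurableSet_setOfPred.2 ((m.u_meas.comp (hlv _)).eqProp
      (measurable_const_smul ((e n).2 : G))))) (fun n => hlv _) (by
      intro n x hx x' hx' h
      have h1 : u ((e n).1 • v x) = (e n).2 • x := hx.2
      have h2 : u ((e n).1 • v x') = (e n).2 • x' := hx'.2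
      have h3 : (e n).1 • v x = (e n).1 • v x' := h
      rw [h3, h2] at h1
      exact (smul_left_cancel _ h1).symm)
  have hAX : A ⊆ X₁ := fun x hx => by
    obtain ⟨n, hn, -⟩ := hφ1 x hx
    exact hn.1
  have hφL : ∀ x ∈ A, SubRel Y L (v x) (φ x) := by
    intro x hx
    obtain ⟨n, -, hn⟩ := hφ1 x hx
    exact ⟨(e n).1, (e n).1.2, hn.symm⟩
  have hφT : ∀ x ∈ A, O.T x (φ x) := by
    intro x hx
    obtain ⟨l, -, hl⟩ := hφL x hx
    rw [← hl]
    exact (m.T_v x (hAX hx)).smul_right l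
  refine ⟨A, φ, hA, hAX, ?_, hφ, hinj, fun x hx => ⟨hφT x hx, hφL x hx⟩⟩
  have hmax : ∀ x ∈ X₁ \ A, ∀ y, SubRel Y L (v x) y → y ∈ φ '' A := by
    rintro x ⟨hx, hxA⟩ y ⟨l, hl, rfl⟩
    obtain ⟨g, hg, h⟩ := EX.trans (m.u_v x hx) (m.u_smul l hl _ (m.v_mem x hx))
    obtain ⟨n, hn⟩ := he (⟨l, hl⟩, ⟨g, hg⟩)
    have := hφ2 x hxA n ⟨hx, by
      rw [Set.mem_ofPred_eq, hn]
      exact h.symm⟩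
    rwa [hn] at this
  set X₂ : Set X := {x | ∃ g : C, g • x ∈ X₁ \ A} with hX₂
  have hX₂m : MeasurableSet X₂ := measurableSet_setOfPred.2 (.exists fun g =>
    measurableSet_setOfPred.1 (measurable_const_smul (g : G) (m.measX.diff hA)))
  have hX₂i : ∀ g ∈ C, ∀ x ∈ X₂, g • x ∈ X₂ := by
    rintro g hg x ⟨k, hk⟩
    refine ⟨k * ⟨g, hg⟩⁻¹, ?_⟩
    have : (k * ⟨g, hg⟩⁻¹ : C) • g • x = k • x := by
      change ((k : G) * g⁻¹) • g • x = (k : G) • x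
      rw [smul_smul, inv_mul_cancel_right]
    rwa [this]
  have hX₂X : X₂ ⊆ X₁ := by
    rintro x ⟨g, hg⟩
    have := m.smulX (g⁻¹ : C) (g⁻¹ : C).2 _ hg.1
    rwa [show ((g⁻¹ : C) : G) • g • x = x from inv_smul_smul (g : G) x] at this
  have hX₂s : ∀ x x', SubRel X C x x' → x ∈ X₂ → x' ∈ X₂ := by
    rintro x _ ⟨g, hg, rfl⟩ h
    exact hX₂i g hg x h
  have hsub : Y₁ ∩ u ⁻¹' X₂ ⊆ φ '' (A ∩ X₂) := by
    rintro y ⟨hy, g, hg⟩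
    have h1 : SubRel Y L (v (g • u y)) y :=
      EY.symm (EY.trans (m.v_u y hy) (m.v_smul g g.2 _ (m.u_mem y hy)))
    obtain ⟨a, ha, rfl⟩ := hmax _ hg y h1
    refine ⟨a, ⟨ha, ?_⟩, rfl⟩
    obtain ⟨l, hl, e⟩ := hφL a ha
    have h2 : SubRel X C (u (v a)) (u (φ a)) := by
      rw [← e]
      exact m.u_smul l hl _ (m.v_mem a (hAX ha))
    exact hX₂s _ _ (EX.symm (EX.trans (m.u_v a (hAX ha)) h2)) ⟨g, hg⟩
  have hm : ν (φ '' (A ∩ X₂)) = μ (A ∩ X₂) := by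
    rw [O.measure_image _ φ (hA.inter hX₂m) hφ (hinj.mono Set.inter_subset_left)
      fun x hx => hφT x hx.1, hc, one_mul]
  have h1 : μ X₂ ≤ μ (X₂ ∩ A) := by
    rw [Set.inter_comm, ← hm]
    exact (hle X₂ hX₂X hX₂m hX₂i).trans (measure_mono hsub)
  have h2 : μ (X₂ \ A) = 0 := by
    have h3 := measure_inter_add_sdiff (μ := μ) X₂ hA
    have h4 : μ (X₂ ∩ A) + μ (X₂ \ A) ≤ μ (X₂ ∩ A) + 0 := by rw [h3, add_zero]; exact h1
    exact le_antisymm ((ENNReal.add_le_add_iff_left (measure_ne_top μ _)).1 h4) bot_le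
  refine measure_mono_null ?_ h2
  exact fun x hx => ⟨⟨1, by rwa [one_smul]⟩, hx.2⟩

/-- The conjugation of `C`-orbits with `L`-orbits is witnessed by any map along it. -/
theorem subRel_iff (m : Match O C L v u X₁ Y₁) {x x' : X} (hx : x ∈ X₁) (hx' : x' ∈ X₁) {y y' : Y}
    (hy : SubRel Y L (v x) y) (hy' : SubRel Y L (v x') y') : SubRel X C x x' ↔ SubRel Y L y y' := by
  have EX := SubRel.equivalence (Y := X) C
  have EY := SubRel.equivalence (Y := Y) L
  constructor
  · rintro ⟨g, hg, rfl⟩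
    exact EY.trans (EY.symm hy) (EY.trans (m.v_smul g hg x hx) hy')
  · intro h
    obtain ⟨l, hl, e⟩ := EY.trans hy (EY.trans h (EY.symm hy'))
    have h1 := m.u_smul l hl _ (m.v_mem x hx)
    rw [e] at h1
    exact EX.trans (m.u_v x hx) (EX.trans h1 (EX.symm (m.u_v x' hx')))

end Match

/-! ### Extending an almost everywhere defined isomorphism -/

theorem exists_uncountable_null {X : Type} [MeasurableSpace X] [StandardBorelSpace X]
    (hX : ¬ Countable X) (μ : Measure X) [IsFiniteMeasure μ] :
    ∃ N : Set X, MeasurableSet N ∧ μ N = 0 ∧ ¬ Countable N := by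
  have hR : ¬ Countable (ℝ × ℝ) := fun h => by
    have : Countable ℝ := (Prod.mk_right_injective (0 : ℝ)).countable
    exact Cardinal.not_countable_real (Set.countable_univ_iff.2 this)
  let e : X ≃ᵐ ℝ × ℝ := PolishSpace.measurableEquivOfNotCountable hX hR
  let F : ℝ → Set X := fun r => e ⁻¹' (Prod.fst ⁻¹' {r})
  have hF : ∀ r, MeasurableSet (F r) := fun r => e.measurable (measurable_fst (measurableSet_singleton r))
  have hd : Pairwise (Function.onFun Disjoint F) := by
    intro r s hrs
    refine Set.disjoint_left.2 fun x hx hx' => hrs ?_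
    have h1 : (e x).1 = r := hx
    have h2 : (e x).1 = s := hx'
    exact h1.symm.trans h2
  have hc := Measure.countable_meas_pos_of_disjoint_iUnion (μ := μ) hF hd
  have hex : ∃ r, μ (F r) = 0 := by
    by_contra hne
    push Not at hne
    refine Cardinal.not_countable_real (hc.mono fun r _ => ?_)
    exact pos_iff_ne_zero.2 (hne r)
  obtain ⟨r, hr⟩ := hex
  refine ⟨F r, hF r, hr, fun h => ?_⟩
  have hi : Function.Injective fun s : ℝ => (⟨e.symm (r, s), by simp [F]⟩ : F r) := by
    intro s s' h'
    have := e.symm.injective (congrArg Subtype.val h')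
    exact congrArg Prod.snd this
  exact Cardinal.not_countable_real (Set.countable_univ_iff.2 hi.countable)

/-- An isomorphism between conull sets agrees almost everywhere with an isomorphism of the whole
spaces. -/
theorem exists_measurableEquiv_extension {X Y : Type} [MeasurableSpace X] [MeasurableSpace Y]
    [StandardBorelSpace X] [StandardBorelSpace Y] (hX : ¬ Countable X) (hY : ¬ Countable Y)
    {μ : Measure X} {ν : Measure Y} [IsProbabilityMeasure μ] [IsProbabilityMeasure ν]
    {A : Set X} {φ : X → Y} (hA : MeasurableSet A) (hA0 : μ Aᶜ = 0) (hφ : Measurable φ)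
    (hinj : Set.InjOn φ A) (hm : ∀ E ⊆ A, MeasurableSet E → ν (φ '' E) = μ E) :
    ∃ (f : X ≃ᵐ Y) (A' : Set X), A' ⊆ A ∧ MeasurableSet A' ∧ μ A'ᶜ = 0 ∧ (∀ x ∈ A', f x = φ x) ∧
      ∀ E, MeasurableSet E → ν (f '' E) = μ E := by
  obtain ⟨N, hN, hN0, hNc⟩ := exists_uncountable_null hX μ
  obtain ⟨M, hM, hM0, hMc⟩ := exists_uncountable_null hY ν
  set A' : Set X := A \ (N ∪ φ ⁻¹' M) with hA'
  have hA'm : MeasurableSet A' := hA.diff (hN.union (hφ hM))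
  have hA'A : A' ⊆ A := Set.sdiff_subset
  have hA'0 : μ A'ᶜ = 0 := by
    have h1 : μ (A ∩ φ ⁻¹' M) = 0 := by
      rw [← hm _ Set.inter_subset_left (hA.inter (hφ hM))]
      refine measure_mono_null ?_ hM0
      rintro _ ⟨x, hx, rfl⟩
      exact hx.2
    refine measure_mono_null ?_ (measure_union_null hA0 (measure_union_null hN0 h1))
    intro x hx
    by_cases h2 : x ∈ A
    · by_cases h3 : x ∈ N
      · exact .inr (.inl h3)
      · refine .inr (.inr ⟨h2, ?_⟩)
        by_contra h4
        exact hx ⟨h2, fun h => h.elim h3 h4⟩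
    · exact .inl h2
  have : StandardBorelSpace A' := hA'm.standardBorel
  have hemb : MeasurableEmbedding fun x : A' => φ x :=
    (hφ.comp measurable_subtype_coe).measurableEmbedding fun x x' h =>
      Subtype.ext (hinj (hA'A x.2) (hA'A x'.2) h)
  set B : Set Y := Set.range fun x : A' => φ x with hB
  have hBe : B = φ '' A' := by
    ext y
    simp [hB]
  have hBm : MeasurableSet B := hemb.measurableSet_range
  have hNA : N ⊆ A'ᶜ := fun x hx h => h.2 (.inl hx)
  have hMB : M ⊆ Bᶜ := by
    rintro y hy ⟨x, rfl⟩
    exact x.2.2 (.inr hy)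
  have : StandardBorelSpace (A'ᶜ : Set X) := hA'm.compl.standardBorel
  have : StandardBorelSpace (Bᶜ : Set Y) := hBm.compl.standardBorel
  have hAc : ¬ Countable (A'ᶜ : Set X) := fun h =>
    hNc ((Set.inclusion_injective hNA).countable)
  have hBc : ¬ Countable (Bᶜ : Set Y) := fun h =>
    hMc ((Set.inclusion_injective hMB).countable)
  classical
  let f : X ≃ᵐ Y := ((MeasurableEquiv.sumCompl hA'm).symm.trans
    (hemb.equivRange.sumCongr (PolishSpace.measurableEquivOfNotCountable hAc hBc))).trans
    (MeasurableEquiv.sumCompl hBm)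
  have hf : ∀ x ∈ A', f x = φ x := by
    intro x hx
    have h1 : (MeasurableEquiv.sumCompl hA'm).symm x = .inl ⟨x, hx⟩ :=
      Equiv.Set.sumCompl_symm_apply_of_mem hx
    change MeasurableEquiv.sumCompl hBm (Sum.map _ _ ((MeasurableEquiv.sumCompl hA'm).symm x)) = _
    rw [h1]
    exact congrArg Subtype.val (hemb.equivRange_apply ⟨x, hx⟩)
  refine ⟨f, A', hA'A, hA'm, hA'0, hf, fun E hE => ?_⟩
  have hB0 : ν Bᶜ = 0 := by
    rw [prob_compl_eq_zero_iff hBm, hBe, hm _ hA'A hA'm, ← prob_compl_eq_zero_iff hA'm]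
    exact hA'0
  have h1 : f '' E ∩ B = φ '' (E ∩ A') := by
    rw [hBe]
    ext y
    constructor
    · rintro ⟨⟨x, hx, rfl⟩, x', hx', e⟩
      rw [← hf x' hx'] at e
      obtain rfl := f.injective e
      exact ⟨x', ⟨hx, hx'⟩, (hf _ hx').symm⟩
    · rintro ⟨x, ⟨hx, hx'⟩, rfl⟩
      exact ⟨⟨x, hx, hf x hx'⟩, x, hx', rfl⟩
  rw [← measure_inter_conull (t := B) hB0, h1, hm _ (Set.inter_subset_right.trans hA'A)
    (hE.inter hA'm), measure_inter_conull hA'0]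

theorem PMPAction.IsFree.not_countable {G X : Type} [Group G] [Infinite G] [MeasurableSpace X]
    [StandardBorelSpace X] {μ : Measure X} [IsProbabilityMeasure μ] {α : PMPAction G X μ}
    (h : α.IsFree) : ¬ Countable X := by
  intro hc
  have h0 : ∀ x, μ {x} = 0 := by
    intro x
    by_contra hx
    have hfree : ∀ g : G, α.act g x = x → g = 1 := by
      by_contra hn
      refine hx (measure_mono_null ?_ (ae_iff.1 h))
      rintro _ rfl
      exact hn
    have hinj : Function.Injective fun g => α.act g x := by
      intro g g' e
      have e' : α.act g x = α.act g' x := e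
      have : α.act (g'⁻¹ * g) x = x := by
        rw [α.act_mul, e', ← α.act_mul, inv_mul_cancel, α.act_one]
      exact (inv_mul_eq_one.1 (hfree _ this)).symm
    have hms : ∀ g, μ {α.act g x} = μ {x} := by
      intro g
      rw [← (α.measurePreserving g).measure_preimage (measurableSet_singleton _).nullMeasurableSet]
      congr 1
      ext z
      simp only [Set.mem_preimage, Set.mem_singleton_iff]
      refine ⟨fun e => ?_, fun e => by rw [e]⟩
      have := congrArg (α.act g⁻¹) e
      rwa [← α.act_mul, ← α.act_mul, inv_mul_cancel, α.act_one, α.act_one] at this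
    have hle := tsum_meas_le_meas_iUnion_of_disjoint μ (As := fun g => {α.act g x})
      (fun g => measurableSet_singleton _) (fun g g' hne => by
        simpa using fun e => hne (hinj e))
    simp only [hms, ENNReal.tsum_const_eq_top_of_ne_zero hx] at hle
    exact measure_ne_top μ _ (top_le_iff.1 hle)
  have h1 : μ Set.univ = 0 := by
    rw [← Set.biUnion_of_singleton (s := (Set.univ : Set X))]
    exact (measure_biUnion_null_iff (Set.to_countable _)).2 fun x _ => h0 x
  simp at h1

/-- The orbit relation of the subgroup is generated by the kernels of a freely independent
countable family of measurable maps preserving the orbits. -/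
def HasKernels {H : Type} [Group H] (Y : Type) [MulAction H Y] [MeasurableSpace Y]
    (L₀ : Subgroup H) : Prop :=
  ∃ e : ℕ × ℕ × Bool → Y → Y, (∀ k, Measurable (e k)) ∧ (FreeRel fun k y y' => e k y = e k y') ∧
    (∀ k y, SubRel Y L₀ y (e k y)) ∧
    ∀ y y', SubRel Y L₀ y y' → Relation.EqvGen (fun a b => ∃ k, e k a = e k b) y y'

/-- The conjugation of orbits exists for free actions with corresponding orbits. -/
theorem OrbitMap.exists_match {G H X Y P Q : Type} [Group G] [Group H] [Countable G] [Countable H]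
    [MulAction G X] [MulAction H Y] [MeasurableSpace X] [MeasurableSpace Y]
    [StandardBorelSpace X] [StandardBorelSpace Y] [MeasurableConstSMul G X]
    [MeasurableConstSMul H Y] {μ : Measure X} {ν : Measure Y} [IsProbabilityMeasure μ]
    [IsProbabilityMeasure ν] [SMulInvariantMeasure G X μ] [SMulInvariantMeasure H Y ν]
    [Nonempty P] [Countable P] [Nonempty Q] [Countable Q]
    (O : OrbitMap G H μ ν) (hfX : FreeAct G X) (hfY : FreeAct H Y)
    {Γ : P → Subgroup G} {Γ₀ : Subgroup G} {Λ : Q → Subgroup H} {Λ₀ : Subgroup H}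
    (hG : IsFreeProductOf G (fun i : Option P => i.elim Γ₀ Γ))
    (hH : IsFreeProductOf H (fun j : Option Q => j.elim Λ₀ Λ))
    (hΓinf : ∀ p, Infinite (Γ p)) (hΛinf : ∀ q, Infinite (Λ q))
    (hkX : HasKernels X Γ₀) (hkY : HasKernels Y Λ₀) {RΓ : P → CBER X} {RΛ : Q → CBER Y}
    (hdX : ∀ p, (RΓ p).dom = Set.univ) (hdY : ∀ q, (RΛ q).dom = Set.univ)
    (hRX : ∀ p x y, (RΓ p).rel x y ↔ SubRel X (Γ p) x y)
    (hRY : ∀ q x y, (RΛ q).rel x y ↔ SubRel Y (Λ q) x y)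
    (hFIΓ : ∀ p, FreelyIndecomposableMod μ (RΓ p)) (hFIΛ : ∀ q, FreelyIndecomposableMod ν (RΛ q))
    {p₀ : P} {q₀ : Q} (hME : MeasureEquivalent (Γ p₀) (Λ q₀))
    (hnMEΓ : ∀ p, p ≠ p₀ → ¬ MeasureEquivalent (Γ p₀) (Γ p))
    (hnMEΛ : ∀ q, q ≠ q₀ → ¬ MeasureEquivalent (Γ p₀) (Λ q)) :
    ∃ (v : X → Y) (u : Y → X) (X₁ : Set X) (Y₁ : Set Y),
      Match O (Γ p₀) (Λ q₀) v u X₁ Y₁ ∧ μ X₁ᶜ = 0 ∧ ν Y₁ᶜ = 0 := by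
  obtain ⟨e, hem, hef, heo, heg⟩ := hkX
  obtain ⟨e', hem', hef', heo', heg'⟩ := hkY
  choose Z qf v hZ hZ0 hZi hqf hv hvs using fun p =>
    exists_conjugator_of_freeProduct (C := Γ p) hfX hfY hH hem' hef' heo' heg' O.τ_meas O.σ_meas
      O.τ_smul O.σ_τ (hdX p) (hRX p) (hFIΓ p)
  choose Z' pf u hZ' hZ'0 hZi' hpf hu hus using fun q =>
    exists_conjugator_of_freeProduct (C := Λ q) hfY hfX hG hem hef heo heg O.σ_meas O.τ_meas
      O.σ_smul O.τ_σ (hdY q) (hRY q) (hFIΛ q)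
  have hvT : ∀ p, ∀ x ∈ Z p, O.T x (v p x) := fun p x hx => (hvs p x hx).1
  have huT : ∀ q, ∀ y ∈ Z' q, O.T (u q y) y := fun q y hy => O.T_iff.2 (hus q y hy).1
  have hm : ∀ p q, Match O (Γ p) (Λ q) (v p) (u q)
      (matchSet (Γ p) p q (Z p) (qf p) (v p) (Z' q) (pf q) (u q))
      (matchSet (Λ q) q p (Z' q) (pf q) (u q) (Z p) (qf p) (v p)) := fun p q =>
    match_matchSet (hZ p) (hqf p) (hv p) (hZ' q) (hpf q) (hu q) (hZi p) (hZi' q) (hvT p) (huT q)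
      (fun x hx => (hvs p x hx).2) (fun y hy => (hus q y hy).2)
  refine ⟨v p₀, u q₀, _, _, hm p₀ q₀, ?_, ?_⟩
  · have h1 := measure_compl_iUnion_matchSet hfX hG p₀ (L := Λ) (hZ p₀) (hZ0 p₀) (hqf p₀) (hv p₀) hZ'
      hZ'0 hpf hu (hZi p₀) hZi' (fun x hx => (hvs p₀ x hx).2) (fun q y hy => (hus q y hy).2)
      (fun N hN hN0 => O.measure_preimage_right (hZ p₀) (hv p₀) (hvT p₀) hN hN0)
      (fun q x hx hx' => (hvT p₀ x hx).left_rel (huT q _ hx'))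
    have h2 : ∀ q, q ≠ q₀ →
        μ (matchSet (Γ p₀) p₀ q (Z p₀) (qf p₀) (v p₀) (Z' q) (pf q) (u q)) = 0 := by
      intro q hq
      by_contra hne
      obtain ⟨c, -⟩ := (hm p₀ q).meWithIndex hfX hfY hne
      exact hnMEΛ q hq ⟨c⟩
    refine measure_mono_null ?_ (measure_union_null h1 (measure_iUnion_null fun q =>
      measure_iUnion_null (h2 q)))
    intro x hx
    by_cases hx' : x ∈ ⋃ q, matchSet (Γ p₀) p₀ q (Z p₀) (qf p₀) (v p₀) (Z' q) (pf q) (u q)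
    · obtain ⟨q, hq⟩ := Set.mem_iUnion.1 hx'
      refine .inr (Set.mem_iUnion.2 ⟨q, Set.mem_iUnion.2 ⟨?_, hq⟩⟩)
      rintro rfl
      exact hx hq
    · exact .inl hx'
  · have h1 := measure_compl_iUnion_matchSet hfY hH q₀ (L := Γ) (hZ' q₀) (hZ'0 q₀) (hpf q₀) (hu q₀) hZ
      hZ0 hqf hv (hZi' q₀) hZi (fun x hx => (hus q₀ x hx).2) (fun q y hy => (hvs q y hy).2)
      (fun N hN hN0 => O.measure_preimage_left (hu q₀) (huT q₀) hN hN0)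
      (fun p y hy hy' => (huT q₀ y hy).right_rel (hvT p _ hy'))
    have h2 : ∀ p, p ≠ p₀ →
        ν (matchSet (Λ q₀) q₀ p (Z' q₀) (pf q₀) (u q₀) (Z p) (qf p) (v p)) = 0 := by
      intro p hp
      by_contra hne
      have h3 : μ (matchSet (Γ p) p q₀ (Z p) (qf p) (v p) (Z' q₀) (pf q₀) (u q₀)) ≠ 0 := by
        intro h0
        refine hne (measure_mono_null ?_
          (O.measure_preimage_left (hu q₀) (hm p q₀).T_u (hm p q₀).measX h0))
        exact fun y hy => ⟨hy, (hm p q₀).u_mem y hy⟩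
      have h4 := (hm p q₀).meWithIndex hfX hfY h3
      obtain ⟨c⟩ := hME
      obtain ⟨c', -⟩ := (show MEwithIndex (Γ p₀) (Λ q₀) _ from ⟨c, rfl⟩).trans h4.symm
      exact hnMEΓ p hp ⟨c'⟩
    refine measure_mono_null ?_ (measure_union_null h1 (measure_iUnion_null fun p =>
      measure_iUnion_null (h2 p)))
    intro x hx
    by_cases hx' : x ∈ ⋃ p, matchSet (Λ q₀) q₀ p (Z' q₀) (pf q₀) (u q₀) (Z p) (qf p) (v p)
    · obtain ⟨q, hq⟩ := Set.mem_iUnion.1 hx'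
      refine .inr (Set.mem_iUnion.2 ⟨q, Set.mem_iUnion.2 ⟨?_, hq⟩⟩)
      rintro rfl
      exact hx hq
    · exact .inl hx'

/-- When all self-couplings have index one, the conjugation of orbits is induced by an isomorphism
between conull sets. -/
theorem Match.exists_isomorphism {G H X Y : Type} [Group G] [Group H] [Countable G] [Countable H]
    [MulAction G X] [MulAction H Y] [MeasurableSpace X] [MeasurableSpace Y]
    [StandardBorelSpace X] [StandardBorelSpace Y] [MeasurableConstSMul G X]
    [MeasurableConstSMul H Y] {μ : Measure X} {ν : Measure Y} [IsProbabilityMeasure μ]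
    [IsProbabilityMeasure ν] [SMulInvariantMeasure G X μ] {O : OrbitMap G H μ ν}
    {C : Subgroup G} {L : Subgroup H} {v : X → Y} {u : Y → X} {X₁ : Set X} {Y₁ : Set Y}
    (m : Match O C L v u X₁ Y₁) (hX₁ : μ X₁ᶜ = 0) (hY₁ : ν Y₁ᶜ = 0)
    (hfX : FreeAct G X) (hfY : FreeAct H Y) (hME : MEwithIndex C L 1)
    (hIME : ∀ κ : ENNReal, MEwithIndex C C κ → κ = 1) :
    ∃ (A : Set X) (φ : X → Y), MeasurableSet A ∧ μ Aᶜ = 0 ∧ Measurable φ ∧ Set.InjOn φ A ∧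
      (∀ E ⊆ A, MeasurableSet E → ν (φ '' E) = μ E) ∧ ∀ x ∈ A, ∀ x' ∈ A,
        (SubRel X (⊤ : Subgroup G) x x' ↔ SubRel Y (⊤ : Subgroup H) (φ x) (φ x')) ∧
        (SubRel X C x x' ↔ SubRel Y L (φ x) (φ x')) := by
  have hone : ∀ κ, MEwithIndex C L κ → κ = 1 := by
    intro κ h
    have := hIME _ (h.trans hME.symm)
    rwa [inv_one, mul_one] at this
  have h1 : μ X₁ = 1 := (prob_compl_eq_zero_iff m.measX).1 hX₁
  have h2 : ν Y₁ = 1 := (prob_compl_eq_zero_iff m.measY).1 hY₁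
  have hc : O.c = 1 := by
    have := hone _ (m.meWithIndex hfX hfY (by rw [h1]; exact one_ne_zero))
    rwa [h1, h2, mul_one, div_one] at this
  obtain ⟨A, φ, hA, hAX, hA0, hφ, hinj, hφA⟩ := m.exists_injection hc (by
    intro X₂ hsub hX₂ hinv
    by_cases h0 : μ X₂ = 0
    · rw [h0]; exact bot_le
    have m' := m.restrict hX₂ hsub hinv
    have h3 := hone _ (m'.meWithIndex hfX hfY h0)
    rw [hc, one_mul, ENNReal.div_eq_one_iff (m'.measure_pos h0) (measure_ne_top _ _)] at h3
    exact h3.le)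
  refine ⟨A, φ, hA, ?_, hφ, hinj, ?_, ?_⟩
  · refine measure_mono_null (t := X₁ᶜ ∪ X₁ \ A) ?_ (measure_union_null hX₁ hA0)
    intro x hx
    by_cases h : x ∈ X₁
    · exact .inr ⟨h, hx⟩
    · exact .inl h
  · intro E hE hEm
    rw [O.measure_image E φ hEm hφ (hinj.mono hE) fun x hx => (hφA x (hE hx)).1, hc, one_mul]
  · intro x hx x' hx'
    refine ⟨?_, m.subRel_iff (hAX hx) (hAX hx') (hφA x hx).2 (hφA x' hx').2⟩
    have t := (hφA x hx).1
    have t' := (hφA x' hx').1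
    constructor
    · rintro ⟨g, -, rfl⟩
      obtain ⟨h, e⟩ := (t.smul_left g).right_rel t'
      exact ⟨h, trivial, e.symm⟩
    · rintro ⟨h, -, e⟩
      have t2 := t.smul_right h
      rw [e] at t2
      obtain ⟨g, e'⟩ := t2.left_rel t'
      exact ⟨g, trivial, e'.symm⟩

section Sections

variable {G H X Y : Type} [Group G] [Group H] [Countable G] [Countable H]
  [MeasurableSpace X] [MeasurableSpace Y] [StandardBorelSpace X] [StandardBorelSpace Y]
  [MulAction G X] [MulAction H Y] [MeasurableConstSMul G X] [MeasurableConstSMul H Y]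
  {μ : Measure X} {ν : Measure Y} [SMulInvariantMeasure G X μ] [SMulInvariantMeasure H Y ν]

/-- A map scaling the measure on a complete section scales the measure of all partial injections
obtained from it by moving points in their orbits. -/
theorem measure_image_of_section {A : Set X} {θ : X → Y} {c : ENNReal} (hθ : Measurable θ)
    (hm : ∀ E ⊆ A, MeasurableSet E → ν (θ '' E) = c * μ E) {γ : X → G} (hγ : MFib γ)
    (hγA : ∀ x, γ x • x ∈ A) {E : Set X} {φ : X → Y} (hE : MeasurableSet E) (hφ : Measurable φ)
    (hinj : Set.InjOn φ E) (hφo : ∀ x ∈ E, ∃ h : H, h • θ (γ x • x) = φ x) :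
    ν (φ '' E) = c * μ E := by
  set η : X → H := fun x => sel fun h : H => h • θ (γ x • x) = φ x with hη
  have hτ : Measurable fun x => θ (γ x • x) :=
    hγ.apply (F := fun g x => θ (g • x)) fun g => hθ.comp (measurable_const_smul g)
  have hηm : MFib η := MFib.sel fun h => (hτ.const_smul h).eqProp hφ
  have hηs : ∀ x ∈ E, η x • θ (γ x • x) = φ x := fun x hx =>
    sel_spec (P := fun h : H => h • θ (γ x • x) = φ x) (hφo x hx)
  set F : G × H → Set X := fun i => E ∩ {x | γ x = i.1 ∧ η x = i.2} with hF
  have hFm : ∀ i, MeasurableSet (F i) := fun i =>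
    hE.inter (measurableSet_setOfPred.2 ((hγ i.1).and (hηm i.2)))
  have hFd : Pairwise (Function.onFun Disjoint F) := by
    intro i j hij
    refine Set.disjoint_left.2 fun x hx hx' => hij ?_
    exact Prod.ext (hx.2.1.symm.trans hx'.2.1) (hx.2.2.symm.trans hx'.2.2)
  have hEU : E = ⋃ i, F i := by
    ext x
    rw [Set.mem_iUnion]
    exact ⟨fun h => ⟨(γ x, η x), h, rfl, rfl⟩, fun ⟨_, h⟩ => h.1⟩
  have hFi : ∀ i, ν (φ '' F i) = c * μ (F i) := by
    intro i
    have h1 : φ '' F i = (fun y => i.2 • y) '' (θ '' ((fun x => i.1 • x) '' F i)) := by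
      rw [Set.image_image, Set.image_image]
      refine Set.image_congr fun x hx => ?_
      rw [← hηs x hx.1, hx.2.1, hx.2.2]
    have h2 : (fun x => i.1 • x) '' F i ⊆ A := by
      rintro _ ⟨x, hx, rfl⟩
      have := hγA x
      rwa [hx.2.1] at this
    have h3 : MeasurableSet ((fun x => i.1 • x) '' F i) :=
      (hFm i).const_smul i.1
    have h4 : μ ((fun x => i.1 • x) '' F i) = μ (F i) := measure_smul μ i.1 (F i)
    have h5 : ∀ S : Set Y, ν ((fun y => i.2 • y) '' S) = ν S := fun S => measure_smul ν i.2 S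
    rw [h1, h5, hm _ h2 h3, h4]
  calc ν (φ '' E) = ν (⋃ i, φ '' F i) := by rw [← Set.image_iUnion, ← hEU]
    _ = ∑' i, ν (φ '' F i) := by
      refine measure_iUnion ?_ fun i =>
        (hFm i).image_of_measurable_injOn hφ (hinj.mono Set.inter_subset_left)
      intro i j hij
      refine Set.disjoint_left.2 ?_
      rintro _ ⟨x, hx, rfl⟩ ⟨x', hx', e⟩
      obtain rfl := hinj hx'.1 hx.1 e
      exact Set.disjoint_left.1 (hFd hij) hx hx'
    _ = ∑' i, c * μ (F i) := tsum_congr hFi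
    _ = c * μ E := by rw [ENNReal.tsum_mul_left, ← measure_iUnion hFd hFm, ← hEU]

/-- An isomorphism between complete sections preserving the orbits extends to a map of orbits. -/
theorem exists_orbitMap_of_section {A : Set X} {B : Set Y} {θ : X → Y} {θ' : Y → X} {c : ENNReal}
    (hA : MeasurableSet A) (hB : MeasurableSet B) (hθ : Measurable θ) (hθ' : Measurable θ')
    (hAB : Set.MapsTo θ A B) (hBA : Set.MapsTo θ' B A) (hl : ∀ x ∈ A, θ' (θ x) = x)
    (hr : ∀ y ∈ B, θ (θ' y) = y) (hGA : ∀ x, ∃ g : G, g • x ∈ A) (hHB : ∀ y, ∃ h : H, h • y ∈ B)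
    (hrel : ∀ x ∈ A, ∀ x' ∈ A, (∃ g : G, g • x = x') ↔ ∃ h : H, h • θ x = θ x')
    (hc0 : c ≠ 0) (hct : c ≠ ⊤)
    (hm : ∀ E ⊆ A, MeasurableSet E → ν (θ '' E) = c * μ E) :
    Nonempty (OrbitMap G H μ ν) := by
  set γ : X → G := fun x => sel fun g : G => g • x ∈ A with hγd
  set η : Y → H := fun y => sel fun h : H => h • y ∈ B with hηd
  have hγ : MFib γ := MFib.sel fun g => measurableSet_setOfPred.1 (measurable_const_smul g hA)
  have hη : MFib η := MFib.sel fun h => measurableSet_setOfPred.1 (measurable_const_smul h hB)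
  have hγA : ∀ x, γ x • x ∈ A := fun x => sel_spec (P := fun g : G => g • x ∈ A) (hGA x)
  have hηB : ∀ y, η y • y ∈ B := fun y => sel_spec (P := fun h : H => h • y ∈ B) (hHB y)
  have hrel' : ∀ y ∈ B, ∀ y' ∈ B, (∃ h : H, h • y = y') → ∃ g : G, g • θ' y = θ' y' := by
    intro y hy y' hy' h
    rw [hrel _ (hBA hy) _ (hBA hy'), hr y hy, hr y' hy']
    exact h
  refine ⟨{
    τ := fun x => θ (γ x • x)
    σ := fun y => θ' (η y • y)
    c := c
    τ_meas := hγ.apply (F := fun g x => θ (g • x)) fun g => hθ.comp (measurable_const_smul g)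
    σ_meas := hη.apply (F := fun g x => θ' (g • x)) fun g => hθ'.comp (measurable_const_smul g)
    τ_smul := ?_
    σ_smul := ?_
    σ_τ := ?_
    τ_σ := ?_
    c_ne_zero := hc0
    c_ne_top := hct
    measure_image := fun E φ hE hφ hinj h => measure_image_of_section hθ hm hγ hγA hE hφ hinj h }⟩
  · intro g x
    refine (hrel _ (hγA x) _ (hγA (g • x))).1 ⟨γ (g • x) * g * (γ x)⁻¹, ?_⟩
    simp only [mul_smul, inv_smul_smul]
  · intro h y
    refine hrel' _ (hηB y) _ (hηB (h • y)) ⟨η (h • y) * h * (η y)⁻¹, ?_⟩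
    simp only [mul_smul, inv_smul_smul]
  · intro x
    obtain ⟨g, hg⟩ := hrel' _ (hAB (hγA x)) _ (hηB _) ⟨_, rfl⟩
    refine ⟨(γ x)⁻¹ * g⁻¹, ?_⟩
    rw [mul_smul, ← hg, inv_smul_smul, hl _ (hγA x), inv_smul_smul]
  · intro y
    obtain ⟨h, hh⟩ := (hrel _ (hBA (hηB y)) _ (hγA _)).1 ⟨_, rfl⟩
    refine ⟨(η y)⁻¹ * h⁻¹, ?_⟩
    rw [mul_smul, ← hh, inv_smul_smul, hr _ (hηB y), inv_smul_smul]

end Sections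

/-! ### Restriction to an invariant set -/

section Invariant

variable {X : Type} [MeasurableSpace X] {s : Set X}

/-- The restriction of a relation defined everywhere, as a relation on the subtype. -/
def CBER.onSubtype (R : CBER X) (hd : R.dom = Set.univ) (s : Set X) : CBER s where
  dom := Set.univ
  dom_meas := .univ
  rel x y := R.rel x y
  rel_meas := ((measurable_subtype_coe.comp measurable_fst).prodMk
    (measurable_subtype_coe.comp measurable_snd)) R.rel_meas
  rel_dom _ := ⟨trivial, trivial⟩
  refl x _ := R.refl x (hd ▸ trivial)
  symm h := R.symm h
  trans h h' := R.trans h h'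
  countable_classes x := (R.countable_classes x).preimage Subtype.val_injective

/-- The extension of a relation on an invariant set by the ambient relation, or by nothing, outside
of it. -/
def CBER.extend {R : CBER X} (hs : MeasurableSet s) (hinv : ∀ x y, R.rel x y → x ∈ s → y ∈ s)
    (hd : R.dom = Set.univ) (S : CBER s) (q : Prop) : CBER X where
  dom := Subtype.val '' S.dom ∪ {x | x ∉ s ∧ q}
  dom_meas := ((MeasurableEmbedding.subtype_coe hs).measurableSet_image.2 S.dom_meas).union
    (measurableSet_setOfPred.2 ((measurableSet_setOfPred.1 hs).not.and measurable_const))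
  rel x y := (∃ (hx : x ∈ s) (hy : y ∈ s), S.rel ⟨x, hx⟩ ⟨y, hy⟩) ∨ ((x ∉ s ∧ q) ∧ R.rel x y)
  rel_meas := by
    have h1 : MeasurableEmbedding (Prod.map Subtype.val Subtype.val : s × s → X × X) :=
      (MeasurableEmbedding.subtype_coe hs).prodMap (MeasurableEmbedding.subtype_coe hs)
    have h2 : MeasurableSet {p : X × X | (p.1 ∉ s ∧ q) ∧ R.rel p.1 p.2} :=
      measurableSet_setOfPred.2 (((measurableSet_setOfPred.1 (measurable_fst hs)).not.and
        measurable_const).and (measurableSet_setOfPred.1 R.rel_meas))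
    convert (h1.measurableSet_image.2 S.rel_meas).union h2 using 1
    ext ⟨x, y⟩
    refine or_congr ⟨?_, ?_⟩ Iff.rfl
    · rintro ⟨hx, hy, h⟩
      exact ⟨(⟨x, hx⟩, ⟨y, hy⟩), h, rfl⟩
    · rintro ⟨⟨a, b⟩, h, e⟩
      obtain ⟨rfl, rfl⟩ := Prod.mk.inj e
      exact ⟨a.2, b.2, h⟩
  rel_dom := by
    rintro x y (⟨hx, hy, h⟩ | ⟨h, hr⟩)
    · exact ⟨.inl ⟨_, (S.rel_dom h).1, rfl⟩, .inl ⟨_, (S.rel_dom h).2, rfl⟩⟩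
    · exact ⟨.inr h, .inr ⟨fun hy => h.1 (hinv _ _ (R.symm hr) hy), h.2⟩⟩
  refl := by
    rintro _ (⟨x, hx, rfl⟩ | h)
    · exact .inl ⟨x.2, x.2, S.refl x hx⟩
    · exact .inr ⟨h, R.refl _ (hd ▸ trivial)⟩
  symm := by
    rintro x y (⟨hx, hy, h⟩ | ⟨h, hr⟩)
    · exact .inl ⟨hy, hx, S.symm h⟩
    · exact .inr ⟨⟨fun hy => h.1 (hinv _ _ (R.symm hr) hy), h.2⟩, R.symm hr⟩
  trans := by
    rintro x y z (⟨hx, hy, h⟩ | ⟨h, hr⟩) (⟨hy', hz, h'⟩ | ⟨h', hr'⟩)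
    · exact .inl ⟨hx, hz, S.trans h h'⟩
    · exact absurd hy h'.1
    · exact absurd (hinv _ _ (R.symm hr) hy') h.1
    · exact .inr ⟨h, R.trans hr hr'⟩
  countable_classes x := by
    by_cases hx : x ∈ s
    · refine ((S.countable_classes ⟨x, hx⟩).image Subtype.val).mono ?_
      rintro y (⟨_, hy, h⟩ | ⟨h, _⟩)
      · exact ⟨⟨y, hy⟩, h, rfl⟩
      · exact absurd hx h.1
    · refine (R.countable_classes x).mono ?_
      rintro y (⟨hx', _⟩ | ⟨_, h⟩)
      · exact absurd hx' hx
      · exact h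

/-- Free indecomposability passes to conull invariant sets. -/
theorem FreelyIndecomposableMod.onSubtype {μ : Measure X} {R : CBER X}
    (h : FreelyIndecomposableMod μ R) (hs : MeasurableSet s)
    (hinv : ∀ x y, R.rel x y → x ∈ s → y ∈ s) (hd : R.dom = Set.univ) :
    FreelyIndecomposableMod (μ.comap (Subtype.val : s → X)) (R.onSubtype hd s) := by
  intro ι hι Rf hfree
  rcases isEmpty_or_nonempty s with he | ⟨⟨z⟩⟩
  · exact ⟨fun _ => ∅, Set.univ, fun _ => .empty, fun _ => Set.empty_subset _,
      fun _ _ _ => Set.disjoint_empty _, .univ, by simp, fun x => he.elim x,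
      fun _ _ x => he.elim x, fun _ x => he.elim x⟩
  obtain ⟨hind, hdom, hrel⟩ := hfree
  obtain ⟨i₀, -⟩ := Set.mem_iUnion.1 (hdom ▸ (trivial : z ∈ Set.univ) : z ∈ ⋃ i, (Rf i).dom)
  set Rf' : ι → CBER X := fun i => CBER.extend hs hinv hd (Rf i) (i = i₀) with hRf'
  have hstep : ∀ i x y (hx : x ∈ s), (Rf' i).rel x y →
      ∃ hy : y ∈ s, (Rf i).rel ⟨x, hx⟩ ⟨y, hy⟩ := by
    rintro i x y hx (⟨_, hy, h⟩ | ⟨h, _⟩)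
    · exact ⟨hy, h⟩
    · exact absurd hx h.1
  have hR : ∀ i x y, (Rf' i).rel x y → R.rel x y := by
    rintro i x y (⟨hx, hy, h⟩ | ⟨_, h⟩)
    · exact (hrel ⟨x, hx⟩ ⟨y, hy⟩).2 ⟨trivial, .rel _ _ ⟨i, h⟩⟩
    · exact h
  have hprod : IsFreeProduct R Rf' := by
    refine ⟨?_, ?_, ?_⟩
    · intro n x i hn hx0 hne hst
      by_cases h0 : x 0 ∈ s
      · have hmem : ∀ j, j ≤ n → x j ∈ s := by
          intro j
          induction j with
          | zero => exact fun _ => h0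
          | succ j ih => exact fun hj => (hstep _ _ _ (ih (by omega)) (hst j (by omega))).1
        classical
        set x' : ℕ → s := fun j => if hj : j ≤ n then ⟨x j, hmem j hj⟩ else ⟨x 0, h0⟩ with hx'
        have hx'v : ∀ j (hj : j ≤ n), x' j = ⟨x j, hmem j hj⟩ := fun j hj => dif_pos hj
        refine hind n x' i hn ?_ ?_ ?_
        · rw [hx'v n le_rfl, hx'v 0 (Nat.zero_le _)]
          exact Subtype.ext hx0
        · intro j hj e
          rw [hx'v j hj.le, hx'v (j + 1) hj] at e
          exact hne j hj (congrArg Subtype.val e)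
        · intro j hj
          rw [hx'v j hj.le, hx'v (j + 1) hj]
          exact (hstep _ _ _ (hmem j hj.le) (hst j hj)).2
      · have hmem : ∀ j, j ≤ n → x j ∉ s := by
          intro j
          induction j with
          | zero => exact fun _ => h0
          | succ j ih =>
            exact fun hj hs' => ih (by omega)
              (hinv _ _ (R.symm (hR _ _ _ (hst j (by omega)))) hs')
        have hi : ∀ j, j < n → i j = i₀ := by
          intro j hj
          rcases hst j hj with ⟨hx, _⟩ | ⟨h, _⟩
          · exact absurd hx (hmem j hj.le)
          · exact h.2
        exact ⟨0, by omega, by rw [hi 0 (by omega), hi (0 + 1) (by omega)]⟩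
    · rw [hd]
      refine (Set.eq_univ_of_forall fun x => ?_).symm
      by_cases hx : x ∈ s
      · obtain ⟨i, hi⟩ := Set.mem_iUnion.1
          (hdom ▸ (trivial : (⟨x, hx⟩ : s) ∈ Set.univ) : (⟨x, hx⟩ : s) ∈ ⋃ i, (Rf i).dom)
        exact Set.mem_iUnion.2 ⟨i, .inl ⟨_, hi, rfl⟩⟩
      · exact Set.mem_iUnion.2 ⟨i₀, .inr ⟨hx, rfl⟩⟩
    · intro x y
      constructor
      · intro hxy
        refine ⟨hd ▸ trivial, ?_⟩
        by_cases hx : x ∈ s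
        · have h1 := ((hrel ⟨x, hx⟩ ⟨y, hinv _ _ hxy hx⟩).1 hxy).2
          have h2 : ∀ a b : s, Relation.EqvGen (fun a b => ∃ i, (Rf i).rel a b) a b →
              Relation.EqvGen (fun a b => ∃ i, (Rf' i).rel a b) (a : X) (b : X) := by
            intro a b hab
            induction hab with
            | rel a b h =>
              obtain ⟨i, hi⟩ := h
              exact .rel _ _ ⟨i, .inl ⟨a.2, b.2, hi⟩⟩
            | refl => exact .refl _
            | symm _ _ _ ih => exact ih.symm
            | trans _ _ _ _ _ ih ih' => exact ih.trans _ _ _ ih'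
          exact h2 _ _ h1
        · exact .rel _ _ ⟨i₀, .inr ⟨⟨hx, rfl⟩, hxy⟩⟩
      · rintro ⟨-, h⟩
        induction h with
        | rel a b h => exact hR _ _ _ h.choose_spec
        | refl => exact R.refl _ (hd ▸ trivial)
        | symm _ _ _ ih => exact R.symm ih
        | trans _ _ _ _ _ ih ih' => exact R.trans ih ih'
  obtain ⟨U, C, hU, -, hUd, hC, hC0, hsec, hUinv, hUR⟩ := h ι hι Rf' hprod
  refine ⟨fun j => Subtype.val ⁻¹' U j, Subtype.val ⁻¹' C, fun j => measurable_subtype_coe (hU j),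
    fun j => Set.subset_univ _, fun i j hij => (hUd hij).preimage _, measurable_subtype_coe hC, ?_,
    ?_, ?_, ?_⟩
  · rw [comap_subtype_coe_apply hs]
    refine measure_mono_null ?_ hC0
    rintro _ ⟨x, hx, rfl⟩
    exact hx
  · rintro x ⟨-, hx⟩
    obtain ⟨y, hy, hxy⟩ := hsec x ⟨hd ▸ trivial, hx⟩
    obtain ⟨j, hj⟩ := Set.mem_iUnion.1 hy
    exact ⟨⟨y, hinv _ _ hxy x.2⟩, Set.mem_iUnion.2 ⟨j, hj⟩, hxy⟩
  · exact fun i j x hx y hy hxy => hUinv i j x hx y hy hxy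
  · intro j x hx y hy
    refine (hUR j x hx y hy).trans ⟨fun h => (hstep _ _ _ x.2 h).2, fun h => .inl ⟨x.2, y.2, h⟩⟩

/-- Treeability of an orbit relation provides kernels on every invariant set. -/
theorem CBER.Treeable.hasKernels [StandardBorelSpace X] {G : Type} [Group G] [MulAction G X]
    [MulAction G s] (hval : ∀ (g : G) (x : s), ((g • x : s) : X) = g • (x : X)) {L₀ : Subgroup G}
    {R : CBER X} (hT : R.Treeable) (hd : R.dom = Set.univ)
    (hR : ∀ x y, R.rel x y ↔ SubRel X L₀ x y) : HasKernels s L₀ := by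
  obtain ⟨e, hem, hef, heo, heg⟩ := hT.exists_kernels hd
  have hinv : ∀ x y, R.rel x y → x ∈ s → y ∈ s := by
    intro x y hxy hx
    obtain ⟨g, -, rfl⟩ := (hR x y).1 hxy
    exact hval g ⟨x, hx⟩ ▸ (g • (⟨x, hx⟩ : s)).2
  have hsub : ∀ x y : s, R.rel x y ↔ SubRel s L₀ x y := by
    intro x y
    rw [hR]
    refine exists_congr fun g => and_congr_right fun _ => ?_
    rw [← hval, Subtype.ext_iff]
  refine ⟨fun k x => ⟨e k x, hinv _ _ (heo k x) x.2⟩,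
    fun k => ((hem k).comp measurable_subtype_coe).subtype_mk, ?_, ?_, ?_⟩
  · intro n x i hn hx0 hne hst
    exact hef n (fun j => x j) i hn (congrArg _ hx0) (fun j hj h => hne j hj (Subtype.ext h))
      fun j hj => congrArg Subtype.val (hst j hj)
  · exact fun k x => (hsub _ _).1 (heo k x)
  · intro y y' hyy'
    have key : ∀ a b : X, Relation.EqvGen (fun a b => ∃ k, e k a = e k b) a b → (a ∈ s ↔ b ∈ s) ∧
        ∀ (ha : a ∈ s) (hb : b ∈ s), Relation.EqvGen (fun a b : s => ∃ k,
          (⟨e k a, hinv _ _ (heo k a) a.2⟩ : s) = ⟨e k b, hinv _ _ (heo k b) b.2⟩)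
          ⟨a, ha⟩ ⟨b, hb⟩ := by
      intro a b h
      induction h with
      | rel a b h =>
        obtain ⟨k, hk⟩ := h
        have hab : R.rel a b := R.trans (heo k a) (R.symm (hk ▸ heo k b))
        exact ⟨⟨hinv _ _ hab, hinv _ _ (R.symm hab)⟩,
          fun ha hb => .rel _ _ ⟨k, Subtype.ext hk⟩⟩
      | refl => exact ⟨Iff.rfl, fun _ _ => .refl _⟩
      | symm _ _ _ ih => exact ⟨ih.1.symm, fun ha hb => (ih.2 hb ha).symm⟩
      | trans _ _ _ _ _ ih ih' =>
        exact ⟨ih.1.trans ih'.1, fun ha hc => (ih.2 ha (ih.1.1 ha)).trans _ _ _ (ih'.2 _ hc)⟩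
    exact (key _ _ (heg _ _ ((hsub _ _).2 hyy'))).2 y.2 y'.2

end Invariant

/-! ### Invariant conull sets on which a stable orbit equivalence is exact -/

section Good

set_option linter.unusedSectionVars false

variable (G : Type) {X : Type} [Group G] [Countable G] [MeasurableSpace X] [MulAction G X]

/-- The points with trivial stabilizer whose orbit meets `A` and avoids `W`. -/
def goodSet (A W : Set X) : Set X :=
  {x | (∀ g : G, g • x = x → g = 1) ∧ (∃ g : G, g • x ∈ A) ∧ ∀ g : G, g • x ∉ W}

variable {G}

theorem measurableSet_goodSet [StandardBorelSpace X] [MeasurableConstSMul G X] {A W : Set X}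
    (hA : MeasurableSet A) (hW : MeasurableSet W) : MeasurableSet (goodSet G A W) := by
  refine measurableSet_setOfPred.2 (.and (.forall fun g => ?_) (.and (.exists fun g => ?_)
    (.forall fun g => .not ?_)))
  · exact ((measurable_const_smul g).eqProp measurable_id).imp measurable_const
  · exact measurableSet_setOfPred.1 (measurable_const_smul g hA)
  · exact measurableSet_setOfPred.1 (measurable_const_smul g hW)

theorem smul_mem_goodSet {A W : Set X} (g : G) {x : X} (hx : x ∈ goodSet G A W) :
    g • x ∈ goodSet G A W := by
  obtain ⟨h1, ⟨k, hk⟩, h3⟩ := hx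
  refine ⟨fun l hl => ?_, ⟨k * g⁻¹, by rwa [mul_smul, inv_smul_smul]⟩, fun l => ?_⟩
  · have h := h1 (g⁻¹ * l * g) (by rw [mul_smul, mul_smul, hl, inv_smul_smul])
    rwa [mul_assoc, inv_mul_eq_one, eq_comm, mul_eq_right] at h
  · rw [← mul_smul]
    exact h3 _

theorem ae_smul_notMem [MeasurableConstSMul G X] {μ : Measure X} [SMulInvariantMeasure G X μ]
    {W : Set X} (hW : μ W = 0) : ∀ᵐ x ∂μ, ∀ g : G, g • x ∉ W := by
  refine ae_all_iff.2 fun g => ?_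
  rw [ae_iff]
  simp only [not_not]
  exact (measure_preimage_smul μ g W).trans hW

theorem measure_compl_goodSet [MeasurableConstSMul G X] {μ : Measure X}
    [SMulInvariantMeasure G X μ] {A W : Set X} (hf : ∀ᵐ x ∂μ, ∀ g : G, g • x = x → g = 1)
    (hA : ∀ᵐ x ∂μ, ∃ g : G, g • x ∈ A) (hW : μ W = 0) : μ (goodSet G A W)ᶜ = 0 := by
  have h : ∀ᵐ x ∂μ, x ∈ goodSet G A W := by
    filter_upwards [hf, hA, ae_smul_notMem (G := G) hW] with x h1 h2 h3
    exact ⟨h1, h2, h3⟩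
  exact h

end Good

section Clean

variable {G H X Y : Type} [Group G] [Group H] [Countable G] [Countable H]
  [MeasurableSpace X] [MeasurableSpace Y] [StandardBorelSpace X] [StandardBorelSpace Y]
  [MulAction G X] [MulAction H Y] [MeasurableConstSMul G X] [MeasurableConstSMul H Y]
  {μ : Measure X} {ν : Measure Y} [SMulInvariantMeasure G X μ] [SMulInvariantMeasure H Y ν]

theorem exists_invariant_sections {A C : Set X} {B : Set Y} {θ : X → Y} {θ' : Y → X} {c : ENNReal}
    (hfX : ∀ᵐ x ∂μ, ∀ g : G, g • x = x → g = 1) (hfY : ∀ᵐ y ∂ν, ∀ h : H, h • y = y → h = 1)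
    (hA : MeasurableSet A) (hB : MeasurableSet B) (hθ : Measurable θ) (hθ' : Measurable θ')
    (hAB : Set.MapsTo θ A B) (hBA : Set.MapsTo θ' B A) (hl : ∀ x ∈ A, θ' (θ x) = x)
    (hr : ∀ y ∈ B, θ (θ' y) = y) (hGA : ∀ᵐ x ∂μ, ∃ g : G, g • x ∈ A)
    (hHB : ∀ᵐ y ∂ν, ∃ h : H, h • y ∈ B) (hC : MeasurableSet C) (hAC : μ (A \ C) = 0)
    (hrel : ∀ x ∈ A ∩ C, ∀ x' ∈ A ∩ C, (∃ g : G, g • x = x') ↔ ∃ h : H, h • θ x = θ x')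
    (hc0 : c ≠ 0) (hm : ∀ E ⊆ A, MeasurableSet E → ν (θ '' E) = c * μ E) :
    ∃ (s A' : Set X) (t B' : Set Y), MeasurableSet s ∧ MeasurableSet A' ∧ MeasurableSet t ∧
      MeasurableSet B' ∧ (∀ (g : G), ∀ x ∈ s, g • x ∈ s) ∧ (∀ (h : H), ∀ y ∈ t, h • y ∈ t) ∧
      μ sᶜ = 0 ∧ ν tᶜ = 0 ∧ A' ⊆ A ∩ C ∧ A' ⊆ s ∧ B' ⊆ B ∧ B' ⊆ t ∧ Set.MapsTo θ A' B' ∧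
      Set.MapsTo θ' B' A' ∧ (∀ x ∈ s, ∃ g : G, g • x ∈ A') ∧ (∀ y ∈ t, ∃ h : H, h • y ∈ B') ∧
      (∀ x ∈ s, ∀ g : G, g • x = x → g = 1) ∧ ∀ y ∈ t, ∀ h : H, h • y = y → h = 1 := by
  set A₀ := A ∩ C with hA₀
  set B₀ := B ∩ θ' ⁻¹' A₀ with hB₀
  have hA₀m : MeasurableSet A₀ := hA.inter hC
  have hB₀m : MeasurableSet B₀ := hB.inter (hθ' hA₀m)
  have hGA₀ : ∀ᵐ x ∂μ, ∃ g : G, g • x ∈ A₀ := by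
    filter_upwards [hGA, ae_smul_notMem (G := G) hAC] with x hx hx'
    obtain ⟨g, hg⟩ := hx
    exact ⟨g, hg, by_contra fun h => hx' g ⟨hg, h⟩⟩
  have hBB : ν (B \ B₀) = 0 := by
    refine measure_mono_null (t := θ '' (A \ C)) ?_ ?_
    · rintro y ⟨hy, hy'⟩
      exact ⟨θ' y, ⟨hBA hy, fun h => hy' ⟨hy, hBA hy, h⟩⟩, hr y hy⟩
    · rw [hm _ Set.sdiff_subset (hA.diff hC), hAC, mul_zero]
  have hHB₀ : ∀ᵐ y ∂ν, ∃ h : H, h • y ∈ B₀ := by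
    filter_upwards [hHB, ae_smul_notMem (G := H) hBB] with x hx hx'
    obtain ⟨g, hg⟩ := hx
    exact ⟨g, by_contra fun h => hx' g ⟨hg, h⟩⟩
  have hX₀m := measurableSet_goodSet (G := G) hA₀m .empty
  have hY₀m := measurableSet_goodSet (G := H) hB₀m .empty
  have hX₀ := measure_compl_goodSet hfX hGA₀ (measure_empty (μ := μ))
  have hY₀ := measure_compl_goodSet hfY hHB₀ (measure_empty (μ := ν))
  set X₀ := goodSet G A₀ ∅
  set Y₀ := goodSet H B₀ ∅
  have hWX : μ (A₀ \ θ ⁻¹' Y₀) = 0 := by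
    have h1 := hm (A₀ \ θ ⁻¹' Y₀) (Set.sdiff_subset.trans Set.inter_subset_left)
      (hA₀m.diff (hθ hY₀m))
    have h2 : ν (θ '' (A₀ \ θ ⁻¹' Y₀)) = 0 := by
      refine measure_mono_null ?_ hY₀
      rintro _ ⟨x, hx, rfl⟩
      exact hx.2
    rw [h2, eq_comm, mul_eq_zero] at h1
    exact h1.resolve_left hc0
  have hWY : ν (B₀ \ θ' ⁻¹' X₀) = 0 := by
    refine measure_mono_null (t := θ '' (A₀ \ X₀)) ?_ ?_
    · rintro y ⟨hy, hy'⟩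
      exact ⟨θ' y, ⟨hy.2, hy'⟩, hr y hy.1⟩
    · rw [hm _ (Set.sdiff_subset.trans Set.inter_subset_left) (hA₀m.diff hX₀m),
        measure_mono_null (fun _ h => h.2) hX₀, mul_zero]
  set s := goodSet G A₀ (A₀ \ θ ⁻¹' Y₀) with hs
  set t := goodSet H B₀ (B₀ \ θ' ⁻¹' X₀) with ht
  have hsm : MeasurableSet s := measurableSet_goodSet hA₀m (hA₀m.diff (hθ hY₀m))
  have htm : MeasurableSet t := measurableSet_goodSet hB₀m (hB₀m.diff (hθ' hX₀m))
  have hθB : ∀ x ∈ A₀, θ x ∈ B₀ := fun x hx =>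
    ⟨hAB hx.1, by rw [Set.mem_preimage, hl x hx.1]; exact hx⟩
  refine ⟨s, A₀ ∩ s, t, B₀ ∩ t, hsm, hA₀m.inter hsm, htm, hB₀m.inter htm,
    fun g x hx => smul_mem_goodSet g hx, fun h y hy => smul_mem_goodSet h hy,
    measure_compl_goodSet hfX hGA₀ hWX, measure_compl_goodSet hfY hHB₀ hWY,
    Set.inter_subset_left, Set.inter_subset_right,
    Set.inter_subset_left.trans Set.inter_subset_left, Set.inter_subset_right, ?_, ?_, ?_, ?_,
    fun x hx => hx.1, fun y hy => hy.1⟩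
  · rintro x ⟨hx, hxs⟩
    have hY : θ x ∈ Y₀ := by
      by_contra hn
      exact hxs.2.2 1 (by rw [one_smul]; exact ⟨hx, hn⟩)
    refine ⟨hθB x hx, hY.1, hY.2.1, fun h hh => hh.2 ?_⟩
    have h1 : θ (θ' (h • θ x)) = h • θ x := hr _ hh.1.1
    obtain ⟨g, hg⟩ := (hrel x hx _ hh.1.2).2 ⟨h, h1.symm⟩
    rw [Set.mem_preimage, ← hg]
    exact smul_mem_goodSet g ⟨hxs.1, hxs.2.1, fun _ => id⟩
  · rintro y ⟨hy, hyt⟩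
    have hX : θ' y ∈ X₀ := by
      by_contra hn
      exact hyt.2.2 1 (by rw [one_smul]; exact ⟨hy, hn⟩)
    refine ⟨hy.2, hX.1, hX.2.1, fun g hg => hg.2 ?_⟩
    obtain ⟨h, hh⟩ := (hrel _ hy.2 _ hg.1).1 ⟨g, rfl⟩
    rw [Set.mem_preimage, ← hh, hr y hy.1]
    exact smul_mem_goodSet h ⟨hyt.1, hyt.2.1, fun _ => id⟩
  · intro x hx
    obtain ⟨g, hg⟩ := hx.2.1
    exact ⟨g, hg, smul_mem_goodSet g hx⟩
  · intro y hy
    obtain ⟨h, hh⟩ := hy.2.1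
    exact ⟨h, hh, smul_mem_goodSet h hy⟩

end Clean

section Subtype

set_option linter.unusedSectionVars false

variable {G X : Type} [Group G] [MeasurableSpace X] [MulAction G X] {s : Set X}

/-- The action on an invariant set. -/
@[reducible]
def invariantAction (hs : ∀ (g : G), ∀ x ∈ s, g • x ∈ s) : MulAction G s where
  smul g x := ⟨g • x, hs g x x.2⟩
  one_smul x := Subtype.ext (one_smul G (x : X))
  mul_smul g h x := Subtype.ext (mul_smul g h (x : X))

theorem measurableConstSMul_of_val [MeasurableConstSMul G X] [MulAction G s]
    (hval : ∀ (g : G) (x : s), ((g • x : s) : X) = g • (x : X)) : MeasurableConstSMul G s where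
  measurable_const_smul g := by
    have h : Measurable fun x : s => ((g • x : s) : X) := by
      simp only [hval]
      exact measurable_subtype_coe.const_smul g
    exact h.subtype_mk (h := fun x => (g • x).2)

theorem isProbabilityMeasure_comap_val {μ : Measure X} [IsProbabilityMeasure μ]
    (hs : MeasurableSet s) (hs0 : μ sᶜ = 0) :
    IsProbabilityMeasure (μ.comap (Subtype.val : s → X)) where
  measure_univ := by
    rw [comap_subtype_coe_apply hs, Set.image_univ, Subtype.range_coe]
    exact (prob_compl_eq_zero_iff hs).1 hs0

theorem smulInvariantMeasure_of_val {μ : Measure X} [MeasurableConstSMul G X]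
    [SMulInvariantMeasure G X μ] [MulAction G s]
    (hval : ∀ (g : G) (x : s), ((g • x : s) : X) = g • (x : X)) (hs : MeasurableSet s) :
    SMulInvariantMeasure G s (μ.comap (Subtype.val : s → X)) where
  measure_preimage_smul g E _ := by
    rw [comap_subtype_coe_apply hs, comap_subtype_coe_apply hs,
      ← measure_preimage_smul μ g (Subtype.val '' E)]
    congr 1
    ext x
    constructor
    · rintro ⟨x, hx, rfl⟩
      exact ⟨g • x, hx, hval g x⟩
    · rintro ⟨y, hy, e⟩
      refine ⟨g⁻¹ • y, ?_, ?_⟩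
      · rwa [Set.mem_preimage, smul_inv_smul]
      · rw [hval, e, inv_smul_smul]

theorem subRel_val_iff [MulAction G s] (hval : ∀ (g : G) (x : s), ((g • x : s) : X) = g • (x : X))
    (L : Subgroup G) (x y : s) : SubRel X L x y ↔ SubRel s L x y := by
  refine exists_congr fun g => and_congr_right fun _ => ?_
  rw [← hval, Subtype.ext_iff]

end Subtype

theorem exists_measurable_map_subtype {X Y : Type} [MeasurableSpace X] [MeasurableSpace Y]
    {s A : Set X} {t : Set Y} {θ : X → Y} (hA : MeasurableSet A) (hθ : Measurable θ)
    (ht : t.Nonempty) (h : Set.MapsTo θ A t) :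
    ∃ θ₁ : s → t, Measurable θ₁ ∧ ∀ x : s, (x : X) ∈ A → (θ₁ x : Y) = θ x := by
  classical
  obtain ⟨y, hy⟩ := ht
  refine ⟨fun x => ⟨if (x : X) ∈ A then θ x else y, ?_⟩, ?_, fun x hx => if_pos hx⟩
  · split_ifs with hx
    · exact h hx
    · exact hy
  · have h1 : Measurable fun x : X => if x ∈ A then θ x else y :=
      Measurable.ite (p := fun x => x ∈ A) hA hθ measurable_const
    exact (h1.comp measurable_subtype_coe).subtype_mk

/-- A stable orbit equivalence between essentially free actions of free products yields, up to
null sets, a measure preserving isomorphism preserving the orbits and the orbits of the two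
distinguished factors. -/
theorem exists_isomorphism_of_sections {G H X Y P Q : Type} [Group G] [Group H] [Countable G]
    [Countable H] [MulAction G X] [MulAction H Y] [MeasurableSpace X] [MeasurableSpace Y]
    [StandardBorelSpace X] [StandardBorelSpace Y] [MeasurableConstSMul G X]
    [MeasurableConstSMul H Y] {μ : Measure X} {ν : Measure Y} [IsProbabilityMeasure μ]
    [IsProbabilityMeasure ν] [SMulInvariantMeasure G X μ] [SMulInvariantMeasure H Y ν]
    [Nonempty P] [Countable P] [Nonempty Q] [Countable Q]
    {A C : Set X} {B : Set Y} {θ : X → Y} {θ' : Y → X} {c : ENNReal}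
    (hfX : ∀ᵐ x ∂μ, ∀ g : G, g • x = x → g = 1) (hfY : ∀ᵐ y ∂ν, ∀ h : H, h • y = y → h = 1)
    (hA : MeasurableSet A) (hB : MeasurableSet B) (hθ : Measurable θ) (hθ' : Measurable θ')
    (hAB : Set.MapsTo θ A B) (hBA : Set.MapsTo θ' B A) (hl : ∀ x ∈ A, θ' (θ x) = x)
    (hr : ∀ y ∈ B, θ (θ' y) = y) (hGA : ∀ᵐ x ∂μ, ∃ g : G, g • x ∈ A)
    (hHB : ∀ᵐ y ∂ν, ∃ h : H, h • y ∈ B) (hC : MeasurableSet C) (hAC : μ (A \ C) = 0)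
    (hrel : ∀ x ∈ A ∩ C, ∀ x' ∈ A ∩ C, (∃ g : G, g • x = x') ↔ ∃ h : H, h • θ x = θ x')
    (hc0 : c ≠ 0) (hct : c ≠ ⊤) (hm : ∀ E ⊆ A, MeasurableSet E → ν (θ '' E) = c * μ E)
    {Γ : P → Subgroup G} {Γ₀ : Subgroup G} {Λ : Q → Subgroup H} {Λ₀ : Subgroup H}
    (hG : IsFreeProductOf G (fun i : Option P => i.elim Γ₀ Γ))
    (hH : IsFreeProductOf H (fun j : Option Q => j.elim Λ₀ Λ))
    (hΓinf : ∀ p, Infinite (Γ p)) (hΛinf : ∀ q, Infinite (Λ q))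
    {RΓ : P → CBER X} {RΛ : Q → CBER Y} {RΓ₀ : CBER X} {RΛ₀ : CBER Y}
    (hdX : ∀ p, (RΓ p).dom = Set.univ) (hdY : ∀ q, (RΛ q).dom = Set.univ)
    (hdX₀ : RΓ₀.dom = Set.univ) (hdY₀ : RΛ₀.dom = Set.univ)
    (hRX : ∀ p x y, (RΓ p).rel x y ↔ SubRel X (Γ p) x y)
    (hRY : ∀ q x y, (RΛ q).rel x y ↔ SubRel Y (Λ q) x y)
    (hRX₀ : ∀ x y, RΓ₀.rel x y ↔ SubRel X Γ₀ x y) (hRY₀ : ∀ x y, RΛ₀.rel x y ↔ SubRel Y Λ₀ x y)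
    (hFIΓ : ∀ p, FreelyIndecomposableMod μ (RΓ p)) (hFIΛ : ∀ q, FreelyIndecomposableMod ν (RΛ q))
    (hTΓ₀ : RΓ₀.Treeable) (hTΛ₀ : RΛ₀.Treeable) {p₀ : P} {q₀ : Q}
    (hME : MEwithIndex (Γ p₀) (Λ q₀) 1)
    (hnMEΓ : ∀ p, p ≠ p₀ → ¬ MeasureEquivalent (Γ p₀) (Γ p))
    (hnMEΛ : ∀ q, q ≠ q₀ → ¬ MeasureEquivalent (Γ p₀) (Λ q))
    (hIME : ∀ κ : ENNReal, MEwithIndex (Γ p₀) (Γ p₀) κ → κ = 1) :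
    ∃ (A : Set X) (φ : X → Y), MeasurableSet A ∧ μ Aᶜ = 0 ∧ Measurable φ ∧ Set.InjOn φ A ∧
      (∀ E ⊆ A, MeasurableSet E → ν (φ '' E) = μ E) ∧ ∀ x ∈ A, ∀ x' ∈ A,
        (SubRel X (⊤ : Subgroup G) x x' ↔ SubRel Y (⊤ : Subgroup H) (φ x) (φ x')) ∧
        (SubRel X (Γ p₀) x x' ↔ SubRel Y (Λ q₀) (φ x) (φ x')) := by
  obtain ⟨s, A', t, B', hs, hA', ht, hB', hsi, hti, hs0, ht0, hA'A, hA's, hB'B, hB't, hAB', hBA',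
    hsA, htB, hsf, htf⟩ := exists_invariant_sections hfX hfY hA hB hθ hθ' hAB hBA hl hr hGA hHB hC
      hAC hrel hc0 hm
  let _ : MulAction G s := invariantAction hsi
  let _ : MulAction H t := invariantAction hti
  have hvs : ∀ (g : G) (x : s), ((g • x : s) : X) = g • (x : X) := fun _ _ => rfl
  have hvt : ∀ (h : H) (y : t), ((h • y : t) : Y) = h • (y : Y) := fun _ _ => rfl
  have := measurableConstSMul_of_val hvs
  have := measurableConstSMul_of_val hvt
  have := isProbabilityMeasure_comap_val hs hs0
  have := isProbabilityMeasure_comap_val ht ht0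
  have := smulInvariantMeasure_of_val (μ := μ) hvs hs
  have := smulInvariantMeasure_of_val (μ := ν) hvt ht
  have := hs.standardBorel
  have := ht.standardBorel
  have hsne : s.Nonempty := by
    rw [Set.nonempty_iff_ne_empty]
    rintro rfl
    simp at hs0
  have htne : t.Nonempty := by
    rw [Set.nonempty_iff_ne_empty]
    rintro rfl
    simp at ht0
  obtain ⟨θ₁, hθ₁, hθ₁e⟩ := exists_measurable_map_subtype (s := s) hA' hθ htne
    (hAB'.mono_right hB't)
  obtain ⟨θ₂, hθ₂, hθ₂e⟩ := exists_measurable_map_subtype (s := t) hB' hθ' hsne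
    (hBA'.mono_right hA's)
  obtain ⟨O⟩ : Nonempty (OrbitMap G H (μ.comap (Subtype.val : s → X))
      (ν.comap (Subtype.val : t → Y))) := by
    refine exists_orbitMap_of_section (A := Subtype.val ⁻¹' A') (B := Subtype.val ⁻¹' B')
      (θ := θ₁) (θ' := θ₂) (c := c) (measurable_subtype_coe hA') (measurable_subtype_coe hB') hθ₁
      hθ₂ ?_ ?_ ?_ ?_ (fun x => hsA x x.2) (fun y => htB y y.2) ?_ hc0 hct ?_
    · intro x hx
      rw [Set.mem_preimage, hθ₁e x hx]
      exact hAB' hx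
    · intro y hy
      rw [Set.mem_preimage, hθ₂e y hy]
      exact hBA' hy
    · intro x hx
      have h1 := hθ₁e x hx
      refine Subtype.ext ?_
      rw [hθ₂e _ (by rw [h1]; exact hAB' hx), h1, hl _ (hA'A hx).1]
    · intro y hy
      have h1 := hθ₂e y hy
      refine Subtype.ext ?_
      rw [hθ₁e _ (by rw [h1]; exact hBA' hy), h1, hr _ (hB'B hy)]
    · intro x hx x' hx'
      have h := hrel x (hA'A hx) x' (hA'A hx')
      rw [← hθ₁e x hx, ← hθ₁e x' hx'] at h
      simpa only [Subtype.ext_iff, hvs, hvt] using h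
    · intro E hE hEm
      rw [comap_subtype_coe_apply hs, comap_subtype_coe_apply ht, ← hm]
      · congr 1
        rw [Set.image_image, Set.image_image]
        exact Set.image_congr fun x hx => hθ₁e x (hE hx)
      · rintro _ ⟨x, hx, rfl⟩
        exact (hA'A (hE hx)).1
      · exact (MeasurableEmbedding.subtype_coe hs).measurableSet_image.2 hEm
  have hfs : FreeAct G s := fun x g h => hsf x x.2 g (congrArg Subtype.val h)
  have hft : FreeAct H t := fun x g h => htf x x.2 g (congrArg Subtype.val h)
  have hiX : ∀ p x y, (RΓ p).rel x y → x ∈ s → y ∈ s := by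
    intro p x y hxy hx
    obtain ⟨g, -, rfl⟩ := (hRX p x y).1 hxy
    exact hsi g x hx
  have hiY : ∀ q x y, (RΛ q).rel x y → x ∈ t → y ∈ t := by
    intro q x y hxy hx
    obtain ⟨g, -, rfl⟩ := (hRY q x y).1 hxy
    exact hti g x hx
  obtain ⟨v, u, X₁, Y₁, m, hX₁, hY₁⟩ := O.exists_match hfs hft hG hH hΓinf hΛinf
    (hTΓ₀.hasKernels hvs hdX₀ hRX₀) (hTΛ₀.hasKernels hvt hdY₀ hRY₀)
    (RΓ := fun p => (RΓ p).onSubtype (hdX p) s) (RΛ := fun q => (RΛ q).onSubtype (hdY q) t)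
    (fun _ => rfl) (fun _ => rfl)
    (fun p x y => (hRX p x y).trans (subRel_val_iff hvs _ _ _))
    (fun q x y => (hRY q x y).trans (subRel_val_iff hvt _ _ _))
    (fun p => (hFIΓ p).onSubtype hs (hiX p) (hdX p))
    (fun q => (hFIΛ q).onSubtype ht (hiY q) (hdY q)) ⟨hME.choose⟩ hnMEΓ hnMEΛ
  obtain ⟨D, φ, hD, hD0, hφ, hφi, hφm, hφr⟩ := m.exists_isomorphism hX₁ hY₁ hfs hft hME hIME
  have hYne : Nonempty Y := ⟨htne.some⟩
  obtain ⟨ψ, hψ, hψe⟩ := (MeasurableEmbedding.subtype_coe hs).exists_measurable_extend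
    (measurable_subtype_coe.comp hφ) fun _ => hYne
  have hψφ : ∀ x : s, ψ x = φ x := congrFun hψe
  refine ⟨Subtype.val '' D, ψ, (MeasurableEmbedding.subtype_coe hs).measurableSet_image.2 hD, ?_, hψ,
    ?_, ?_, ?_⟩
  · rw [comap_subtype_coe_apply hs] at hD0
    refine measure_mono_null ?_ (measure_union_null hs0 hD0)
    intro x hx
    by_cases hxs : x ∈ s
    · exact .inr ⟨⟨x, hxs⟩, fun h => hx ⟨_, h, rfl⟩, rfl⟩
    · exact .inl hxs
  · rintro _ ⟨x, hx, rfl⟩ _ ⟨x', hx', rfl⟩ e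
    rw [hψφ, hψφ] at e
    rw [hφi hx hx' (Subtype.ext e)]
  · intro E hE hEm
    have h1 := hφm (Subtype.val ⁻¹' E) (by
      intro x hx
      obtain ⟨x', hx', e⟩ := hE hx
      rwa [← Subtype.ext e]) (measurable_subtype_coe hEm)
    have h2 : Subtype.val '' (Subtype.val ⁻¹' E : Set s) = E := by
      rw [Subtype.image_preimage_coe, Set.inter_eq_right]
      intro x hx
      obtain ⟨x', -, rfl⟩ := hE hx
      exact x'.2
    have h3 : Subtype.val '' (φ '' (Subtype.val ⁻¹' E : Set s)) = ψ '' E := by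
      conv_rhs => rw [← h2]
      rw [Set.image_image, Set.image_image]
      exact Set.image_congr fun x _ => (hψφ x).symm
    rwa [comap_subtype_coe_apply hs, comap_subtype_coe_apply ht, h2, h3] at h1
  · rintro _ ⟨x, hx, rfl⟩ _ ⟨x', hx', rfl⟩
    rw [hψφ, hψφ, subRel_val_iff hvs, subRel_val_iff hvs, subRel_val_iff hvt, subRel_val_iff hvt]
    exact hφr x hx x' hx'

/-- A measurable isomorphism which preserves the measure and, on a conull set, the relations is an
orbit equivalence. -/
theorem OE.of_measurableEquiv {X Y : Type} [MeasurableSpace X] [MeasurableSpace Y] {R : CBER X}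
    {S : CBER Y} {μ : Measure X} {ν : Measure Y} [IsProbabilityMeasure μ] [IsProbabilityMeasure ν]
    (hR : R.dom = Set.univ) (hS : S.dom = Set.univ) (f : X ≃ᵐ Y)
    (hf : ∀ E, MeasurableSet E → ν (f '' E) = μ E) {C : Set X} (hC : MeasurableSet C)
    (hC0 : μ Cᶜ = 0) (h : ∀ x ∈ C, ∀ y ∈ C, R.rel x y ↔ S.rel (f x) (f y)) : OE R μ S ν :=
  ⟨{  A := Set.univ
      B := Set.univ
      toFun := f
      invFun := f.symm
      measA := .univ
      measB := .univ
      A_sub := hR.ge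
      B_sub := hS.ge
      A_pos := by simp
      B_pos := by simp
      A_section := .of_forall fun x hx => ⟨x, trivial, R.refl x hx⟩
      B_section := .of_forall fun y hy => ⟨y, trivial, S.refl y hy⟩
      meas_toFun := f.measurable
      meas_invFun := f.symm.measurable
      mapsTo := Set.mapsTo_univ _ _
      mapsTo_inv := Set.mapsTo_univ _ _
      left_inv := fun x _ => f.symm_apply_apply x
      right_inv := fun y _ => f.apply_symm_apply y
      measure_eq := fun E _ hE => by rw [hf E hE, measure_univ, measure_univ]
      rel_iff := ⟨C, hC, by rwa [← Set.compl_eq_univ_sdiff], fun x hx y hy => h x hx.2 y hy.2⟩ },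
    rfl, rfl⟩

/-- The action underlying a measure preserving action. -/
@[reducible]
def PMPAction.toMulAction {G X : Type} [Group G] [MeasurableSpace X] {μ : Measure X}
    (α : PMPAction G X μ) : MulAction G X where
  smul := α.act
  one_smul := α.act_one
  mul_smul := α.act_mul

/-- In the Framework, if `Γ₁ ∼ME Λ₁` with generalized index 1, `Γ₁` is not ME
to the other factors, and all ME self-couplings of `Γ₁` have index 1, then the SOE actions
are in fact orbit equivalent, and so are the restrictions to `Γ₁` and `Λ₁`. -/
theorem SOE_is_OE_of_IME_trivial
    {X Y : Type} [MeasurableSpace X] [StandardBorelSpace X]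
    [MeasurableSpace Y] [StandardBorelSpace Y]
    (μ : MeasureTheory.Measure X) [MeasureTheory.IsProbabilityMeasure μ]
    (ν : MeasureTheory.Measure Y) [MeasureTheory.IsProbabilityMeasure ν]
    {G H : Type} [Group G] [Countable G] [Group H] [Countable H]
    {P Q : Type} [Nonempty P] [Countable P] [Nonempty Q] [Countable Q]
    (Γ : P → Subgroup G) (Γ₀ : Subgroup G) (Λ : Q → Subgroup H) (Λ₀ : Subgroup H)
    (hG : IsFreeProductOf G (fun i : Option P => i.elim Γ₀ Γ))
    (hH : IsFreeProductOf H (fun j : Option Q => j.elim Λ₀ Λ))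
    (hΓinf : ∀ p, Infinite (Γ p)) (hΛinf : ∀ q, Infinite (Λ q))
    (α : PMPAction G X μ) (β : PMPAction H Y ν)
    (hαfree : α.IsFree) (hβfree : β.IsFree)
    (Rα : CBER X) (Rβ : CBER Y)
    (hRα : IsOrbitRel α ⊤ Rα) (hRβ : IsOrbitRel β ⊤ Rβ)
    (RΓ : P → CBER X) (RΛ : Q → CBER Y) (RΓ₀ : CBER X) (RΛ₀ : CBER Y)
    (hRΓ : ∀ p, IsOrbitRel α (Γ p) (RΓ p)) (hRΛ : ∀ q, IsOrbitRel β (Λ q) (RΛ q))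
    (hRΓ₀ : IsOrbitRel α Γ₀ RΓ₀) (hRΛ₀ : IsOrbitRel β Λ₀ RΛ₀)
    (hFIΓ : ∀ p, FreelyIndecomposableMod μ (RΓ p))
    (hFIΛ : ∀ q, FreelyIndecomposableMod ν (RΛ q))
    (hTΓ₀ : RΓ₀.Treeable) (hTΛ₀ : RΛ₀.Treeable)
    (hsoe : SOE Rα μ Rβ ν)
    (p₀ : P) (q₀ : Q)
    (hME1 : MEwithIndex (↥(Γ p₀)) (↥(Λ q₀)) 1)
    (hnMEΓ : ∀ p, p ≠ p₀ → ¬ MeasureEquivalent (↥(Γ p₀)) (↥(Γ p)))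
    (hnMEΛ : ∀ q, q ≠ q₀ → ¬ MeasureEquivalent (↥(Γ p₀)) (↥(Λ q)))
    (hIME : ∀ κ : ENNReal, MEwithIndex (↥(Γ p₀)) (↥(Γ p₀)) κ → κ = 1) :
    OE Rα μ Rβ ν ∧ OE (RΓ p₀) μ (RΛ q₀) ν := by
  obtain ⟨Θ⟩ := hsoe
  let _ : MulAction G X := α.toMulAction
  let _ : MulAction H Y := β.toMulAction
  have : MeasurableConstSMul G X := ⟨fun g => (α.measurePreserving g).measurable⟩
  have : MeasurableConstSMul H Y := ⟨fun h => (β.measurePreserving h).measurable⟩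
  have : SMulInvariantMeasure G X μ :=
    ⟨fun g _ hE => (α.measurePreserving g).measure_preimage hE.nullMeasurableSet⟩
  have : SMulInvariantMeasure H Y ν :=
    ⟨fun h _ hE => (β.measurePreserving h).measure_preimage hE.nullMeasurableSet⟩
  have hαrel : ∀ x x', Rα.rel x x' ↔ ∃ g : G, g • x = x' := fun x x' =>
    (hRα.2 x x').trans (exists_congr fun g => and_iff_right (Subgroup.mem_top g))
  have hβrel : ∀ y y', Rβ.rel y y' ↔ ∃ h : H, h • y = y' := fun y y' =>
    (hRβ.2 y y').trans (exists_congr fun g => and_iff_right (Subgroup.mem_top g))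
  obtain ⟨C, hC, hAC, hrel⟩ := Θ.rel_iff
  obtain ⟨A, φ, hA, hA0, hφ, hφi, hφm, hφr⟩ := exists_isomorphism_of_sections (C := C)
    (c := ν Θ.B * (μ Θ.A)⁻¹) hαfree hβfree Θ.measA Θ.measB Θ.meas_toFun Θ.meas_invFun Θ.mapsTo
    Θ.mapsTo_inv Θ.left_inv Θ.right_inv
    (by
      filter_upwards [Θ.A_section] with x hx
      obtain ⟨y, hy, hxy⟩ := hx (hRα.1 ▸ trivial)
      obtain ⟨g, rfl⟩ := (hαrel x y).1 hxy
      exact ⟨g, hy⟩)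
    (by
      filter_upwards [Θ.B_section] with x hx
      obtain ⟨y, hy, hxy⟩ := hx (hRβ.1 ▸ trivial)
      obtain ⟨g, rfl⟩ := (hβrel x y).1 hxy
      exact ⟨g, hy⟩)
    hC hAC (fun x hx x' hx' => by rw [← hαrel, ← hβrel]; exact hrel x hx x' hx')
    (mul_ne_zero Θ.B_pos.ne' (ENNReal.inv_ne_zero.2 (measure_ne_top _ _)))
    (ENNReal.mul_ne_top (measure_ne_top _ _) (ENNReal.inv_ne_top.2 Θ.A_pos.ne'))
    (fun E hE hEm => by
      rw [mul_assoc, Θ.measure_eq E hE hEm, ← mul_assoc,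
        ENNReal.mul_inv_cancel Θ.B_pos.ne' (measure_ne_top _ _), one_mul])
    hG hH hΓinf hΛinf (fun p => (hRΓ p).1) (fun q => (hRΛ q).1) hRΓ₀.1 hRΛ₀.1
    (fun p => (hRΓ p).2) (fun q => (hRΛ q).2) hRΓ₀.2 hRΛ₀.2 hFIΓ hFIΛ hTΓ₀ hTΛ₀ hME1 hnMEΓ hnMEΛ
    hIME
  have hGinf : Infinite G := .of_injective _ (Γ p₀).subtype_injective
  have hHinf : Infinite H := .of_injective _ (Λ q₀).subtype_injective
  obtain ⟨f, A', hA'A, hA', hA'0, hfφ, hfm⟩ := exists_measurableEquiv_extension hαfree.not_countable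
    hβfree.not_countable hA hA0 hφ hφi hφm
  constructor
  · refine OE.of_measurableEquiv hRα.1 hRβ.1 f hfm hA' hA'0 fun x hx y hy => ?_
    rw [hfφ x hx, hfφ y hy]
    exact ((hRα.2 x y).trans (hφr x (hA'A hx) y (hA'A hy)).1).trans (hRβ.2 _ _).symm
  · refine OE.of_measurableEquiv (hRΓ p₀).1 (hRΛ q₀).1 f hfm hA' hA'0 fun x hx y hy => ?_
    rw [hfφ x hx, hfφ y hy]
    exact (((hRΓ p₀).2 x y).trans (hφr x (hA'A hx) y (hA'A hy)).2).trans ((hRΛ q₀).2 _ _).symm
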